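/- arXiv:2512.16398 — 2 statements merged into one kernel-verified Lean document; each statement's English description precedes it below -/
import Mathlib

section
/- Let D(r) denote the number of graphs on the labeled vertex set {1,…,r} that are inducibility diverse. Then D(r)/2^{r(r−1)/2} → 1 as r → ∞; that is, asymptotically almost surely a uniformly random graph on r vertices is inducibility diverse. -/
open Filter Topology

/-- The number of `|V(F)|`-element subsets of the vertex set of `G` that induce a
subgraph isomorphic to `F`. -/
noncomputable def inducedCount {α β : Type*} [Fintype α] [Fintype β]
    (F : SimpleGraph α) (G : SimpleGraph β) : ℕ :=
  Set.ncard {s : Finset β | s.card = Fintype.card α ∧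
    Nonempty (F ≃g SimpleGraph.induce (↑s : Set β) G)}

/-- The induced density `p(F,G) = P(F,G)/C(n,r)`. -/
noncomputable def inducedDensity {α β : Type*} [Fintype α] [Fintype β]
    (F : SimpleGraph α) (G : SimpleGraph β) : ℝ :=
  (inducedCount F G : ℝ) / ((Fintype.card β).choose (Fintype.card α))

/-- `i_k(F,n)`: the maximum induced density of `F` over `K_k`-free graphs on `n` vertices. -/
noncomputable def ikn {α : Type*} [Fintype α] (F : SimpleGraph α) (k n : ℕ) : ℝ :=
  sSup {x : ℝ | ∃ G : SimpleGraph (Fin n), G.CliqueFree k ∧ x = inducedDensity F G}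

/-- `i_k(F) = lim_{n → ∞} i_k(F,n)`. -/
noncomputable def ik {α : Type*} [Fintype α] (F : SimpleGraph α) (k : ℕ) : ℝ :=
  limUnder atTop (fun n => ikn F k n)

/-- A graph `F` is inducibility diverse if for every `k` there is `m > k`
with `i_k(F) < i_m(F)`. -/
def InducibilityDiverse {α : Type*} [Fintype α] (F : SimpleGraph α) : Prop :=
  ∀ k : ℕ, ∃ m : ℕ, k < m ∧ ik F k < ik F m

/-- The expectation of `f` when the coordinates are drawn independently with weights `w`. -/
noncomputable def tupleMean {ι V : Type*} [Fintype ι] [DecidableEq ι] [Fintype V] (w : V → ℝ)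
    (f : (ι → V) → ℝ) : ℝ :=
  ∑ Y, (∏ v, w (Y v)) * f Y

open Classical in
/-- The total weight of the tuples satisfying `p`. -/
noncomputable def tupleProb {ι V : Type*} [Fintype ι] [DecidableEq ι] [Fintype V] (w : V → ℝ)
    (p : (ι → V) → Prop) : ℝ :=
  tupleMean w (fun Y => if p Y then 1 else 0)

open Classical in
/-- The total weight of the vertices satisfying `p`. -/
noncomputable def mass {V : Type*} [Fintype V] (w : V → ℝ) (p : V → Prop) : ℝ :=
  ∑ y, w y * (if p y then 1 else 0)

section Tuples

variable {ι V : Type*} [Fintype ι] [DecidableEq ι] [Fintype V] {w : V → ℝ}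

lemma tupleMean_mono (hw : ∀ y, 0 ≤ w y) {f g : (ι → V) → ℝ} (h : ∀ Y, f Y ≤ g Y) :
    tupleMean w f ≤ tupleMean w g :=
  Finset.sum_le_sum fun Y _ => mul_le_mul_of_nonneg_left (h Y) (Finset.prod_nonneg fun _ _ => hw _)

lemma tupleMean_prod (g : ι → V → ℝ) :
    tupleMean w (fun Y => ∏ v, g v (Y v)) = ∏ v, ∑ y, w y * g v y := by
  classical
  rw [Finset.prod_univ_sum, Fintype.piFinset_univ]
  simp only [tupleMean, Finset.prod_mul_distrib]

lemma tupleMean_const (hw1 : ∑ y, w y = 1) (a : ℝ) :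
    tupleMean w (fun _ : ι → V => a) = a := by
  have := tupleMean_prod (ι := ι) (w := w) (fun _ _ => 1)
  simp only [Finset.prod_const_one, mul_one, hw1, tupleMean] at this
  rw [tupleMean, ← Finset.sum_mul, this, one_mul]

lemma tupleMean_resample (hw1 : ∑ y, w y = 1) (Q : Finset ι) (f : (ι → V) → ℝ) :
    tupleMean w f = tupleMean w (fun t => tupleMean w (fun Y => f (Q.piecewise t Y))) := by
  have inv : Function.Involutive
      (fun p : (ι → V) × (ι → V) => (Q.piecewise p.1 p.2, Q.piecewise p.2 p.1)) := by
    rintro ⟨a, b⟩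
    simp only [Prod.mk.injEq]
    constructor <;> ext v <;> by_cases hv : v ∈ Q <;> simp [hv]
  have hprod : ∀ a b : ι → V, (∏ v, w (a v)) * (∏ v, w (b v)) =
      (∏ v, w (Q.piecewise a b v)) * (∏ v, w (Q.piecewise b a v)) := by
    intro a b
    rw [← Finset.prod_mul_distrib, ← Finset.prod_mul_distrib]
    refine Finset.prod_congr rfl fun v _ => ?_
    by_cases hv : v ∈ Q <;> simp [hv, mul_comm]
  have h1 : tupleMean w (fun t => tupleMean w (fun Y => f (Q.piecewise t Y))) =
      ∑ p : (ι → V) × (ι → V), (∏ v, w (p.1 v)) * (∏ v, w (p.2 v)) * f (Q.piecewise p.1 p.2) := by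
    rw [Fintype.sum_prod_type]
    simp only [tupleMean, Finset.mul_sum, mul_assoc]
  have h2 : (∑ p : (ι → V) × (ι → V), (∏ v, w (p.1 v)) * (∏ v, w (p.2 v)) * f p.1) =
      tupleMean w f := by
    rw [Fintype.sum_prod_type]
    have := tupleMean_const (ι := ι) hw1 1
    simp only [tupleMean, mul_one] at this
    simp only [mul_right_comm, ← Finset.mul_sum, this, tupleMean, mul_one]
  rw [h1, ← h2, ← Equiv.sum_comp (inv.toPerm _)]
  refine Finset.sum_congr rfl fun p _ => ?_
  simp only [Function.Involutive.coe_toPerm]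
  rw [← hprod]

lemma tupleProb_mono (hw : ∀ y, 0 ≤ w y) {p q : (ι → V) → Prop} (h : ∀ Y, p Y → q Y) :
    tupleProb w p ≤ tupleProb w q := by
  classical
  refine tupleMean_mono hw fun Y => ?_
  by_cases hp : p Y
  · simp [hp, h Y hp]
  · simp only [hp, if_false]; split_ifs <;> norm_num

lemma tupleProb_nonneg (hw : ∀ y, 0 ≤ w y) (p : (ι → V) → Prop) : 0 ≤ tupleProb w p := by
  classical
  refine Finset.sum_nonneg fun Y _ => mul_nonneg (Finset.prod_nonneg fun v _ => hw _) ?_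
  dsimp only
  split_ifs <;> norm_num

lemma tupleProb_true (hw1 : ∑ y, w y = 1) : tupleProb w (fun _ : ι → V => True) = 1 := by
  simpa [tupleProb] using tupleMean_const (ι := ι) hw1 1

lemma tupleProb_le_one (hw : ∀ y, 0 ≤ w y) (hw1 : ∑ y, w y = 1) (p : (ι → V) → Prop) :
    tupleProb w p ≤ 1 := by
  rw [← tupleProb_true (ι := ι) hw1]
  exact tupleProb_mono hw fun _ _ => trivial

lemma tupleProb_le_add (hw : ∀ y, 0 ≤ w y) {p q s : (ι → V) → Prop}
    (h : ∀ Y, p Y → q Y ∨ s Y) : tupleProb w p ≤ tupleProb w q + tupleProb w s := by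
  classical
  rw [tupleProb, tupleProb, tupleProb, tupleMean, tupleMean, tupleMean, ← Finset.sum_add_distrib]
  refine Finset.sum_le_sum fun Y _ => ?_
  rw [← mul_add]
  refine mul_le_mul_of_nonneg_left ?_ (Finset.prod_nonneg fun v _ => hw _)
  by_cases hp : p Y
  · rcases h Y hp with h | h <;> simp only [hp, h, if_true] <;> split_ifs <;> norm_num
  · simp only [hp, if_false]; split_ifs <;> norm_num

lemma tupleProb_add_le (hw : ∀ y, 0 ≤ w y) {p q s : (ι → V) → Prop}
    (hp : ∀ Y, p Y → s Y) (hq : ∀ Y, q Y → s Y) (hpq : ∀ Y, p Y → ¬ q Y) :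
    tupleProb w p + tupleProb w q ≤ tupleProb w s := by
  classical
  rw [tupleProb, tupleProb, tupleProb, tupleMean, tupleMean, tupleMean, ← Finset.sum_add_distrib]
  refine Finset.sum_le_sum fun Y _ => ?_
  rw [← mul_add]
  refine mul_le_mul_of_nonneg_left ?_ (Finset.prod_nonneg fun v _ => hw _)
  by_cases h1 : p Y
  · simp [h1, hpq Y h1, hp Y h1]
  · by_cases h2 : q Y
    · simp [h1, h2, hq Y h2]
    · simp only [h1, h2, if_false]; split_ifs <;> norm_num

lemma tupleProb_le_sum {κ : Type*} [Fintype κ] (hw : ∀ y, 0 ≤ w y) {p : (ι → V) → Prop}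
    {q : κ → (ι → V) → Prop} (h : ∀ Y, p Y → ∃ k, q k Y) :
    tupleProb w p ≤ ∑ k, tupleProb w (q k) := by
  classical
  simp only [tupleProb, tupleMean]
  rw [Finset.sum_comm]
  refine Finset.sum_le_sum fun Y _ => ?_
  rw [← Finset.mul_sum]
  refine mul_le_mul_of_nonneg_left ?_ (Finset.prod_nonneg fun v _ => hw _)
  by_cases hp : p Y
  · obtain ⟨k, hk⟩ := h Y hp
    simp only [hp, if_true]
    refine le_trans ?_ (Finset.single_le_sum (f := fun k => if q k Y then (1:ℝ) else 0)
      (fun k _ => by split_ifs <;> norm_num) (Finset.mem_univ k))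
    simp [hk]
  · simp only [hp, if_false]
    exact Finset.sum_nonneg fun k _ => by split_ifs <;> norm_num

lemma tupleProb_resample (hw1 : ∑ y, w y = 1) (Q : Finset ι) (p : (ι → V) → Prop) :
    tupleProb w p = tupleMean w (fun t => tupleProb w (fun Y => p (Q.piecewise t Y))) :=
  tupleMean_resample hw1 Q _

lemma tupleProb_le_of_resample (hw : ∀ y, 0 ≤ w y) (hw1 : ∑ y, w y = 1) (Q : Finset ι)
    {p : (ι → V) → Prop} {b : ℝ} (h : ∀ t, tupleProb w (fun Y => p (Q.piecewise t Y)) ≤ b) :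
    tupleProb w p ≤ b := by
  rw [tupleProb_resample hw1 Q, ← tupleMean_const (ι := ι) hw1 b]
  exact tupleMean_mono hw h

lemma exists_le_tupleProb_piecewise (hw : ∀ y, 0 ≤ w y) (hw1 : ∑ y, w y = 1) (Q : Finset ι)
    (p : (ι → V) → Prop) :
    ∃ t, tupleProb w p ≤ tupleProb w (fun Y => p (Q.piecewise t Y)) := by
  by_contra! h
  have hne : Nonempty (ι → V) := by
    by_contra hne
    rw [not_nonempty_iff] at hne
    have := tupleProb_true (ι := ι) hw1
    simp [tupleProb, tupleMean] at this
  obtain ⟨t, -, ht⟩ := Finset.exists_max_image Finset.univ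
    (fun t => tupleProb w (fun Y => p (Q.piecewise t Y))) Finset.univ_nonempty
  have := tupleProb_le_of_resample hw hw1 Q (p := p) fun t' => ht t' (Finset.mem_univ _)
  exact absurd this (not_le.2 (h t))

lemma mass_mono (hw : ∀ y, 0 ≤ w y) {p q : V → Prop} (h : ∀ y, p y → q y) :
    mass w p ≤ mass w q := by
  classical
  refine Finset.sum_le_sum fun y _ => mul_le_mul_of_nonneg_left ?_ (hw y)
  by_cases hp : p y
  · simp [hp, h y hp]
  · simp only [hp, if_false]; split_ifs <;> norm_num

lemma mass_nonneg (hw : ∀ y, 0 ≤ w y) (p : V → Prop) : 0 ≤ mass w p := by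
  classical
  refine Finset.sum_nonneg fun y _ => mul_nonneg (hw y) ?_
  split_ifs <;> norm_num

lemma mass_le_add (hw : ∀ y, 0 ≤ w y) {p q s : V → Prop} (h : ∀ y, p y → q y ∨ s y) :
    mass w p ≤ mass w q + mass w s := by
  classical
  rw [mass, mass, mass, ← Finset.sum_add_distrib]
  refine Finset.sum_le_sum fun y _ => ?_
  rw [← mul_add]
  refine mul_le_mul_of_nonneg_left ?_ (hw _)
  by_cases hp : p y
  · rcases h y hp with h | h <;> simp only [hp, h, if_true] <;> split_ifs <;> norm_num
  · simp only [hp, if_false]; split_ifs <;> norm_num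

lemma mass_not (hw1 : ∑ y, w y = 1) (p : V → Prop) : mass w (fun y => ¬ p y) = 1 - mass w p := by
  classical
  rw [eq_sub_iff_add_eq, mass, mass, ← Finset.sum_add_distrib]
  refine Eq.trans ?_ hw1
  refine Finset.sum_congr rfl fun y _ => ?_
  by_cases hp : p y <;> simp [hp]

lemma mass_le_one (hw : ∀ y, 0 ≤ w y) (hw1 : ∑ y, w y = 1) (p : V → Prop) : mass w p ≤ 1 := by
  have := mass_not hw1 p
  linarith [mass_nonneg hw fun y => ¬ p y]

lemma tupleProb_forall (q : ι → V → Prop) :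
    tupleProb w (fun Y => ∀ v, q v (Y v)) = ∏ v, mass w (q v) := by
  classical
  have := tupleMean_prod (w := w) (fun v y => if q v y then (1:ℝ) else 0)
  unfold mass
  rw [← this, tupleProb]
  congr 1
  ext Y
  rw [Finset.prod_ite_zero]
  simp

end Tuples

lemma prod_le_sum_div_card_pow {ι : Type*} (s : Finset ι) (z : ι → ℝ) (hz : ∀ i ∈ s, 0 ≤ z i) :
    ∏ i ∈ s, z i ≤ ((∑ i ∈ s, z i) / s.card) ^ s.card := by
  rcases s.eq_empty_or_nonempty with rfl | hs
  · simp
  have hc : (0:ℝ) < s.card := by exact_mod_cast hs.card_pos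
  have h := Real.geom_mean_le_arith_mean s (fun _ => 1) z (fun _ _ => zero_le_one)
    (by simpa using hc) hz
  simp only [Real.rpow_one, Finset.sum_const, nsmul_eq_mul, mul_one, one_mul] at h
  have hp : 0 ≤ ∏ i ∈ s, z i := Finset.prod_nonneg hz
  calc ∏ i ∈ s, z i = ((∏ i ∈ s, z i) ^ ((s.card : ℝ)⁻¹)) ^ s.card := by
        rw [← Real.rpow_natCast, ← Real.rpow_mul hp, inv_mul_cancel₀ hc.ne', Real.rpow_one]
    _ ≤ _ := pow_le_pow_left₀ (Real.rpow_nonneg hp _) h _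

/-- The vertices in `D` tell all other vertices of `F` apart. -/
def Separating {ι : Type*} (F : SimpleGraph ι) (D : Finset ι) : Prop :=
  ∀ u v, u ∉ D → v ∉ D → u ≠ v → ∃ x ∈ D, ¬ (F.Adj u x ↔ F.Adj v x)

lemma adj_iff_of_comap_eq {ι V : Type*} {F : SimpleGraph ι} {G : SimpleGraph V} {Y : ι → V}
    (h : G.comap Y = F) (u v : ι) : G.Adj (Y u) (Y v) ↔ F.Adj u v := by
  rw [← h]; rfl

section Copies

variable {ι V : Type*} [Fintype ι] [DecidableEq ι] [Fintype V] {w : V → ℝ}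
  {F : SimpleGraph ι} {G : SimpleGraph V} {D Q : Finset ι}

open Classical in
lemma tupleMean_copy_le (hw : ∀ y, 0 ≤ w y) (hw1 : ∑ y, w y = 1) (hD : Separating F D)
    (hQ : D ⊆ Q) (t : ι → V) (g : V → ℝ) (hg : ∀ y, 0 ≤ g y) :
    tupleMean w (fun Y => if G.comap (Q.piecewise t Y) = F then ∏ u ∈ Qᶜ, g (Y u) else 0) ≤
      ((∑ y, w y * g y) / (Qᶜ).card) ^ (Qᶜ).card := by
  set A : ι → V → Prop := fun u y => ∀ x ∈ D, (G.Adj y (t x) ↔ F.Adj u x) with hA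
  set k : ι → V → ℝ := fun u y => if u ∈ Q then 1 else if A u y then g y else 0 with hk
  have hk0 : ∀ u y, 0 ≤ k u y := by
    intro u y; simp only [hk]; split_ifs <;> simp [hg]
  have h1 : tupleMean w (fun Y => if G.comap (Q.piecewise t Y) = F then ∏ u ∈ Qᶜ, g (Y u) else 0)
      ≤ tupleMean w (fun Y => ∏ u, k u (Y u)) := by
    refine tupleMean_mono hw fun Y => ?_
    split_ifs with hc
    · rw [← Finset.prod_mul_prod_compl Q]
      have e1 : ∏ u ∈ Q, k u (Y u) = 1 := Finset.prod_eq_one fun u hu => by simp [hk, hu]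
      rw [e1, one_mul]
      refine le_of_eq (Finset.prod_congr rfl fun u hu => ?_)
      rw [Finset.mem_compl] at hu
      have : A u (Y u) := by
        intro x hx
        have := adj_iff_of_comap_eq hc u x
        rwa [Finset.piecewise_eq_of_notMem _ _ _ hu, Finset.piecewise_eq_of_mem _ _ _ (hQ hx)]
          at this
      simp [hk, hu, this]
    · exact Finset.prod_nonneg fun u _ => hk0 _ _
  refine h1.trans ?_
  rw [tupleMean_prod, ← Finset.prod_mul_prod_compl Q]
  have e1 : ∏ u ∈ Q, ∑ y, w y * k u y = 1 :=
    Finset.prod_eq_one fun u hu => by simp [hk, hu, hw1]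
  rw [e1, one_mul]
  refine (prod_le_sum_div_card_pow _ _ fun u _ =>
    Finset.sum_nonneg fun y _ => mul_nonneg (hw y) (hk0 _ _)).trans ?_
  refine pow_le_pow_left₀ (div_nonneg (Finset.sum_nonneg fun u _ =>
    Finset.sum_nonneg fun y _ => mul_nonneg (hw y) (hk0 _ _)) (Nat.cast_nonneg _)) ?_ _
  refine div_le_div_of_nonneg_right ?_ (Nat.cast_nonneg _)
  rw [Finset.sum_comm]
  refine Finset.sum_le_sum fun y _ => ?_
  rw [← Finset.mul_sum]
  refine mul_le_mul_of_nonneg_left ?_ (hw y)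
  by_cases hex : ∃ u ∈ Qᶜ, A u y
  · obtain ⟨u, hu, hAu⟩ := hex
    rw [Finset.sum_eq_single_of_mem u hu]
    · rw [Finset.mem_compl] at hu
      simp [hk, hu, hAu]
    · intro v hv hvu
      rw [Finset.mem_compl] at hu hv
      have : ¬ A v y := by
        intro hAv
        obtain ⟨x, hx, hne⟩ := hD u v (fun h => hu (hQ h)) (fun h => hv (hQ h)) hvu.symm
        exact hne ((hAu x hx).symm.trans (hAv x hx))
      simp [hk, hv, this]
  · push Not at hex
    rw [Finset.sum_eq_zero]
    · exact hg y
    · intro u hu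
      have := hex u hu
      rw [Finset.mem_compl] at hu
      simp [hk, hu, this]

lemma tupleProb_copy_avoid_le (hw : ∀ y, 0 ≤ w y) (hw1 : ∑ y, w y = 1) (hD : Separating F D)
    (hQ : D ⊆ Q) (t : ι → V) (B : V → Prop) {κ : ℝ} (hκ : κ ≤ mass w B) :
    tupleProb w (fun Y => G.comap (Q.piecewise t Y) = F ∧ ∀ u, u ∉ Q → ¬ B (Y u)) ≤
      ((1 - κ) / (Qᶜ).card) ^ (Qᶜ).card := by
  classical
  refine le_trans (le_trans (tupleMean_mono hw fun Y => ?_)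
    (tupleMean_copy_le hw hw1 hD hQ t (fun y => if B y then 0 else 1)
      (fun y => by split_ifs <;> norm_num) (G := G))) ?_
  · by_cases hc : G.comap (Q.piecewise t Y) = F
    · by_cases h : ∀ u, u ∉ Q → ¬ B (Y u)
      · rw [if_pos ⟨hc, h⟩, if_pos hc]
        refine le_of_eq (Finset.prod_eq_one fun u hu => ?_).symm
        rw [if_neg (h u (Finset.mem_compl.1 hu))]
      · rw [if_neg (fun hh => h hh.2), if_pos hc]
        exact Finset.prod_nonneg fun u _ => by split_ifs <;> norm_num
    · rw [if_neg (fun hh => hc hh.1), if_neg hc]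
  · have e : (∑ y, w y * (if B y then 0 else 1)) = 1 - mass w B := by
      rw [← mass_not hw1, mass]
      refine Finset.sum_congr rfl fun y _ => ?_
      by_cases h : B y <;> simp [h]
    rw [e]
    refine pow_le_pow_left₀ (div_nonneg ?_ (Nat.cast_nonneg _)) ?_ _
    · linarith [mass_le_one hw hw1 B]
    · exact div_le_div_of_nonneg_right (by linarith) (Nat.cast_nonneg _)

open Classical in
lemma tupleProb_copy_many_le (hw : ∀ y, 0 ≤ w y) (hw1 : ∑ y, w y = 1) (hD : Separating F D)
    (hQ : D ⊆ Q) (t : ι → V) (B : V → Prop) {κ : ℝ} (hκ : mass w B ≤ κ) (k : ℝ) :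
    tupleProb w (fun Y => G.comap (Q.piecewise t Y) = F ∧
        k ≤ ((Finset.univ.filter fun u => B (Q.piecewise t Y u)).card : ℝ)) ≤
      Real.exp (Q.card - k) * ((1 + 2 * κ) / (Qᶜ).card) ^ (Qᶜ).card := by
  set g : V → ℝ := fun y => if B y then Real.exp 1 else 1 with hgdef
  have hg1 : ∀ y, 1 ≤ g y := by
    intro y; simp only [hgdef]; split_ifs
    · exact Real.one_le_exp zero_le_one
    · exact le_rfl
  have hg : ∀ y, 0 ≤ g y := fun y => zero_le_one.trans (hg1 y)
  have key := tupleMean_copy_le hw hw1 hD hQ t g hg (G := G)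
  have step : tupleProb w (fun Y => G.comap (Q.piecewise t Y) = F ∧
        k ≤ ((Finset.univ.filter fun u => B (Q.piecewise t Y u)).card : ℝ)) ≤
      Real.exp (Q.card - k) * tupleMean w
        (fun Y => if G.comap (Q.piecewise t Y) = F then ∏ u ∈ Qᶜ, g (Y u) else 0) := by
    rw [tupleProb, tupleMean, tupleMean, Finset.mul_sum]
    refine Finset.sum_le_sum fun Y _ => ?_
    rw [mul_left_comm]
    refine mul_le_mul_of_nonneg_left ?_ (Finset.prod_nonneg fun v _ => hw _)
    by_cases hc : G.comap (Q.piecewise t Y) = F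
    · rw [if_pos hc]
      have hpos : 0 ≤ ∏ u ∈ Qᶜ, g (Y u) := Finset.prod_nonneg fun u _ => hg _
      split_ifs with h
      · have hk := h.2
        have h2 : (Finset.univ.filter fun u => B (Q.piecewise t Y u)).card ≤
            Q.card + (Qᶜ.filter fun u => B (Y u)).card := by
          rw [← Finset.card_union_add_card_inter]
          refine le_trans (Finset.card_le_card ?_) (Nat.le_add_right _ _)
          intro u hu
          by_cases huQ : u ∈ Q
          · simp [huQ]
          · simp [huQ] at hu ⊢
            exact hu
        have h3 : ∏ u ∈ Qᶜ, g (Y u) = Real.exp ((Qᶜ.filter fun u => B (Y u)).card) := by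
          simp only [hgdef]
          rw [Finset.prod_ite]
          simp [← Real.exp_nat_mul]
        rw [h3, ← Real.exp_add]
        refine Real.one_le_exp ?_
        have h2' : ((Finset.univ.filter fun u => B (Q.piecewise t Y u)).card : ℝ) ≤
            Q.card + (Qᶜ.filter fun u => B (Y u)).card := by exact_mod_cast h2
        linarith
      · exact mul_nonneg (Real.exp_nonneg _) hpos
    · rw [if_neg (fun hh => hc hh.1), if_neg hc, mul_zero]
  refine step.trans (mul_le_mul_of_nonneg_left (key.trans ?_) (Real.exp_nonneg _))
  refine pow_le_pow_left₀ (div_nonneg (Finset.sum_nonneg fun y _ => mul_nonneg (hw y) (hg y))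
    (Nat.cast_nonneg _)) (div_le_div_of_nonneg_right ?_ (Nat.cast_nonneg _)) _
  have e : ∑ y, w y * g y = 1 + (Real.exp 1 - 1) * mass w B := by
    have e2 : ∑ y, w y * g y - ∑ y, w y = (Real.exp 1 - 1) * mass w B := by
      rw [mass, Finset.mul_sum, ← Finset.sum_sub_distrib]
      refine Finset.sum_congr rfl fun y _ => ?_
      simp only [hgdef]
      split_ifs <;> ring
    rw [hw1] at e2
    linarith
  rw [e]
  have he : Real.exp 1 - 1 ≤ 2 := by linarith [Real.exp_one_lt_d9]
  have := mass_nonneg hw B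
  nlinarith

end Copies

/-- The pseudorandomness properties of `F` used in the argument. -/
structure Typical {ι : Type*} [Fintype ι] [DecidableEq ι] (F : SimpleGraph ι) (D : Finset ι)
    (K : ℕ) : Prop where
  sep : Separating F D
  twin_free : ∀ u v, u ≠ v → ∃ x, ¬ (F.Adj u x ↔ F.Adj v x)
  rigid : ∀ (R : Finset ι) (τ : ι → ι), Rᶜ.card < K →
    (∀ u, (R.filter fun v => τ v = u).card < K) → (∃ v ∈ R, τ v ≠ v) →
    ∃ v ∈ R, ∃ S : Finset ι, K ≤ S.card ∧
      ∀ u ∈ S, u ∈ R ∧ τ u ≠ τ v ∧ ¬ (F.Adj v u ↔ F.Adj (τ v) (τ u))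
  prime : ∀ τ : ι → ι, τ ≠ id → (∃ u v, τ u ≠ τ v) →
    ∃ u v, τ u ≠ τ v ∧ ¬ (F.Adj u v ↔ F.Adj (τ u) (τ v))

/-- The numerical relations between the parameters of the structure theorem. -/
structure Scale {ι : Type*} [Fintype ι] [DecidableEq ι] (D : Finset ι) (K : ℕ) (κ ν : ℝ) :
    Prop where
  avoid : ∀ Q : Finset ι, Q.card ≤ D.card + 3 → ((1 - κ) / (Qᶜ).card) ^ (Qᶜ).card ≤ ν
  many : ∀ Q : Finset ι, Q.card ≤ D.card + 3 →
    Fintype.card ι * (Real.exp (Q.card - K) * ((1 + 2 * (4 * κ)) / (Qᶜ).card) ^ (Qᶜ).card) ≤ ν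
  pos : 0 < ν
  nonneg : 0 ≤ κ

/-- The two given vertices form an irregularity of the partition `φ`. -/
def Irregular {ι V : Type*} (F : SimpleGraph ι) (G : SimpleGraph V) (φ : V → ι) (y z : V) :
    Prop :=
  φ z ≠ φ y ∧ ¬ (G.Adj y z ↔ F.Adj (φ y) (φ z))

/-- The vertices that cannot serve together with `y` in a copy respecting `φ`. -/
def Obstructs {ι V : Type*} (F : SimpleGraph ι) (G : SimpleGraph V) (φ : V → ι) (Z : V → Prop)
    (y y' : V) : Prop :=
  Z y' ∨ (¬ Z y ∧ (φ y' = φ y ∨ Irregular F G φ y y'))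

open Classical in
/-- Every member of the tuple is obstructed by fewer than `K` others. -/
def Tame {ι V : Type*} [Fintype ι] (F : SimpleGraph ι) (G : SimpleGraph V) (φ : V → ι)
    (Z : V → Prop) (K : ℕ) (Y : ι → V) : Prop :=
  ∀ v, (Finset.univ.filter fun u => Obstructs F G φ Z (Y v) (Y u)).card < K

lemma piecewise_piecewise_left {ι V : Type*} [DecidableEq ι] {P Q : Finset ι} (h : P ⊆ Q) (t t' Y : ι → V) :
    P.piecewise t (Q.piecewise t' Y) = Q.piecewise (P.piecewise t t') Y := by
  ext v
  by_cases hP : v ∈ P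
  · simp [hP, h hP]
  · by_cases hQ : v ∈ Q <;> simp [hP, hQ]

lemma mass_obstructs_le {ι V : Type*} [Fintype V] {w : V → ℝ} {F : SimpleGraph ι}
    {G : SimpleGraph V} {κ : ℝ} (hw : ∀ y, 0 ≤ w y) (hκ : 0 ≤ κ) {φ : V → ι} {Z : V → Prop}
    (h1 : ∀ y, ¬ Z y → mass w (fun y' => ¬ Z y' ∧ Irregular F G φ y y') ≤ κ)
    (h2 : mass w Z ≤ κ) (h3 : ∀ u, mass w (fun y => ¬ Z y ∧ φ y = u) ≤ κ) (y : V) :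
    mass w (Obstructs F G φ Z y) ≤ 4 * κ := by
  by_cases hy : Z y
  · refine le_trans (mass_mono hw (q := Z) fun y' h => ?_) (by linarith)
    exact h.resolve_right fun h => h.1 hy
  · have e1 := mass_le_add hw (p := Obstructs F G φ Z y) (q := Z)
      (s := fun y' => (¬ Z y' ∧ φ y' = φ y) ∨ (¬ Z y' ∧ Irregular F G φ y y')) (by
        intro y' h
        by_cases hy' : Z y'
        · exact Or.inl hy'
        · rcases h with h | ⟨-, h | h⟩
          · exact Or.inl h
          · exact Or.inr (Or.inl ⟨hy', h⟩)
          · exact Or.inr (Or.inr ⟨hy', h⟩))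
    have e2 := mass_le_add hw (p := fun y' => (¬ Z y' ∧ φ y' = φ y) ∨
      (¬ Z y' ∧ Irregular F G φ y y')) (fun y' h => h)
    have := h1 y hy
    have := h3 (φ y)
    linarith

section Structure

variable {ι V : Type*} [Fintype ι] [DecidableEq ι]
  {F : SimpleGraph ι} {G : SimpleGraph V} {D : Finset ι} {K : ℕ} {κ ν : ℝ}

lemma apply_eq_of_tame (hF : Typical F D K) {φ : V → ι} {Z : V → Prop} {Y : ι → V}
    (hY : G.comap Y = F) (ht : Tame F G φ Z K Y) (v : ι) (hv : ¬ Z (Y v)) : φ (Y v) = v := by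
  classical
  by_contra hne
  have hK : 0 < K := (Nat.zero_le _).trans_lt (ht v)
  obtain ⟨x, hx, S, hS, hS'⟩ := hF.rigid (Finset.univ.filter fun v => ¬ Z (Y v)) (fun v => φ (Y v))
    (by
      refine lt_of_le_of_lt (Finset.card_le_card ?_) (ht v)
      intro u hu
      simp only [Finset.mem_compl, Finset.mem_filter, Finset.mem_univ, true_and, not_not] at hu ⊢
      exact Or.inl hu)
    (by
      intro u
      rcases Finset.eq_empty_or_nonempty
        ((Finset.univ.filter fun v => ¬ Z (Y v)).filter fun v => φ (Y v) = u) with h | ⟨x, hx⟩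
      · rw [h]; simpa using hK
      · refine lt_of_le_of_lt (Finset.card_le_card ?_) (ht x)
        intro y hy
        simp only [Finset.mem_filter, Finset.mem_univ, true_and] at hx hy ⊢
        exact Or.inr ⟨hx.1, Or.inl (hy.2.trans hx.2.symm)⟩)
    ⟨v, by simpa using hv, hne⟩
  refine absurd (ht x) (not_lt.2 (hS.trans (Finset.card_le_card ?_)))
  intro u hu
  obtain ⟨-, h2, h3⟩ := hS' u hu
  simp only [Finset.mem_filter, Finset.mem_univ, true_and] at hx ⊢
  exact Or.inr ⟨hx, Or.inr ⟨h2, by rwa [adj_iff_of_comap_eq hY]⟩⟩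

variable [Fintype V] {w : V → ℝ}

lemma tupleProb_not_tame_le (hw : ∀ y, 0 ≤ w y) (hw1 : ∑ y, w y = 1) (hF : Typical F D K)
    (hsc : Scale D K κ ν) {φ : V → ι} {Z : V → Prop}
    (hB : ∀ y, mass w (Obstructs F G φ Z y) ≤ 4 * κ) (P : Finset ι) (hP : P.card ≤ 2)
    (t : ι → V) :
    tupleProb w (fun Y => G.comap (P.piecewise t Y) = F ∧ ¬ Tame F G φ Z K (P.piecewise t Y)) ≤
      ν := by
  classical
  rcases isEmpty_or_nonempty ι with hι | hι
  · refine le_trans (le_of_eq ?_) hsc.pos.le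
    rw [tupleProb, tupleMean]
    refine Finset.sum_eq_zero fun Y _ => ?_
    rw [if_neg, mul_zero]
    rintro ⟨-, h⟩
    exact h fun v => (hι.false v).elim
  have hr : (0:ℝ) < Fintype.card ι := by exact_mod_cast Fintype.card_pos
  refine (tupleProb_le_sum (κ := ι) hw (q := fun v Y => G.comap (P.piecewise t Y) = F ∧
    (K:ℝ) ≤ ((Finset.univ.filter fun u =>
      Obstructs F G φ Z (P.piecewise t Y v) (P.piecewise t Y u)).card : ℝ)) ?_).trans ?_
  · rintro Y ⟨h1, h2⟩
    simp only [Tame, not_forall, not_lt] at h2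
    obtain ⟨v, hv⟩ := h2
    exact ⟨v, h1, by exact_mod_cast hv⟩
  · have key : ∀ v : ι, tupleProb w (fun Y => G.comap (P.piecewise t Y) = F ∧
      (K:ℝ) ≤ ((Finset.univ.filter fun u =>
      Obstructs F G φ Z (P.piecewise t Y v) (P.piecewise t Y u)).card : ℝ)) ≤
        ν / Fintype.card ι := by
      intro v
      have hPQ : P ⊆ insert v (D ∪ P) := fun x hx => by simp [hx]
      have hDQ : D ⊆ insert v (D ∪ P) := fun x hx => by simp [hx]
      refine tupleProb_le_of_resample hw hw1 (insert v (D ∪ P)) fun t' => ?_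
      simp only [piecewise_piecewise_left hPQ]
      have hvQ : ∀ Y, (insert v (D ∪ P)).piecewise (P.piecewise t t') Y v = P.piecewise t t' v :=
        fun Y => Finset.piecewise_eq_of_mem _ _ _ (Finset.mem_insert_self _ _)
      simp only [hvQ]
      refine (tupleProb_copy_many_le hw hw1 hF.sep hDQ _ _ (hB _) K).trans ?_
      rw [le_div_iff₀ hr, mul_comm]
      refine hsc.many _ ?_
      have h1 := Finset.card_insert_le v (D ∪ P)
      have h2 := Finset.card_union_le D P
      omega
    refine (Finset.sum_le_sum fun v _ => key v).trans (le_of_eq ?_)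
    rw [Finset.sum_const, Finset.card_univ, nsmul_eq_mul]
    field_simp

lemma tupleProb_avoid_le (hw : ∀ y, 0 ≤ w y) (hw1 : ∑ y, w y = 1) (hF : Typical F D K)
    (hsc : Scale D K κ ν) (P : Finset ι) (hP : P ⊆ D) (t : ι → V) (v : ι)
    (p : (ι → V) → Prop) (B : V → Prop) (hB : κ ≤ mass w B)
    (h : ∀ Y, G.comap (P.piecewise t Y) = F → p Y → ∀ u, u ∉ D → u ≠ v → ¬ B (Y u)) :
    tupleProb w (fun Y => G.comap (P.piecewise t Y) = F ∧ p Y) ≤ ν := by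
  classical
  have hDQ : D ⊆ insert v D := Finset.subset_insert _ _
  refine tupleProb_le_of_resample hw hw1 (insert v D) fun t' => ?_
  refine le_trans (tupleProb_mono hw fun Y hY => ?_)
    ((tupleProb_copy_avoid_le hw hw1 hF.sep hDQ (P.piecewise t t') B hB (G := G)).trans
      (hsc.avoid _ ?_))
  · refine ⟨by rw [← piecewise_piecewise_left (hP.trans hDQ)]; exact hY.1, fun u hu => ?_⟩
    have := h _ hY.1 hY.2 u (fun h => hu (hDQ h)) (fun h => hu (by simp [h]))
    rwa [Finset.piecewise_eq_of_notMem _ _ _ hu] at this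
  · have h1 := Finset.card_insert_le v D
    omega

lemma exists_initial_partition [Nonempty ι] (hw : ∀ y, 0 ≤ w y) (hw1 : ∑ y, w y = 1)
    (hF : Typical F D K) (hsc : Scale D K κ ν) {ρ : ℝ} (hρ : 2 * Fintype.card ι * ν < ρ)
    (hρ' : ρ ≤ tupleProb w (fun Y : ι → V => G.comap Y = F)) :
    ∃ (φ : V → ι) (Z : V → Prop),
      (∀ y, ¬ Z y → mass w (fun y' => ¬ Z y' ∧ Irregular F G φ y y') ≤ κ) ∧
      mass w Z ≤ κ ∧ ∀ u, mass w (fun y => ¬ Z y ∧ φ y = u) ≤ κ := by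
  classical
  have hr : (1:ℝ) ≤ Fintype.card ι := by exact_mod_cast Fintype.card_pos
  have hν := hsc.pos
  obtain ⟨t, ht⟩ := exists_le_tupleProb_piecewise hw hw1 D (fun Y : ι → V => G.comap Y = F)
  set A : ι → V → Prop := fun u y => u ∉ D ∧ ∀ x ∈ D, (G.Adj y (t x) ↔ F.Adj u x) with hA
  have hAuniq : ∀ u v y, A u y → A v y → u = v := by
    intro u v y hu hv
    by_contra hne
    obtain ⟨x, hx, h⟩ := hF.sep u v hu.1 hv.1 hne
    exact h ((hu.2 x hx).symm.trans (hv.2 x hx))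
  set φ : V → ι := fun y => if h : ∃ u, A u y then h.choose else Classical.arbitrary ι with hφ
  have hφA : ∀ u y, A u y → φ y = u := by
    intro u y h
    have hex : ∃ u, A u y := ⟨u, h⟩
    simp only [hφ, hex, dif_pos]
    exact hAuniq _ _ y hex.choose_spec h
  have hcopyA : ∀ Y, G.comap (D.piecewise t Y) = F → ∀ u, u ∉ D → A u (Y u) := by
    intro Y hY u hu
    refine ⟨hu, fun x hx => ?_⟩
    have := adj_iff_of_comap_eq hY u x
    rwa [Finset.piecewise_eq_of_notMem _ _ _ hu, Finset.piecewise_eq_of_mem _ _ _ hx] at this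
  have hcopyAdj : ∀ Y, G.comap (D.piecewise t Y) = F → ∀ u v, u ∉ D → v ∉ D →
      (G.Adj (Y u) (Y v) ↔ F.Adj u v) := by
    intro Y hY u v hu hv
    have := adj_iff_of_comap_eq hY u v
    rwa [Finset.piecewise_eq_of_notMem _ _ _ hu, Finset.piecewise_eq_of_notMem _ _ _ hv] at this
  set Z : V → Prop := fun y => (¬ ∃ u, A u y) ∨
    κ < mass w (fun y' => (∃ u, A u y') ∧ Irregular F G φ y y') with hZ
  have hbad : ∀ v, tupleProb w (fun Y => G.comap (D.piecewise t Y) = F ∧ (v ∉ D ∧ Z (Y v))) ≤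
      ν := by
    intro v
    refine tupleProb_le_of_resample hw hw1 {v} fun t' => ?_
    have hv' : ∀ Y : ι → V, ({v} : Finset ι).piecewise t' Y v = t' v := fun Y => by simp
    simp only [hv']
    by_cases hvD : v ∈ D
    · refine le_trans (le_of_eq ?_) hν.le
      simp [tupleProb, tupleMean, hvD]
    have hpw : ∀ Y : ι → V, D.piecewise t (({v} : Finset ι).piecewise t' Y) =
        (insert v D).piecewise (D.piecewise t t') Y := by
      intro Y
      ext x
      by_cases hx : x ∈ D
      · simp [hx]
      · by_cases hxv : x = v
        · subst hxv; simp [hx]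
        · simp [hx, hxv]
    by_cases hex : (∃ u, A u (t' v)) ∧ Z (t' v)
    · obtain ⟨hex, hZv⟩ := hex
      have hm : κ ≤ mass w (fun y' => (∃ u, A u y') ∧ Irregular F G φ (t' v) y') := by
        rcases hZv with h | h
        · exact absurd hex h
        · exact h.le
      refine le_trans (tupleProb_mono hw fun Y hY => ?_)
        ((tupleProb_copy_avoid_le hw hw1 hF.sep (Finset.subset_insert v D)
        (D.piecewise t t') _ hm (G := G)).trans (hsc.avoid _ ?_))
      · have hc := hY.1
        refine ⟨by rw [← hpw]; exact hc, fun u hu => ?_⟩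
        rw [Finset.mem_insert, not_or] at hu
        have h1 := hφA _ _ (hcopyA _ hc u hu.2)
        have h2 := hφA _ _ (hcopyA _ hc v hvD)
        have h3 := hcopyAdj _ hc v u hvD hu.2
        have e : ({v} : Finset ι).piecewise t' Y u = Y u := by simp [hu.1]
        rw [e] at h1 h3
        rw [hv'] at h2 h3
        rintro ⟨-, -, h⟩
        rw [h1, h2] at h
        exact h h3
      · have h1 := Finset.card_insert_le v D
        omega
    · refine le_trans (tupleProb_mono hw (q := fun _ => False) fun Y hY => ?_) ?_
      · refine hex ⟨?_, hY.2.2⟩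
        have := hcopyA _ hY.1 v hvD
        rw [hv'] at this
        exact ⟨v, this⟩
      · simp [tupleProb, tupleMean, hν.le]
  have hgood : ρ - Fintype.card ι * ν ≤
      tupleProb w (fun Y => G.comap (D.piecewise t Y) = F ∧ ∀ u, u ∉ D → ¬ Z (Y u)) := by
    have h1 := tupleProb_le_add hw (p := fun Y => G.comap (D.piecewise t Y) = F)
      (q := fun Y => G.comap (D.piecewise t Y) = F ∧ ∀ u, u ∉ D → ¬ Z (Y u))
      (s := fun Y => ∃ v, G.comap (D.piecewise t Y) = F ∧ (v ∉ D ∧ Z (Y v))) (by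
        intro Y hY
        by_cases h : ∀ u, u ∉ D → ¬ Z (Y u)
        · exact Or.inl ⟨hY, h⟩
        · push Not at h
          obtain ⟨u, hu⟩ := h
          exact Or.inr ⟨u, hY, hu⟩)
    have h2 := tupleProb_le_sum hw (p := fun Y => ∃ v, G.comap (D.piecewise t Y) = F ∧
      (v ∉ D ∧ Z (Y v))) (q := fun v Y => G.comap (D.piecewise t Y) = F ∧ (v ∉ D ∧ Z (Y v)))
      (fun Y h => h)
    have h3 := Finset.sum_le_sum fun v (_ : v ∈ Finset.univ) => hbad v
    rw [Finset.sum_const, Finset.card_univ, nsmul_eq_mul] at h3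
    linarith
  have hlt : ν < ρ - Fintype.card ι * ν := by nlinarith
  refine ⟨φ, Z, fun y hy => ?_, ?_, fun u => ?_⟩
  · simp only [hZ, not_or, not_lt] at hy
    refine le_trans (mass_mono hw fun y' h => ⟨?_, h.2⟩) hy.2
    have := h.1
    simp only [hZ, not_or, not_not] at this
    exact this.1
  · by_contra! h
    have := tupleProb_avoid_le hw hw1 hF hsc D le_rfl t (Classical.arbitrary ι)
      (fun Y => ∀ u, u ∉ D → ¬ Z (Y u)) Z h.le (G := G) fun Y _ h u hu _ => h u hu
    linarith
  · by_contra! h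
    have := tupleProb_avoid_le hw hw1 hF hsc D le_rfl t u
      (fun Y => ∀ u, u ∉ D → ¬ Z (Y u)) _ h.le (G := G) fun Y hc _ v hv hvu h => by
        have := hφA _ _ (hcopyA _ hc v hv)
        exact hvu (this.symm.trans h.2)
    linarith

/-- If every vertex of a weighted graph lies in many copies of a typical graph `F`, then the
graph resembles a blow-up of `F`. -/
theorem exists_regular_partition [Nonempty ι] (hw : ∀ y, 0 ≤ w y) (hw1 : ∑ y, w y = 1)
    (hF : Typical F D K) (hsc : Scale D K κ ν) {ρ : ℝ} (hρ : 2 * Fintype.card ι * ν < ρ)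
    (hρ' : ρ ≤ tupleProb w (fun Y : ι → V => G.comap Y = F))
    (hd : ∀ x, ρ ≤ ∑ a : ι, tupleProb w
      (fun Y : ι → V => G.comap (({a} : Finset ι).piecewise (fun _ => x) Y) = F)) :
    ∃ φ : V → ι, ∀ y, mass w (Obstructs F G φ (fun _ => False) y) ≤ 4 * κ := by
  classical
  obtain ⟨φ, Z, h1, h2, h3⟩ := exists_initial_partition hw hw1 hF hsc hρ hρ'
  have hB := mass_obstructs_le hw hsc.nonneg h1 h2 h3
  have hsel : ∀ x, ∃ a, mass w (fun y => ¬ Z y ∧ φ y ≠ a ∧ ¬ (G.Adj x y ↔ F.Adj a (φ y))) ≤ κ := by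
    intro x
    by_contra! hcon
    have key : ∀ a : ι, tupleProb w
        (fun Y : ι → V => G.comap (({a} : Finset ι).piecewise (fun _ => x) Y) = F) ≤ ν + ν := by
      intro a
      refine (tupleProb_le_add hw (q := fun Y => G.comap (({a} : Finset ι).piecewise
        (fun _ => x) Y) = F ∧ ¬ Tame F G φ Z K (({a} : Finset ι).piecewise (fun _ => x) Y))
        (s := fun Y => G.comap (({a} : Finset ι).piecewise
        (fun _ => x) Y) = F ∧ Tame F G φ Z K (({a} : Finset ι).piecewise (fun _ => x) Y))
        fun Y h => ?_).trans (add_le_add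
          (tupleProb_not_tame_le hw hw1 hF hsc hB {a} (by simp) _) ?_)
      · tauto
      · refine tupleProb_le_of_resample hw hw1 (insert a D) fun t' => ?_
        have hsub : ({a} : Finset ι) ⊆ insert a D := by simp
        refine le_trans (tupleProb_mono hw fun Y hY => ?_)
          ((tupleProb_copy_avoid_le hw hw1 hF.sep (Finset.subset_insert a D)
          (({a} : Finset ι).piecewise (fun _ => x) t') _ (hcon a).le (G := G)).trans
          (hsc.avoid _ ?_))
        · rw [piecewise_piecewise_left hsub] at hY
          refine ⟨hY.1, fun u hu => ?_⟩
          rintro ⟨g1, g2, g3⟩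
          have e1 := apply_eq_of_tame hF hY.1 hY.2 u
          have e2 := adj_iff_of_comap_eq hY.1 a u
          rw [Finset.piecewise_eq_of_notMem _ _ _ hu] at e1 e2
          rw [Finset.piecewise_eq_of_mem _ _ _ (Finset.mem_insert_self _ _),
            Finset.piecewise_eq_of_mem _ _ _ (Finset.mem_singleton_self _)] at e2
          rw [e1 g1] at g3
          tauto
        · have h1 := Finset.card_insert_le a D
          omega
    have h4 := (hd x).trans (Finset.sum_le_sum fun a (_ : a ∈ Finset.univ) => key a)
    rw [Finset.sum_const, Finset.card_univ, nsmul_eq_mul] at h4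
    linarith
  choose a ha using hsel
  set φ' : V → ι := fun x => if Z x then a x else φ x with hφ'
  have hφ'n : ∀ y, ¬ Z y → φ' y = φ y := fun y hy => by simp [hφ', hy]
  refine ⟨φ', fun y => ?_⟩
  have e1 := mass_le_add hw (p := Obstructs F G φ' (fun _ => False) y) (q := Z)
      (s := fun y' => (¬ Z y' ∧ φ y' = φ' y) ∨ (¬ Z y' ∧ Irregular F G φ' y y')) (by
        intro y' h
        by_cases hy' : Z y'
        · exact Or.inl hy'
        · rcases h with h | ⟨-, h | h⟩
          · exact h.elim
          · exact Or.inr (Or.inl ⟨hy', by rw [← h, hφ'n _ hy']⟩)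
          · exact Or.inr (Or.inr ⟨hy', h⟩))
  have e2 := mass_le_add hw (p := fun y' => (¬ Z y' ∧ φ y' = φ' y) ∨
      (¬ Z y' ∧ Irregular F G φ' y y')) (fun y' h => h)
  have e3 := h3 (φ' y)
  have e4 : mass w (fun y' => ¬ Z y' ∧ Irregular F G φ' y y') ≤ κ := by
    by_cases hy : Z y
    · refine le_trans (mass_mono hw fun y' h => ?_) (ha y)
      have hy' : φ' y = a y := by simp [hφ', hy]
      obtain ⟨g1, g2, g3⟩ := h
      rw [hφ'n _ g1, hy'] at g2 g3
      exact ⟨g1, g2, g3⟩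
    · refine le_trans (mass_mono hw fun y' h => ?_) (h1 y hy)
      obtain ⟨g1, g2, g3⟩ := h
      rw [hφ'n _ g1, hφ'n _ hy] at g2 g3
      exact ⟨g1, g2, g3⟩
  have := hsc.nonneg
  linarith

end Structure

/-- A probability weighting. -/
def IsWeight {V : Type*} [Fintype V] (w : V → ℝ) : Prop := (∀ y, 0 ≤ w y) ∧ ∑ y, w y = 1

/-- The probability that a random tuple of vertices is a labelled copy of `F` in `G`. -/
noncomputable def copyProb {ι V : Type*} [Fintype ι] [DecidableEq ι] [Fintype V]
    (F : SimpleGraph ι) (G : SimpleGraph V) (w : V → ℝ) : ℝ :=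
  tupleProb w (fun Y : ι → V => G.comap Y = F)

/-- The supremum of the copy probabilities over weighted graphs without a clique of size `k`. -/
noncomputable def cliqueFreeSup {ι : Type*} [Fintype ι] [DecidableEq ι] (F : SimpleGraph ι)
    (k : ℕ) : ℝ :=
  sSup {x | ∃ (n : ℕ) (G : SimpleGraph (Fin n)) (w : Fin n → ℝ),
    G.CliqueFree k ∧ IsWeight w ∧ x = copyProb F G w}

/-- The supremum of the copy probabilities over weighted graphs. -/
noncomputable def copySup {ι : Type*} [Fintype ι] [DecidableEq ι] (F : SimpleGraph ι) : ℝ :=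
  sSup {x | ∃ (n : ℕ) (G : SimpleGraph (Fin n)) (w : Fin n → ℝ),
    IsWeight w ∧ x = copyProb F G w}

section Basic

variable {ι V : Type*} [Fintype ι] [DecidableEq ι] [Fintype V] {w : V → ℝ}

lemma tupleProb_sum_le {κ : Type*} [Fintype κ] (hw : ∀ y, 0 ≤ w y) {q : κ → (ι → V) → Prop}
    {s : (ι → V) → Prop} (h : ∀ k Y, q k Y → s Y) (hd : ∀ k l Y, q k Y → q l Y → k = l) :
    ∑ k, tupleProb w (q k) ≤ tupleProb w s := by
  classical
  simp only [tupleProb, tupleMean]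
  rw [Finset.sum_comm]
  refine Finset.sum_le_sum fun Y _ => ?_
  rw [← Finset.mul_sum]
  refine mul_le_mul_of_nonneg_left ?_ (Finset.prod_nonneg fun v _ => hw _)
  by_cases hex : ∃ k, q k Y
  · obtain ⟨k, hk⟩ := hex
    rw [Finset.sum_eq_single k, if_pos hk, if_pos (h k Y hk)]
    · intro l _ hl
      exact if_neg fun hq => hl (hd l k Y hq hk)
    · simp
  · push Not at hex
    rw [Finset.sum_eq_zero fun k _ => if_neg (hex k)]
    split_ifs <;> norm_num

lemma tupleMean_apply (hw1 : ∑ y, w y = 1) (a : ι) (g : V → ℝ) :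
    tupleMean w (fun t : ι → V => g (t a)) = ∑ y, w y * g y := by
  have h := tupleMean_prod (w := w) (fun v y => if v = a then g y else 1)
  have e1 : (fun t : ι → V => g (t a)) = fun t => ∏ v, (if v = a then g (t v) else 1) := by
    ext t
    rw [Finset.prod_ite_eq' Finset.univ a (fun v => g (t v))]
    simp
  rw [e1, h, Finset.prod_eq_single a]
  · simp
  · intro b _ hb
    simp [hb, hw1]
  · simp

lemma tupleProb_apply (hw1 : ∑ y, w y = 1) (a : ι) (p : V → Prop) :
    tupleProb w (fun t : ι → V => p (t a)) = mass w p := by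
  classical
  exact tupleMean_apply hw1 a fun y => if p y then 1 else 0

lemma tupleProb_apply₂ (hw1 : ∑ y, w y = 1) {a b : ι} (hab : a ≠ b) (R : V → V → Prop) :
    tupleProb w (fun t : ι → V => R (t a) (t b)) = ∑ y, w y * mass w (R y) := by
  rw [tupleProb_resample hw1 {a}]
  have : ∀ t : ι → V, tupleProb w (fun Y : ι → V => R (({a} : Finset ι).piecewise t Y a)
      (({a} : Finset ι).piecewise t Y b)) = mass w (R (t a)) := by
    intro t
    rw [← tupleProb_apply hw1 b]
    simp [hab.symm]
  simp only [this]
  exact tupleMean_apply hw1 a fun y => mass w (R y)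

lemma tupleProb_and_le (hw : ∀ y, 0 ≤ w y) (hw1 : ∑ y, w y = 1) (Q : Finset ι)
    {p q : (ι → V) → Prop} (hp : ∀ t Y, p (Q.piecewise t Y) ↔ p t) {b : ℝ}
    (h : ∀ t, tupleProb w (fun Y => q (Q.piecewise t Y)) ≤ b) :
    tupleProb w (fun Y => p Y ∧ q Y) ≤ b * tupleProb w p := by
  classical
  rw [tupleProb_resample hw1 Q]
  have : b * tupleProb w p = tupleMean w (fun t => b * if p t then 1 else 0) := by
    rw [tupleProb, tupleMean, tupleMean, Finset.mul_sum]
    exact Finset.sum_congr rfl fun _ _ => by ring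
  rw [this]
  refine tupleMean_mono hw fun t => ?_
  simp only [hp]
  by_cases hpt : p t
  · simpa [hpt] using h t
  · simp [hpt, tupleProb, tupleMean]

lemma le_tupleProb_and (hw : ∀ y, 0 ≤ w y) (hw1 : ∑ y, w y = 1) (Q : Finset ι)
    {p q : (ι → V) → Prop} (hp : ∀ t Y, p (Q.piecewise t Y) ↔ p t) {b : ℝ}
    (h : ∀ t, p t → b ≤ tupleProb w (fun Y => q (Q.piecewise t Y))) :
    b * tupleProb w p ≤ tupleProb w (fun Y => p Y ∧ q Y) := by
  classical
  have : b * tupleProb w p = tupleMean w (fun t => b * if p t then 1 else 0) := by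
    rw [tupleProb, tupleMean, tupleMean, Finset.mul_sum]
    exact Finset.sum_congr rfl fun _ _ => by ring
  rw [this, tupleProb_resample hw1 Q (fun Y => p Y ∧ q Y)]
  refine tupleMean_mono hw fun t => ?_
  simp only [hp]
  by_cases hpt : p t
  · simpa [hpt] using h t hpt
  · simp [hpt, tupleProb, tupleMean]

lemma sum_mass_eq (hw1 : ∑ y, w y = 1) (φ : V → ι) : ∑ u, mass w (fun y => φ y = u) = 1 := by
  classical
  simp only [mass]
  rw [Finset.sum_comm]
  refine Eq.trans ?_ hw1
  refine Finset.sum_congr rfl fun y _ => ?_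
  rw [Finset.sum_eq_single (φ y) (fun u _ hu => by rw [if_neg hu.symm, mul_zero]) (by simp),
    if_pos rfl, mul_one]

lemma tupleProb_comp_injective {V' : Type*} [Fintype V'] {w' : V' → ℝ} (e : V' → V)
    (he : Function.Injective e) (c : ℝ) (hc : ∀ y, w (e y) = c * w' y) (p : (ι → V) → Prop)
    (hp : ∀ Y, p Y → ∀ v, Y v ∉ Set.range e → w (Y v) = 0) :
    tupleProb w p = c ^ Fintype.card ι * tupleProb w' (fun Y => p (e ∘ Y)) := by
  classical
  rw [tupleProb, tupleMean, tupleProb, tupleMean, Finset.mul_sum]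
  refine (Fintype.sum_of_injective (fun Y : ι → V' => e ∘ Y) he.comp_left _ _ ?_ ?_).symm
  · intro Y hY
    by_cases h : p Y
    · have : ∃ v, Y v ∉ Set.range e := by
        by_contra! hcon
        choose Y' hY' using hcon
        exact hY ⟨Y', funext hY'⟩
      obtain ⟨v, hv⟩ := this
      rw [Finset.prod_eq_zero (Finset.mem_univ v) (hp Y h v hv), zero_mul]
    · simp [h]
  · intro Y
    simp only [Function.comp_apply, hc, Finset.prod_mul_distrib, Finset.prod_const,
      Finset.card_univ]
    rw [mul_assoc]

variable {F : SimpleGraph ι} {G : SimpleGraph V}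

lemma copyProb_nonneg (hw : ∀ y, 0 ≤ w y) : 0 ≤ copyProb F G w := tupleProb_nonneg hw _

lemma copyProb_le_one (hw : IsWeight w) : copyProb F G w ≤ 1 := tupleProb_le_one hw.1 hw.2 _

lemma copyProb_equiv {V' : Type*} [Fintype V'] (e : V' ≃ V) :
    copyProb F (G.comap e) (w ∘ e) = copyProb F G w := by
  rw [copyProb, copyProb, tupleProb_comp_injective e e.injective 1 (w' := w ∘ e) (by simp)
    _ (by simp), one_pow, one_mul]
  rfl

lemma isWeight_comp_equiv {V' : Type*} [Fintype V'] (e : V' ≃ V) (hw : IsWeight w) :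
    IsWeight (w ∘ e) :=
  ⟨fun y => hw.1 _, by rw [← hw.2]; exact Equiv.sum_comp e w⟩

lemma copyProb_le_copySup (hw : IsWeight w) : copyProb F G w ≤ copySup F := by
  refine le_csSup ⟨1, ?_⟩ ⟨Fintype.card V, G.comap (Fintype.equivFin V).symm,
    w ∘ (Fintype.equivFin V).symm, isWeight_comp_equiv _ hw, (copyProb_equiv _).symm⟩
  rintro x ⟨n, G, w, hw, rfl⟩
  exact copyProb_le_one hw

lemma copyProb_le_cliqueFreeSup {k : ℕ} (hG : G.CliqueFree k) (hw : IsWeight w) :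
    copyProb F G w ≤ cliqueFreeSup F k := by
  refine le_csSup ⟨1, ?_⟩ ⟨Fintype.card V, G.comap (Fintype.equivFin V).symm,
    w ∘ (Fintype.equivFin V).symm, ?_, isWeight_comp_equiv _ hw, (copyProb_equiv _).symm⟩
  · rintro x ⟨n, G, w, -, hw, rfl⟩
    exact copyProb_le_one hw
  · exact hG.comap ⟨(SimpleGraph.Embedding.comap (Fintype.equivFin V).symm.toEmbedding G).toCopy⟩

lemma cliqueFreeSup_nonneg (k : ℕ) : 0 ≤ cliqueFreeSup F k := by
  refine Real.sSup_nonneg ?_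
  rintro x ⟨n, G, w, -, hw, rfl⟩
  exact copyProb_nonneg hw.1

lemma copySup_nonneg : 0 ≤ copySup F := by
  refine Real.sSup_nonneg ?_
  rintro x ⟨n, G, w, hw, rfl⟩
  exact copyProb_nonneg hw.1

lemma cliqueFreeSup_le_copySup (k : ℕ) : cliqueFreeSup F k ≤ copySup F := by
  refine Real.sSup_le ?_ copySup_nonneg
  rintro x ⟨n, G, w, -, hw, rfl⟩
  exact copyProb_le_copySup hw

lemma mass_eq_sum_subtype (U : V → Prop) [Fintype {y // U y}] :
    mass w U = ∑ y : {y // U y}, w y := by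
  classical
  rw [mass]
  simp only [mul_ite, mul_one, mul_zero]
  rw [← Finset.sum_filter]
  exact Finset.sum_subtype _ (by simp) _

lemma isWeight_restrict (hw : ∀ y, 0 ≤ w y) (U : V → Prop) [Fintype {y // U y}]
    (hU : 0 < mass w U) : IsWeight (fun y : {y // U y} => (mass w U)⁻¹ * w y) := by
  refine ⟨fun y => mul_nonneg (inv_nonneg.2 hU.le) (hw _), ?_⟩
  rw [← Finset.mul_sum, ← mass_eq_sum_subtype, inv_mul_cancel₀ hU.ne']

lemma tupleProb_forall_mem_le (hw : ∀ y, 0 ≤ w y) [Nonempty ι] (U : V → Prop)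
    [Fintype {y // U y}] {c : ℝ}
    (h : 0 < mass w U → copyProb F (G.comap (Subtype.val : {y // U y} → V))
      (fun y : {y // U y} => (mass w U)⁻¹ * w y) ≤ c) :
    tupleProb w (fun Y : ι → V => G.comap Y = F ∧ ∀ v, U (Y v)) ≤
      c * mass w U ^ Fintype.card ι := by
  rcases (mass_nonneg hw U).eq_or_lt with h0 | h0
  · rw [← h0, zero_pow Fintype.card_ne_zero, mul_zero]
    refine (tupleProb_mono hw (q := fun Y => ∀ v, U (Y v)) fun Y h => h.2).trans ?_
    rw [tupleProb_forall, ← h0]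
    simp
  · rw [tupleProb_comp_injective (Subtype.val : {y // U y} → V) Subtype.val_injective (mass w U)
      (w' := fun y : {y // U y} => (mass w U)⁻¹ * w y), mul_comm]
    · refine mul_le_mul_of_nonneg_right (le_trans ?_ (h h0)) (pow_nonneg h0.le _)
      exact tupleProb_mono (isWeight_restrict hw U h0).1 fun Y hY => by
        rw [SimpleGraph.comap_comap]; exact hY.1
    · intro y
      rw [mul_inv_cancel_left₀ h0.ne']
    · intro Y hY v hv
      simp [hY.2 v] at hv

lemma inv_card_pow_le_copySup [Nonempty ι] :
    (1 / (Fintype.card ι : ℝ)) ^ Fintype.card ι ≤ copySup F := by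
  classical
  have hr : (0:ℝ) < Fintype.card ι := by exact_mod_cast Fintype.card_pos
  have hw : IsWeight (fun _ : ι => 1 / (Fintype.card ι : ℝ)) := by
    refine ⟨fun _ => by positivity, ?_⟩
    rw [Finset.sum_const, Finset.card_univ, nsmul_eq_mul]
    field_simp
  refine le_trans ?_ (copyProb_le_copySup (F := F) (G := F) hw)
  rw [copyProb, tupleProb, tupleMean]
  refine le_trans ?_ (Finset.single_le_sum (f := fun Y : ι → ι =>
    (∏ v, 1 / (Fintype.card ι : ℝ)) * if F.comap Y = F then (1:ℝ) else 0) (fun Y _ => ?_)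
    (Finset.mem_univ id))
  · simp
  · refine mul_nonneg (Finset.prod_nonneg fun _ _ => by positivity) ?_
    split_ifs <;> norm_num

/-- The lexicographic product of `F` and `G`. -/
def lexGraph {ι V : Type*} (F : SimpleGraph ι) (G : SimpleGraph V) : SimpleGraph (ι × V) where
  Adj a b := (a.1 ≠ b.1 ∧ F.Adj a.1 b.1) ∨ (a.1 = b.1 ∧ G.Adj a.2 b.2)
  symm := ⟨by
    rintro a b (⟨h1, h2⟩ | ⟨h1, h2⟩)
    · exact Or.inl ⟨h1.symm, h2.symm⟩
    · exact Or.inr ⟨h1.symm, h2.symm⟩⟩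
  loopless := ⟨by rintro a (⟨h, -⟩ | ⟨-, h⟩); exacts [h rfl, G.loopless.irrefl _ h]⟩

lemma prod_add_copyProb_mul_le [Nontrivial ι] {x : ι → ℝ} (hx : IsWeight x) (hw : IsWeight w) :
    ∏ u, x u + copyProb F G w * ∑ u, x u ^ Fintype.card ι ≤ copySup F := by
  classical
  set W : ι × V → ℝ := fun a => x a.1 * w a.2 with hW
  have hW' : IsWeight W := by
    refine ⟨fun a => mul_nonneg (hx.1 _) (hw.1 _), ?_⟩
    rw [Fintype.sum_prod_type]
    simp only [hW, ← Finset.mul_sum, hw.2, mul_one, hx.2]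
  refine le_trans ?_ (copyProb_le_copySup (F := F) (G := lexGraph F G) hW')
  set q : Option ι → (ι → ι × V) → Prop := fun o Y => match o with
    | none => ∀ v, (Y v).1 = v
    | some u => (lexGraph F G).comap Y = F ∧ ∀ v, (Y v).1 = u with hq
  have hmass : ∀ v, mass W (fun a => a.1 = v) = x v := by
    intro v
    rw [mass, Fintype.sum_prod_type]
    simp only [hW, mul_ite, mul_one, mul_zero]
    rw [Finset.sum_comm]
    simp [← Finset.mul_sum, hw.2]
  have h := tupleProb_sum_le hW'.1 (q := q) (s := fun Y => (lexGraph F G).comap Y = F) ?_ ?_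
  · rw [Fintype.sum_option] at h
    refine le_trans (le_of_eq ?_) h
    congr 1
    · simp only [hq, tupleProb_forall (fun v (a : ι × V) => a.1 = v), hmass]
    · rw [Finset.mul_sum]
      refine Finset.sum_congr rfl fun u _ => ?_
      rw [tupleProb_comp_injective (w := W) (w' := w) (fun y => (u, y))
        (fun a b h => (Prod.mk.inj h).2) (x u) (fun y => rfl), mul_comm, copyProb]
      · congr 2
        ext Y
        simp only [hq, Function.comp_apply, implies_true, and_true]
        have : (lexGraph F G).comap ((fun y => (u, y)) ∘ Y) = G.comap Y := by
          ext a b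
          simp [lexGraph]
        rw [this]
      · intro Y hY v hv
        refine absurd ⟨(Y v).2, ?_⟩ hv
        rw [← hY.2 v]
  · rintro (_ | u) Y hY
    · ext a b
      have ha : (Y a).1 = a := hY a
      have hb : (Y b).1 = b := hY b
      simp only [SimpleGraph.comap_adj, lexGraph, ha, hb]
      constructor
      · rintro (h | ⟨rfl, h⟩)
        · exact h.2
        · exact absurd h (G.loopless.irrefl _)
      · exact fun h => Or.inl ⟨h.ne, h⟩
    · exact hY.1
  · obtain ⟨a, b, hab⟩ := exists_pair_ne ι
    rintro (_ | u) (_ | v) Y h1 h2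
    · rfl
    · exact absurd ((h1 a).symm.trans ((h2.2 a).trans ((h2.2 b).symm.trans (h1 b)))) hab
    · exact absurd ((h2 a).symm.trans ((h1.2 a).trans ((h1.2 b).symm.trans (h2 b)))) hab
    · rw [← h1.2 a, ← h2.2 a]

lemma prod_add_copySup_mul_le [Nontrivial ι] {x : ι → ℝ} (hx : IsWeight x) :
    ∏ u, x u + copySup F * ∑ u, x u ^ Fintype.card ι ≤ copySup F := by
  have hS : 0 < ∑ u, x u ^ Fintype.card ι := by
    have : ∃ u, 0 < x u := by
      by_contra! h
      have := Finset.sum_nonpos fun u (_ : u ∈ Finset.univ) => h u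
      rw [hx.2] at this
      linarith
    obtain ⟨u, hu⟩ := this
    exact Finset.sum_pos' (fun v _ => pow_nonneg (hx.1 v) _) ⟨u, Finset.mem_univ _, pow_pos hu _⟩
  have : copySup F ≤ (copySup F - ∏ u, x u) / ∑ u, x u ^ Fintype.card ι := by
    refine csSup_le ?_ ?_
    · exact ⟨_, 1, ⊥, fun _ => 1, ⟨fun _ => zero_le_one, by simp⟩, rfl⟩
    · rintro y ⟨n, G, w, hw, rfl⟩
      rw [le_div_iff₀ hS]
      linarith [prod_add_copyProb_mul_le (F := F) (G := G) hx hw]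
  rw [le_div_iff₀ hS] at this
  linarith

end Basic

lemma cliqueFree_comap_of_adj {V : Type*} {G : SimpleGraph V} {k : ℕ} (hG : G.CliqueFree (k + 1))
    (y : V) (U : V → Prop) (hU : ∀ z, U z → G.Adj y z) :
    (G.comap (Subtype.val : {z // U z} → V)).CliqueFree k := by
  classical
  intro s hs
  rw [SimpleGraph.isNClique_iff] at hs
  refine hG (insert y (s.map ⟨Subtype.val, Subtype.val_injective⟩)) ?_
  rw [SimpleGraph.isNClique_iff]
  constructor
  · rw [Finset.coe_insert, SimpleGraph.isClique_insert]
    constructor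
    · intro a ha b hb hab
      simp only [Finset.coe_map, Function.Embedding.coeFn_mk, Set.mem_image] at ha hb
      obtain ⟨a, ha, rfl⟩ := ha
      obtain ⟨b, hb, rfl⟩ := hb
      exact hs.1 ha hb fun h => hab (by rw [h])
    · intro b hb _
      simp only [Finset.coe_map, Function.Embedding.coeFn_mk, Set.mem_image] at hb
      obtain ⟨b, hb, rfl⟩ := hb
      exact hU _ b.2
  · rw [Finset.card_insert_of_notMem, Finset.card_map, hs.2]
    intro h
    simp only [Finset.mem_map, Function.Embedding.coeFn_mk] at h
    obtain ⟨b, -, hb⟩ := h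
    have := hU _ b.2
    rw [hb] at this
    exact this.ne rfl

section Gap

variable {ι V : Type*} [Fintype ι] [DecidableEq ι] [Fintype V] {w : V → ℝ}
  {F : SimpleGraph ι} {G : SimpleGraph V} {D : Finset ι} {K : ℕ} {κ ν : ℝ} {φ : V → ι}

lemma mass_le_sum {V κ : Type*} [Fintype V] {w : V → ℝ} [Fintype κ] (hw : ∀ y, 0 ≤ w y)
    {p : V → Prop} {q : κ → V → Prop} (h : ∀ y, p y → ∃ k, q k y) :
    mass w p ≤ ∑ k, mass w (q k) := by
  classical
  simp only [mass]
  rw [Finset.sum_comm]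
  refine Finset.sum_le_sum fun y _ => ?_
  rw [← Finset.mul_sum]
  refine mul_le_mul_of_nonneg_left ?_ (hw _)
  by_cases hp : p y
  · obtain ⟨k, hk⟩ := h y hp
    simp only [hp, if_true]
    refine le_trans ?_ (Finset.single_le_sum (f := fun k => if q k y then (1:ℝ) else 0)
      (fun k _ => by split_ifs <;> norm_num) (Finset.mem_univ k))
    simp [hk]
  · simp only [hp, if_false]
    exact Finset.sum_nonneg fun k _ => by split_ifs <;> norm_num

lemma tupleProb_mixed_copy_le (hw : IsWeight w) (hF : Typical F D K) (hsc : Scale D K κ ν)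
    (hB : ∀ y, mass w (Obstructs F G φ (fun _ => False) y) ≤ 4 * κ) :
    tupleProb w (fun Y : ι → V => G.comap Y = F ∧ (¬ ∀ v, φ (Y v) = v) ∧
      ∃ u v, φ (Y u) ≠ φ (Y v)) ≤
    (Fintype.card ι : ℝ) ^ 2 * (ν * ∑ y, w y * mass w (Irregular F G φ y)) := by
  have hb : 0 ≤ ∑ y, w y * mass w (Irregular F G φ y) :=
    Finset.sum_nonneg fun y _ => mul_nonneg (hw.1 y) (mass_nonneg hw.1 _)
  refine (tupleProb_le_sum (κ := ι × ι) hw.1 (q := fun a Y =>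
    Irregular F G φ (Y a.1) (Y a.2) ∧ (G.comap Y = F ∧ ¬ Tame F G φ (fun _ => False) K Y))
    ?_).trans ?_
  · rintro Y ⟨h1, h2, u, v, h3⟩
    obtain ⟨a, b, h4, h5⟩ := hF.prime (fun v => φ (Y v)) (fun h => h2 fun v => congrFun h v)
      ⟨u, v, h3⟩
    refine ⟨(a, b), ⟨h4.symm, ?_⟩, h1, fun ht => h2 fun v => ?_⟩
    · rwa [adj_iff_of_comap_eq h1]
    · exact apply_eq_of_tame hF h1 ht v not_false
  · refine (Finset.sum_le_sum (g := fun _ => ν * ∑ y, w y * mass w (Irregular F G φ y))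
      fun a _ => ?_).trans (le_of_eq ?_)
    · obtain ⟨a, b⟩ := a
      rcases eq_or_ne a b with rfl | hab
      · refine le_trans (le_of_eq ?_) (mul_nonneg hsc.pos.le hb)
        simp [tupleProb, tupleMean, Irregular]
      · rw [← tupleProb_apply₂ hw.2 hab]
        refine tupleProb_and_le hw.1 hw.2 {a, b} (p := fun Y => Irregular F G φ (Y a) (Y b))
          (fun t Y => ?_) fun t => ?_
        · simp
        · exact tupleProb_not_tame_le hw.1 hw.2 hF hsc hB _ Finset.card_le_two t
    · rw [Finset.sum_const, Finset.card_univ, Fintype.card_prod, nsmul_eq_mul]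
      push_cast
      ring

lemma tupleProb_transversal_copy_le [Nonempty ι] (hw : IsWeight w) :
    (Fintype.card ι : ℝ) ^ 2 *
      tupleProb w (fun Y : ι → V => G.comap Y = F ∧ ∀ v, φ (Y v) = v) ≤
    (Fintype.card ι : ℝ) ^ 2 * (∏ u, mass w (fun y => φ y = u)) -
      (∏ u, mass w (fun y => φ y = u)) * ∑ y, w y * mass w (Irregular F G φ y) := by
  set P := ∏ u, mass w (fun y => φ y = u) with hP
  have hPe : tupleProb w (fun Y : ι → V => ∀ v, φ (Y v) = v) = P :=
    tupleProb_forall (fun v y => φ y = v)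
  have hP0 : 0 ≤ P := Finset.prod_nonneg fun u _ => mass_nonneg hw.1 _
  set β : ι × ι → ℝ := fun a => ∑ y, w y *
    mass w (fun y' => φ y = a.1 ∧ φ y' = a.2 ∧ Irregular F G φ y y') with hβ
  have hsum : ∑ y, w y * mass w (Irregular F G φ y) ≤ ∑ a, β a := by
    simp only [hβ]
    rw [Finset.sum_comm]
    refine Finset.sum_le_sum fun y _ => ?_
    rw [← Finset.mul_sum]
    refine mul_le_mul_of_nonneg_left (mass_le_sum hw.1 fun y' h => ?_) (hw.1 y)
    exact ⟨(φ y, φ y'), rfl, rfl, h⟩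
  have key : ∀ a, tupleProb w (fun Y : ι → V => G.comap Y = F ∧ ∀ v, φ (Y v) = v) ≤
      P - P * β a := by
    rintro ⟨i, j⟩
    rcases eq_or_ne i j with rfl | hij
    · have : β (i, i) = 0 := by
        refine Finset.sum_eq_zero fun y _ => ?_
        have : ∀ y', ¬ (φ y = i ∧ φ y' = i ∧ Irregular F G φ y y') :=
          fun y' h => h.2.2.1 (h.2.1.trans h.1.symm)
        simp [mass, this]
      rw [this, mul_zero, sub_zero, ← hPe]
      exact tupleProb_mono hw.1 fun Y h => h.2
    · have h1 : P * β (i, j) ≤ tupleProb w (fun Y : ι → V =>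
          (φ (Y i) = i ∧ φ (Y j) = j ∧ Irregular F G φ (Y i) (Y j)) ∧ ∀ v, φ (Y v) = v) := by
        have e : β (i, j) = tupleProb w (fun Y : ι → V =>
            φ (Y i) = i ∧ φ (Y j) = j ∧ Irregular F G φ (Y i) (Y j)) :=
          (tupleProb_apply₂ hw.2 hij
            fun y y' => φ y = i ∧ φ y' = j ∧ Irregular F G φ y y').symm
        rw [e]
        refine le_tupleProb_and hw.1 hw.2 {i, j} (p := fun Y : ι → V =>
          φ (Y i) = i ∧ φ (Y j) = j ∧ Irregular F G φ (Y i) (Y j))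
          (fun t Y => by simp) fun t ht => ?_
        rw [← hPe]
        refine tupleProb_mono hw.1 fun Y hY v => ?_
        by_cases hv : v ∈ ({i, j} : Finset ι)
        · rw [Finset.piecewise_eq_of_mem _ _ _ hv]
          rw [Finset.mem_insert, Finset.mem_singleton] at hv
          rcases hv with rfl | rfl
          · exact ht.1
          · exact ht.2.1
        · rw [Finset.piecewise_eq_of_notMem _ _ _ hv]
          exact hY v
      have h2 := tupleProb_add_le hw.1 (p := fun Y : ι → V => G.comap Y = F ∧ ∀ v, φ (Y v) = v)
        (q := fun Y : ι → V => (φ (Y i) = i ∧ φ (Y j) = j ∧ Irregular F G φ (Y i) (Y j)) ∧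
          ∀ v, φ (Y v) = v) (s := fun Y => ∀ v, φ (Y v) = v) (fun Y h => h.2) (fun Y h => h.2)
        (by
          rintro Y ⟨g1, g2⟩ ⟨⟨-, -, -, g3⟩, -⟩
          rw [g2, g2, adj_iff_of_comap_eq g1] at g3
          exact g3 Iff.rfl)
      rw [hPe] at h2
      linarith
  have h := Finset.sum_le_sum fun a (_ : a ∈ (Finset.univ : Finset (ι × ι))) => key a
  rw [Finset.sum_sub_distrib, ← Finset.mul_sum, Finset.sum_const, Finset.sum_const,
    Finset.card_univ, Fintype.card_prod, nsmul_eq_mul, nsmul_eq_mul] at h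
  push_cast at h
  nlinarith [mul_le_mul_of_nonneg_left hsum hP0]

lemma tupleProb_const_copy_le [Nonempty ι] (hw : IsWeight w) (u : ι) :
    tupleProb w (fun Y : ι → V => G.comap Y = F ∧ ∀ v, φ (Y v) = u) ≤
      copySup F * mass w (fun y => φ y = u) ^ Fintype.card ι := by
  classical
  exact tupleProb_forall_mem_le hw.1 (fun y => φ y = u) fun h =>
    copyProb_le_copySup (isWeight_restrict hw.1 _ h)

lemma tupleProb_const_copy_le_cliqueFreeSup [Nonempty ι] (hw : IsWeight w) {k : ℕ}
    (hG : G.CliqueFree (k + 1)) {i j : ι} (hij : F.Adj j i) {y : V} (hy : φ y = j) :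
    tupleProb w (fun Y : ι → V => G.comap Y = F ∧ ∀ v, φ (Y v) = i) ≤
      cliqueFreeSup F k * mass w (fun y => φ y = i) ^ Fintype.card ι +
        Fintype.card ι * mass w (fun y' => φ y' = i ∧ Irregular F G φ y y') := by
  classical
  set U : V → Prop := fun y' => φ y' = i ∧ ¬ Irregular F G φ y y' with hU
  refine (tupleProb_le_add hw.1 (q := fun Y => G.comap Y = F ∧ ∀ v, U (Y v))
    (s := fun Y => ∃ v : ι, φ (Y v) = i ∧ Irregular F G φ y (Y v)) ?_).trans
    (add_le_add ?_ ?_)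
  · rintro Y ⟨h1, h2⟩
    by_cases h : ∀ v, ¬ Irregular F G φ y (Y v)
    · exact Or.inl ⟨h1, fun v => ⟨h2 v, h v⟩⟩
    · push Not at h
      obtain ⟨v, hv⟩ := h
      exact Or.inr ⟨v, h2 v, hv⟩
  · refine (tupleProb_forall_mem_le (c := cliqueFreeSup F k) hw.1 U fun h =>
      copyProb_le_cliqueFreeSup (cliqueFree_comap_of_adj hG y U ?_)
        (isWeight_restrict hw.1 _ h)).trans ?_
    · rintro z ⟨h1, h2⟩
      by_contra hadj
      refine h2 ⟨?_, ?_⟩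
      · rw [h1, hy]; exact hij.ne'
      · rw [h1, hy]; tauto
    · refine mul_le_mul_of_nonneg_left ?_ (cliqueFreeSup_nonneg k)
      exact pow_le_pow_left₀ (mass_nonneg hw.1 _) (mass_mono hw.1 fun y h => h.1) _
  · refine (tupleProb_le_sum (κ := ι) hw.1 (q := fun v Y => φ (Y v) = i ∧
      Irregular F G φ y (Y v)) fun Y h => h).trans (le_of_eq ?_)
    rw [Finset.sum_congr rfl fun v _ => tupleProb_apply hw.2 v
      fun y' => φ y' = i ∧ Irregular F G φ y y']
    rw [Finset.sum_const, Finset.card_univ, nsmul_eq_mul]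

lemma exists_mass_irregular_le (hw : IsWeight w) (i j : ι) (hj : 0 < mass w (fun y => φ y = j)) :
    ∃ y, φ y = j ∧ mass w (fun y' => φ y' = i ∧ Irregular F G φ y y') *
      mass w (fun y => φ y = j) ≤ ∑ y, w y * mass w (Irregular F G φ y) := by
  classical
  by_contra! hcon
  set b := ∑ y, w y * mass w (Irregular F G φ y) with hb
  set m : V → ℝ := fun y => mass w (fun y' => φ y' = i ∧ Irregular F G φ y y') with hm
  set x := mass w (fun y => φ y = j) with hx
  have hm0 : ∀ y, 0 ≤ m y := fun y => mass_nonneg hw.1 _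
  have h1 : ∑ y, w y * (if φ y = j then 1 else 0) * (m y * x) ≤ b * x := by
    rw [hb, Finset.sum_mul]
    refine Finset.sum_le_sum fun y _ => ?_
    rw [← mul_assoc]
    refine mul_le_mul_of_nonneg_right ?_ hj.le
    have hmy : m y ≤ mass w (Irregular F G φ y) := mass_mono hw.1 fun y h => h.2
    have := hw.1 y
    have := hm0 y
    split_ifs
    · rw [mul_one]; exact mul_le_mul_of_nonneg_left hmy (hw.1 y)
    · rw [mul_zero, zero_mul]; exact mul_nonneg (hw.1 y) ((hm0 y).trans hmy)
  have h2 : b * x < ∑ y, w y * (if φ y = j then 1 else 0) * (m y * x) := by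
    have e : b * x = ∑ y, w y * (if φ y = j then 1 else 0) * b := by
      rw [hx, mass, ← Finset.sum_mul, mul_comm]
      congr! 
    rw [e]
    refine Finset.sum_lt_sum (fun y _ => ?_) ?_
    · by_cases h : φ y = j
      · simp only [h, if_true, mul_one]
        exact mul_le_mul_of_nonneg_left (hcon y h).le (hw.1 y)
      · simp [h]
    · by_contra! hall
      have : x ≤ 0 := by
        rw [hx, mass]
        refine Finset.sum_nonpos fun y _ => ?_
        by_cases h : φ y = j
        · have g1 := hall y (Finset.mem_univ _)
          have g2 := hcon y h
          simp only [h, if_true, mul_one] at g1 ⊢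
          by_contra! g3
          nlinarith
        · simp [h]
      linarith
  linarith

lemma exists_adj_of_typical [Nontrivial ι] (hF : Typical F D K) : ∃ i j, F.Adj j i := by
  obtain ⟨u, v, huv⟩ := exists_pair_ne ι
  obtain ⟨x, hx⟩ := hF.twin_free u v huv
  by_contra! h
  exact hx ⟨fun h' => absurd h' (h _ _), fun h' => absurd h' (h _ _)⟩

lemma gap_mul_pow_le [Nontrivial ι] (hw : IsWeight w) (hF : Typical F D K) (hsc : Scale D K κ ν)
    {k : ℕ} (hG : G.CliqueFree (k + 1))
    (hB : ∀ y, mass w (Obstructs F G φ (fun _ => False) y) ≤ 4 * κ) {q : ℝ} (hq0 : 0 < q)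
    (hq : q + ν ≤ copyProb F G w) (hνq : 2 * (Fintype.card ι : ℝ) ^ 4 * ν ≤ q) :
    (copySup F - cliqueFreeSup F k) * q ^ Fintype.card ι ≤
      (copySup F - copyProb F G w) * (1 + 2 * (Fintype.card ι : ℝ) ^ 3 / q ^ 2) := by
  have hr : (1:ℝ) ≤ Fintype.card ι := by exact_mod_cast Fintype.card_pos
  have hmixed := tupleProb_mixed_copy_le hw hF hsc hB
  have hid := tupleProb_transversal_copy_le hw (F := F) (G := G) (φ := φ)
  have hconst := tupleProb_const_copy_le hw (F := F) (G := G) (φ := φ)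
  set r : ℝ := (Fintype.card ι : ℝ) with hrdef
  set x : ι → ℝ := fun u => mass w (fun y => φ y = u) with hx
  set P := ∏ u, x u with hP
  set b := ∑ y, w y * mass w (Irregular F G φ y) with hb
  set ρ := copyProb F G w with hρ
  set pid := tupleProb w (fun Y : ι → V => G.comap Y = F ∧ ∀ v, φ (Y v) = v) with hpid
  set pc : ι → ℝ := fun u => tupleProb w (fun Y : ι → V => G.comap Y = F ∧ ∀ v, φ (Y v) = u)
    with hpc
  have hb0 : 0 ≤ b := Finset.sum_nonneg fun y _ => mul_nonneg (hw.1 y) (mass_nonneg hw.1 _)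
  have hxw : IsWeight x := ⟨fun u => mass_nonneg hw.1 _, sum_mass_eq hw.2 φ⟩
  have hlex := prod_add_copySup_mul_le (F := F) hxw
  have hgap := cliqueFreeSup_le_copySup (F := F) k
  have hPle : ∀ u, P ≤ x u := by
    intro u
    rw [hP, ← Finset.mul_prod_erase _ _ (Finset.mem_univ u)]
    refine mul_le_of_le_one_right (hxw.1 u) (Finset.prod_le_one (fun v _ => hxw.1 v)
      fun v _ => mass_le_one hw.1 hw.2 _)
  have hqP : q ≤ P := by
    have h1 := tupleProb_le_add hw.1 (p := fun Y : ι → V => G.comap Y = F)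
      (q := fun Y => ∀ v, φ (Y v) = v)
      (s := fun Y => G.comap ((∅ : Finset ι).piecewise Y Y) = F ∧
        ¬ Tame F G φ (fun _ => False) K ((∅ : Finset ι).piecewise Y Y)) (by
        intro Y hY
        by_cases ht : Tame F G φ (fun _ => False) K Y
        · exact Or.inl fun v => apply_eq_of_tame hF hY ht v not_false
        · exact Or.inr (by simpa using ⟨hY, ht⟩))
    have h2 : tupleProb w (fun Y : ι → V => G.comap ((∅ : Finset ι).piecewise Y Y) = F ∧
        ¬ Tame F G φ (fun _ => False) K ((∅ : Finset ι).piecewise Y Y)) ≤ ν := by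
      rcases isEmpty_or_nonempty V with hV | ⟨⟨z⟩⟩
      · have := hw.2
        simp at this
      · simpa using tupleProb_not_tame_le hw.1 hw.2 hF hsc hB ∅ (by simp) fun _ => z
    have h3 : tupleProb w (fun Y : ι → V => ∀ v, φ (Y v) = v) = P :=
      tupleProb_forall (fun v y => φ y = v)
    have : ρ ≤ P + ν := by rw [← h3]; exact h1.trans (add_le_add le_rfl h2)
    linarith
  have hsplit : ρ ≤ pid + ∑ u, pc u + r ^ 2 * (ν * b) := by
    have h1 := tupleProb_le_add hw.1 (p := fun Y : ι → V => G.comap Y = F)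
      (q := fun Y => (G.comap Y = F ∧ ∀ v, φ (Y v) = v) ∨
        ∃ u, G.comap Y = F ∧ ∀ v, φ (Y v) = u)
      (s := fun Y => G.comap Y = F ∧ (¬ ∀ v, φ (Y v) = v) ∧ ∃ u v, φ (Y u) ≠ φ (Y v)) (by
        intro Y hY
        by_cases h : ∀ v, φ (Y v) = v
        · exact Or.inl (Or.inl ⟨hY, h⟩)
        by_cases h' : ∃ u v, φ (Y u) ≠ φ (Y v)
        · exact Or.inr ⟨hY, h, h'⟩
        · push Not at h'
          obtain ⟨a⟩ := (inferInstance : Nonempty ι)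
          exact Or.inl (Or.inr ⟨φ (Y a), hY, fun v => h' v a⟩))
    have h2 := tupleProb_le_add hw.1 (p := fun Y : ι → V => (G.comap Y = F ∧ ∀ v, φ (Y v) = v) ∨
        ∃ u, G.comap Y = F ∧ ∀ v, φ (Y v) = u) fun Y h => h
    have h3 := tupleProb_le_sum hw.1 (p := fun Y : ι → V => ∃ u, G.comap Y = F ∧
      ∀ v, φ (Y v) = u) (q := fun u Y => G.comap Y = F ∧ ∀ v, φ (Y v) = u) fun Y h => h
    have h4 : ρ = tupleProb w (fun Y : ι → V => G.comap Y = F) := rfl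
    linarith
  have hr0 : (0:ℝ) < r := by linarith
  have hpid' : pid ≤ P - q * b / r ^ 2 := by
    rw [le_sub_iff_add_le, ← le_sub_iff_add_le', div_le_iff₀ (by positivity)]
    nlinarith [mul_le_mul_of_nonneg_right hqP hb0]
  have hνb : r ^ 2 * (ν * b) ≤ q * b / r ^ 2 / 2 := by
    rw [le_div_iff₀ two_pos, le_div_iff₀ (by positivity)]
    nlinarith [mul_le_mul_of_nonneg_right hνq hb0]
  have hcrude : ρ ≤ copySup F - q * b / r ^ 2 / 2 := by
    have := Finset.sum_le_sum fun u (_ : u ∈ Finset.univ) => hconst u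
    rw [← Finset.mul_sum] at this
    linarith
  obtain ⟨i, j, hij⟩ := exists_adj_of_typical hF
  obtain ⟨y, hy, hm⟩ := exists_mass_irregular_le (F := F) (G := G) hw i j
    (hq0.trans_le (hqP.trans (hPle j)))
  have hpi := tupleProb_const_copy_le_cliqueFreeSup hw hG hij hy
  set m := mass w (fun y' => φ y' = i ∧ Irregular F G φ y y') with hmdef
  have hm0 : 0 ≤ m := mass_nonneg hw.1 _
  have hmq : m * q ≤ b := (mul_le_mul_of_nonneg_left (hqP.trans (hPle j)) hm0).trans hm
  have hfine : ρ ≤ copySup F - (copySup F - cliqueFreeSup F k) * x i ^ Fintype.card ι + r * m := by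
    have h1 := Finset.sum_le_sum fun u (_ : u ∈ Finset.univ.erase i) => hconst u
    rw [← Finset.mul_sum] at h1
    have h2 := Finset.add_sum_erase Finset.univ pc (Finset.mem_univ i)
    have h3 := Finset.add_sum_erase Finset.univ (fun u => x u ^ Fintype.card ι)
      (Finset.mem_univ i)
    have h4 : 0 ≤ q * b / r ^ 2 / 2 := by positivity
    rw [← h3, mul_add] at hlex
    have h5 : pc i ≤ cliqueFreeSup F k * x i ^ Fintype.card ι + r * m := hpi
    have h6 : ∑ u ∈ Finset.univ.erase i, pc u ≤
      copySup F * ∑ u ∈ Finset.univ.erase i, x u ^ Fintype.card ι := h1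
    linarith
  have hpow : q ^ Fintype.card ι ≤ x i ^ Fintype.card ι :=
    pow_le_pow_left₀ hq0.le (hqP.trans (hPle i)) _
  have h1 := mul_le_mul_of_nonneg_left hpow (sub_nonneg.2 hgap)
  have h2 : r * m ≤ (copySup F - ρ) * (2 * r ^ 3 / q ^ 2) := by
    rw [← mul_div_assoc, le_div_iff₀ (by positivity)]
    have g1 : q * b ≤ (copySup F - ρ) * (2 * r ^ 2) := by
      have : q * b / (2 * r ^ 2) ≤ copySup F - ρ := by
        have e : q * b / (2 * r ^ 2) = q * b / r ^ 2 / 2 := by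
          field_simp
        linarith
      rwa [div_le_iff₀ (by positivity)] at this
    have g2 : m * q * q ≤ b * q := mul_le_mul_of_nonneg_right hmq hq0.le
    nlinarith [mul_le_mul_of_nonneg_left (g2.trans ((mul_comm b q).le.trans g1)) hr0.le]
  linarith

end Gap

section Step

variable {ι : Type*} [Fintype ι] [DecidableEq ι] {F : SimpleGraph ι} {D : Finset ι} {K : ℕ}
  {κ ν : ℝ}

lemma copyProb_le_delete_add {V : Type*} [Fintype V] [Nonempty ι] {w : V → ℝ}
    {G : SimpleGraph V} (hw : IsWeight w) (x : V) [Fintype {y // y ≠ x}] {c : ℝ}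
    (hc : 0 ≤ c) (h : 0 < mass w (· ≠ x) →
      copyProb F (G.comap (Subtype.val : {y // y ≠ x} → V))
        (fun y : {y // y ≠ x} => (mass w (· ≠ x))⁻¹ * w y) ≤ c) :
    copyProb F G w ≤ c * (1 - w x) + w x * ∑ a : ι, tupleProb w
      (fun Y : ι → V => G.comap (({a} : Finset ι).piecewise (fun _ => x) Y) = F) := by
  classical
  have hmx : mass w (fun y => y = x) = w x := by
    rw [mass, Finset.sum_eq_single x (fun y _ hy => by rw [if_neg hy, mul_zero]) (by simp)]
    simp
  have hm : mass w (· ≠ x) = 1 - w x := by rw [← hmx]; exact mass_not hw.2 fun y => y = x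
  refine (tupleProb_le_add hw.1 (q := fun Y => G.comap Y = F ∧ ∀ v, Y v ≠ x)
    (s := fun Y => ∃ a : ι, Y a = x ∧ G.comap Y = F) fun Y hY => ?_).trans (add_le_add ?_ ?_)
  · by_cases hx : ∀ v, Y v ≠ x
    · exact Or.inl ⟨hY, hx⟩
    · push Not at hx
      obtain ⟨v, hv⟩ := hx
      exact Or.inr ⟨v, hv, hY⟩
  · refine (tupleProb_forall_mem_le hw.1 (· ≠ x) h).trans (mul_le_mul_of_nonneg_left ?_ hc)
    rw [← hm]
    exact pow_le_of_le_one (mass_nonneg hw.1 _) (mass_le_one hw.1 hw.2 _) Fintype.card_ne_zero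
  · refine (tupleProb_le_sum (κ := ι) hw.1 (q := fun a Y => Y a = x ∧ G.comap Y = F)
      fun Y h => h).trans ?_
    rw [Finset.mul_sum]
    refine Finset.sum_le_sum fun a _ => ?_
    have e : tupleProb w (fun Y : ι → V => Y a = x) = w x := by
      rw [← hmx]; exact tupleProb_apply hw.2 a fun y => y = x
    rw [tupleProb_resample hw.2 {a}]
    have e2 : w x * tupleProb w
        (fun Y : ι → V => G.comap (({a} : Finset ι).piecewise (fun _ => x) Y) = F) =
        tupleMean w (fun t : ι → V => tupleProb w
        (fun Y : ι → V => G.comap (({a} : Finset ι).piecewise (fun _ => x) Y) = F) *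
          if t a = x then 1 else 0) := by
      rw [mul_comm, ← e]
      conv_lhs => rw [tupleProb.eq_def w (fun Y : ι → V => Y a = x)]
      rw [tupleMean, tupleMean, Finset.mul_sum]
      refine Finset.sum_congr rfl fun t _ => ?_
      by_cases ht : t a = x
      · simp only [ht, if_true]; ring
      · simp [ht]
    rw [e2]
    refine tupleMean_mono hw.1 fun t => ?_
    have e3 : ∀ Y : ι → V, ({a} : Finset ι).piecewise t Y a = t a := fun Y => by simp
    simp only [e3]
    by_cases ht : t a = x
    · rw [if_pos ht, mul_one]
      refine tupleProb_mono hw.1 fun Y hY => ?_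
      rw [← hY.2]
      congr 1
      ext v
      by_cases hv : v = a
      · subst hv; simp [ht]
      · simp [hv]
    · simp [ht, tupleProb, tupleMean]

lemma exists_minimal_weighted_graph [Nonempty ι] {k : ℕ} {c : ℝ} (hc0 : 0 ≤ c)
    (hc : c < cliqueFreeSup F k) :
    ∃ (n : ℕ) (G : SimpleGraph (Fin n)) (w : Fin n → ℝ), G.CliqueFree k ∧ IsWeight w ∧
      c < copyProb F G w ∧ ∀ x, copyProb F G w ≤ ∑ a : ι, tupleProb w
        (fun Y : ι → Fin n => G.comap (({a} : Finset ι).piecewise (fun _ => x) Y) = F) := by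
  classical
  have hex : ∃ (n : ℕ) (G : SimpleGraph (Fin n)) (w : Fin n → ℝ), G.CliqueFree k ∧ IsWeight w ∧
      c < copyProb F G w := by
    by_contra! hcon
    refine absurd hc (not_lt.2 (Real.sSup_le ?_ hc0))
    rintro y ⟨n, G, w, h1, h2, rfl⟩
    exact hcon n G w h1 h2
  obtain ⟨n, ⟨G, w, hG, hw, hlt⟩, hmin⟩ : ∃ n : ℕ, (∃ (G : SimpleGraph (Fin n)) (w : Fin n → ℝ),
      G.CliqueFree k ∧ IsWeight w ∧ c < copyProb F G w) ∧ ∀ m < n,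
      ¬ ∃ (G : SimpleGraph (Fin m)) (w : Fin m → ℝ),
        G.CliqueFree k ∧ IsWeight w ∧ c < copyProb F G w :=
    ⟨Nat.find hex, Nat.find_spec hex, fun m hm => Nat.find_min hex hm⟩
  refine ⟨n, G, w, hG, hw, hlt, fun x => ?_⟩
  have hdel := copyProb_le_delete_add hw (F := F) (G := G) x hc0 (fun hpos => by
    by_contra! hgt
    have hcard : Fintype.card {y // y ≠ x} < n := by
      simpa using Fintype.card_subtype_lt (p := fun y => y ≠ x) (x := x) (by simp)
    refine hmin _ hcard ⟨(G.comap Subtype.val).comap (Fintype.equivFin _).symm,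
      _, ?_, isWeight_comp_equiv (Fintype.equivFin _).symm (isWeight_restrict hw.1 _ hpos), ?_⟩
    · refine (hG.comap ⟨(SimpleGraph.Embedding.comap (Function.Embedding.subtype _) G).toCopy⟩
        ).comap ⟨(SimpleGraph.Embedding.comap (Fintype.equivFin {y // y ≠ x}).symm.toEmbedding
          (G.comap (Function.Embedding.subtype _))).toCopy⟩
    · rw [copyProb_equiv]
      exact hgt)
  have hx0 := hw.1 x
  have hx1 : w x ≤ 1 := by
    rw [← hw.2]
    exact Finset.single_le_sum (fun y _ => hw.1 y) (Finset.mem_univ x)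
  have hxpos : 0 < w x := by
    by_contra! h
    have : w x = 0 := le_antisymm h hx0
    rw [this] at hdel
    linarith
  set d := ∑ a : ι, tupleProb w
      (fun Y : ι → Fin n => G.comap (({a} : Finset ι).piecewise (fun _ => x) Y) = F)
  by_contra! hd
  nlinarith

lemma cliqueFreeSup_zero : cliqueFreeSup F 0 = 0 := by
  rw [cliqueFreeSup]
  convert Real.sSup_empty
  ext x
  simp only [Set.mem_ofPred_eq, Set.mem_empty_iff_false, iff_false]
  rintro ⟨n, G, w, h, -⟩
  exact h ∅ (by simp)

/-- For typical `F`, no clique-free family of graphs attains the supremum of copy densities. -/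
theorem cliqueFreeSup_lt_copySup [Nontrivial ι] (hF : Typical F D K) (hsc : Scale D K κ ν)
    (hν : 8 * (Fintype.card ι : ℝ) ^ 4 * ν ≤ (1 / (Fintype.card ι : ℝ)) ^ Fintype.card ι)
    (k : ℕ) : cliqueFreeSup F k < copySup F := by
  have hr : (1:ℝ) ≤ Fintype.card ι := by exact_mod_cast Fintype.card_pos
  have hP := inv_card_pow_le_copySup (F := F)
  set P := (1 / (Fintype.card ι : ℝ)) ^ Fintype.card ι with hPdef
  have hP0 : 0 < P := by positivity
  induction k with
  | zero => rw [cliqueFreeSup_zero]; exact hP0.trans_le hP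
  | succ k ih =>
    by_contra! hle
    set r : ℝ := (Fintype.card ι : ℝ) with hrdef
    set C : ℝ := 1 + 2 * r ^ 3 / (P / 4) ^ 2 with hC
    have hC0 : 0 < C := by positivity
    set δ := (copySup F - cliqueFreeSup F k) * (P / 4) ^ Fintype.card ι with hδ
    have hδ0 : 0 < δ := mul_pos (sub_pos.2 ih) (by positivity)
    set ε := min (P / 2) (δ / C) with hε
    have hε0 : 0 < ε := lt_min (by positivity) (by positivity)
    have hε1 : ε ≤ P / 2 := min_le_left _ _
    have hε2 : ε * C ≤ δ := by
      rw [← le_div_iff₀ hC0]; exact min_le_right _ _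
    obtain ⟨n, G, w, hG, hw, hlt, hd⟩ := exists_minimal_weighted_graph (F := F) (k := k + 1)
      (c := copySup F - ε) (by linarith) (by linarith)
    have hν0 := hsc.pos
    have hr2 : r ≤ r ^ 4 := le_self_pow₀ hr (by norm_num)
    have hr4 : 1 ≤ r ^ 4 := one_le_pow₀ hr
    have hn1 : r * ν ≤ r ^ 4 * ν := mul_le_mul_of_nonneg_right hr2 hν0.le
    have hn2 : 1 * ν ≤ r ^ 4 * ν := mul_le_mul_of_nonneg_right hr4 hν0.le
    obtain ⟨φ, hφ⟩ := exists_regular_partition hw.1 hw.2 hF hsc (G := G)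
      (ρ := copyProb F G w) (by show 2 * r * ν < _; linarith) le_rfl hd
    have := gap_mul_pow_le hw hF hsc hG hφ (q := P / 4) (by positivity) (by linarith)
      (by show 2 * r ^ 4 * ν ≤ _; linarith)
    have h2 : (copySup F - copyProb F G w) * C < ε * C :=
      mul_lt_mul_of_pos_right (by linarith) hC0
    have h3 : δ ≤ (copySup F - copyProb F G w) * C := this
    linarith

end Step

section Inducibility

variable {ι V : Type*} [Fintype ι] [DecidableEq ι]
  {F : SimpleGraph ι} {D : Finset ι} {K : ℕ}

lemma injective_of_comap_eq {G : SimpleGraph V} (hF : Typical F D K) {Y : ι → V}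
    (hY : G.comap Y = F) : Function.Injective Y := by
  intro u v huv
  by_contra hne
  obtain ⟨x, hx⟩ := hF.twin_free u v hne
  rw [← adj_iff_of_comap_eq hY, ← adj_iff_of_comap_eq hY, huv] at hx
  exact hx Iff.rfl

open Classical in
lemma inducedCount_eq_card [Fintype V] [Nontrivial ι] {G : SimpleGraph V} (hF : Typical F D K) :
    inducedCount F G = (Finset.univ.filter fun Y : ι → V => G.comap Y = F).card := by
  rw [inducedCount, ← Set.ncard_coe_finset, ← Set.InjOn.ncard_image
    (f := fun Y : ι → V => Finset.univ.image Y)]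
  · congr 1
    ext s
    simp only [Set.mem_ofPred_eq, Finset.coe_filter, Finset.mem_univ, true_and, Set.mem_image]
    constructor
    · rintro ⟨-, ⟨e⟩⟩
      refine ⟨fun v => (e v : V), ?_, ?_⟩
      · ext a b
        simp only [SimpleGraph.comap_adj]
        exact e.map_adj_iff
      · ext x
        simp only [Finset.mem_image, Finset.mem_univ, true_and]
        constructor
        · rintro ⟨v, rfl⟩
          exact (e v).2
        · intro hx
          exact ⟨e.symm ⟨x, hx⟩, by simp⟩
    · rintro ⟨Y, hY, rfl⟩
      have hinj := injective_of_comap_eq hF hY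
      refine ⟨by rw [Finset.card_image_of_injective _ hinj, Finset.card_univ], ⟨⟨Equiv.ofBijective
        (fun v => ⟨Y v, by simp⟩) ⟨fun a b h => hinj (congrArg Subtype.val h), ?_⟩, ?_⟩⟩⟩
      · rintro ⟨x, hx⟩
        simp only [Finset.coe_image, Finset.coe_univ, Set.image_univ, Set.mem_range] at hx
        obtain ⟨v, rfl⟩ := hx
        exact ⟨v, rfl⟩
      · intro a b
        simp only [SimpleGraph.comap_adj]
        exact adj_iff_of_comap_eq hY a b
  · intro Y hY Y' hY' h
    simp only [Finset.coe_filter, Finset.mem_univ, true_and, Set.mem_ofPred_eq] at hY hY'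
    have hex : ∀ v, ∃ u, Y' u = Y v := by
      intro v
      have : Y v ∈ Finset.univ.image Y' := by
        have h' : Finset.univ.image Y = Finset.univ.image Y' := h
        rw [← h']; simp
      simpa using this
    choose τ hτ using hex
    have hτinj : Function.Injective τ := fun a b hab =>
      injective_of_comap_eq hF hY (by rw [← hτ a, ← hτ b, hab])
    have hid : τ = id := by
      by_contra hne
      obtain ⟨a, b, hab⟩ := exists_pair_ne ι
      obtain ⟨u, v, -, huv⟩ := hF.prime τ hne ⟨a, b, fun h => hab (hτinj h)⟩
      rw [← adj_iff_of_comap_eq hY u v, ← adj_iff_of_comap_eq hY' (τ u), hτ, hτ] at huv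
      exact huv Iff.rfl
    ext v
    rw [← hτ v, hid, id]

lemma copyProb_le_tupleProb_comp {κ : Type*} [Fintype κ] [DecidableEq κ] [Fintype V] {w : V → ℝ}
    (hw : IsWeight w) {G : SimpleGraph V} (Y : ι ↪ κ) :
    copyProb F G w ≤ tupleProb w (fun π : κ → V => G.comap (π ∘ Y) = F) := by
  classical
  have hT : ∀ T : ι → V, tupleProb w (fun π : κ → V => π ∘ Y = T) = ∏ v, w (T v) := by
    intro T
    have e : (fun π : κ → V => π ∘ Y = T) = fun π => ∀ i, ∀ v, Y v = i → π i = T v := by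
      ext π
      constructor
      · rintro rfl i v rfl
        rfl
      · exact fun h => funext fun v => h _ v rfl
    rw [e, tupleProb_forall (fun i y => ∀ v, Y v = i → y = T v)]
    refine (Fintype.prod_of_injective Y Y.injective _ _ (fun i hi => ?_) fun v => ?_).symm
    · have : ∀ y : V, ∀ v, Y v = i → y = T v := fun y v h => absurd ⟨v, h⟩ hi
      refine Eq.trans ?_ hw.2
      exact Finset.sum_congr rfl fun y _ => by rw [if_pos (this y), mul_one]
    · rw [mass, Finset.sum_eq_single (T v)]
      · rw [if_pos, mul_one]
        intro u hu
        rw [Y.injective hu]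
      · intro y _ hy
        rw [if_neg, mul_zero]
        exact fun h => hy (h v rfl)
      · simp
  have h := tupleProb_sum_le (κ := {T : ι → V // G.comap T = F}) hw.1
    (q := fun T (π : κ → V) => π ∘ Y = T.1) (s := fun π => G.comap (π ∘ Y) = F)
    (fun T π h => by rw [h]; exact T.2) (fun T T' π h h' => Subtype.ext (h.symm.trans h'))
  refine le_trans (le_of_eq ?_) h
  simp only [hT]
  rw [copyProb, tupleProb, tupleMean]
  simp only [mul_ite, mul_one, mul_zero]
  rw [← Finset.sum_filter]
  exact Finset.sum_subtype _ (by simp) _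

lemma cliqueFree_comap {κ : Type*} {G : SimpleGraph V} {k : ℕ} (hG : G.CliqueFree k)
    (π : κ → V) : (G.comap π).CliqueFree k := by
  classical
  intro s hs
  rw [SimpleGraph.isNClique_iff] at hs
  have hadj : ∀ a ∈ s, ∀ b ∈ s, a ≠ b → G.Adj (π a) (π b) := fun a ha b hb hab => hs.1 ha hb hab
  refine hG (s.image π) ?_
  rw [SimpleGraph.isNClique_iff]
  constructor
  · intro x hx y hy hxy
    simp only [Finset.coe_image, Set.mem_image] at hx hy
    obtain ⟨a, ha, rfl⟩ := hx
    obtain ⟨b, hb, rfl⟩ := hy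
    exact hadj a ha b hb fun h => hxy (by rw [h])
  · rw [Finset.card_image_of_injOn, hs.2]
    intro a ha b hb hab
    by_contra hne
    exact (hadj a ha b hb hne).ne hab

lemma inducedDensity_le [Nontrivial ι] (hF : Typical F D K) {k n : ℕ} (hn : 0 < n)
    {G : SimpleGraph (Fin n)} (hG : G.CliqueFree k) :
    inducedDensity F G ≤ cliqueFreeSup F k * ((n : ℝ) ^ Fintype.card ι /
      (n.choose (Fintype.card ι) : ℝ)) := by
  classical
  have hn' : (0:ℝ) < n := by exact_mod_cast hn
  rw [inducedDensity, inducedCount_eq_card hF, Fintype.card_fin, ← mul_div_assoc]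
  refine div_le_div_of_nonneg_right ?_ (Nat.cast_nonneg _)
  have hw : IsWeight (fun _ : Fin n => 1 / (n:ℝ)) := by
    refine ⟨fun _ => by positivity, ?_⟩
    rw [Finset.sum_const, Finset.card_univ, Fintype.card_fin, nsmul_eq_mul]
    field_simp
  have h := copyProb_le_cliqueFreeSup (F := F) hG hw
  have e : copyProb F G (fun _ : Fin n => 1 / (n:ℝ)) =
      (1 / (n:ℝ)) ^ Fintype.card ι *
        ((Finset.univ.filter fun Y : ι → Fin n => G.comap Y = F).card : ℝ) := by
    rw [copyProb, tupleProb, tupleMean]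
    simp only [Finset.prod_const, Finset.card_univ]
    rw [← Finset.mul_sum, Finset.card_filter]
    push_cast
    rfl
  rw [e, one_div, inv_pow, inv_mul_le_iff₀ (by positivity)] at h
  linarith

lemma le_ikn [Fintype V] [Nontrivial ι] (hF : Typical F D K) {k n : ℕ} (hn : Fintype.card ι ≤ n)
    {w : V → ℝ} {G : SimpleGraph V} (hG : G.CliqueFree k) (hw : IsWeight w) :
    (Fintype.card ι).factorial * copyProb F G w ≤ ikn F k n := by
  classical
  have hr : 0 < Fintype.card ι := Fintype.card_pos
  have hch : (0:ℝ) < n.choose (Fintype.card ι) := by exact_mod_cast Nat.choose_pos hn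
  have hbd : BddAbove {x : ℝ | ∃ G : SimpleGraph (Fin n), G.CliqueFree k ∧
      x = inducedDensity F G} := by
    refine ⟨cliqueFreeSup F k * ((n : ℝ) ^ Fintype.card ι /
      (n.choose (Fintype.card ι) : ℝ)), ?_⟩
    rintro x ⟨G, hG, rfl⟩
    exact inducedDensity_le hF (hr.trans_le hn) hG
  have hdens : ∀ π : Fin n → V,
      ((Finset.univ.filter fun Y : ι → Fin n => (G.comap π).comap Y = F).card : ℝ) ≤
        ikn F k n * n.choose (Fintype.card ι) := by
    intro π
    have := le_csSup hbd ⟨G.comap π, cliqueFree_comap hG π, rfl⟩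
    rwa [inducedDensity, inducedCount_eq_card hF, Fintype.card_fin, div_le_iff₀ hch] at this
  have hmean := tupleMean_mono hw.1 hdens
  rw [tupleMean_const hw.2] at hmean
  have hlow : (n.descFactorial (Fintype.card ι) : ℝ) * copyProb F G w ≤ tupleMean w
      (fun π : Fin n → V => ((Finset.univ.filter
        fun Y : ι → Fin n => (G.comap π).comap Y = F).card : ℝ)) := by
    have h1 : (n.descFactorial (Fintype.card ι) : ℝ) * copyProb F G w ≤
        ∑ Y : ι ↪ Fin n, tupleProb w (fun π : Fin n → V => G.comap (π ∘ Y) = F) := by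
      refine le_trans (le_of_eq ?_)
        (Finset.sum_le_sum fun Y _ => copyProb_le_tupleProb_comp (F := F) (G := G) hw Y)
      rw [Finset.sum_const, Finset.card_univ, Fintype.card_embedding_eq, Fintype.card_fin,
        nsmul_eq_mul]
    refine h1.trans ?_
    simp only [tupleProb, tupleMean]
    rw [Finset.sum_comm]
    refine Finset.sum_le_sum fun π _ => ?_
    rw [← Finset.mul_sum]
    refine mul_le_mul_of_nonneg_left ?_ (Finset.prod_nonneg fun v _ => hw.1 _)
    rw [Finset.sum_boole, Nat.cast_le]
    refine Finset.card_le_card_of_injOn (fun Y : ι ↪ Fin n => (Y : ι → Fin n)) ?_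
      (DFunLike.coe_injective.injOn)
    intro Y hY
    simp only [Finset.coe_filter, Finset.mem_univ, true_and, Set.mem_ofPred_eq] at hY ⊢
    rw [SimpleGraph.comap_comap]
    exact hY
  rw [Nat.descFactorial_eq_factorial_mul_choose] at hlow
  push_cast at hlow
  have := hlow.trans hmean
  refine le_of_mul_le_mul_right ?_ hch
  linarith

lemma tendsto_ikn [Nontrivial ι] (hF : Typical F D K) (k : ℕ) :
    Tendsto (fun n => ikn F k n) atTop
      (𝓝 ((Fintype.card ι).factorial * cliqueFreeSup F k)) := by
  have hc := cliqueFreeSup_nonneg (F := F) k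
  have hratio : Tendsto (fun n : ℕ => (n : ℝ) ^ Fintype.card ι /
      (n.choose (Fintype.card ι) : ℝ)) atTop (𝓝 ((Fintype.card ι).factorial : ℝ)) := by
    have h := (isEquivalent_choose (Fintype.card ι)).symm
    rw [Asymptotics.isEquivalent_iff_tendsto_one] at h
    · have h2 := h.mul_const ((Fintype.card ι).factorial : ℝ)
      rw [one_mul] at h2
      refine h2.congr fun n => ?_
      simp only [Pi.div_apply]
      have : ((Fintype.card ι).factorial : ℝ) ≠ 0 := by positivity
      rw [div_right_comm, div_mul_cancel₀ _ this]
    · filter_upwards [eventually_ge_atTop (Fintype.card ι)] with n hn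
      have := Nat.choose_pos hn
      positivity
  have hup := hratio.const_mul (cliqueFreeSup F k)
  rw [mul_comm (cliqueFreeSup F k)] at hup
  refine tendsto_of_tendsto_of_tendsto_of_le_of_le' tendsto_const_nhds hup ?_ ?_
  · filter_upwards [eventually_ge_atTop (Fintype.card ι)] with n hn
    have hf : (0:ℝ) < (Fintype.card ι).factorial := by positivity
    rw [mul_comm, ← le_div_iff₀ hf]
    refine Real.sSup_le ?_ (div_nonneg (Real.sSup_nonneg ?_) hf.le)
    · rintro x ⟨m, G, w, hG, hw, rfl⟩
      rw [le_div_iff₀ hf, mul_comm]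
      exact le_ikn hF hn hG hw
    · rintro x ⟨G, -, rfl⟩
      exact div_nonneg (Nat.cast_nonneg _) (Nat.cast_nonneg _)
  · filter_upwards [eventually_gt_atTop 0] with n hn
    refine Real.sSup_le ?_ (mul_nonneg hc (by positivity))
    rintro x ⟨G, hG, rfl⟩
    exact inducedDensity_le hF hn hG

theorem inducibilityDiverse_of_typical [Nontrivial ι] {κ ν : ℝ} (hF : Typical F D K)
    (hsc : Scale D K κ ν)
    (hν : 8 * (Fintype.card ι : ℝ) ^ 4 * ν ≤ (1 / (Fintype.card ι : ℝ)) ^ Fintype.card ι) :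
    InducibilityDiverse F := by
  intro k
  have hlim : ∀ k, ik F k = (Fintype.card ι).factorial * cliqueFreeSup F k :=
    fun k => (tendsto_ikn hF k).limUnder_eq
  have hlt := cliqueFreeSup_lt_copySup hF hsc hν k
  have hne : {x | ∃ (n : ℕ) (G : SimpleGraph (Fin n)) (w : Fin n → ℝ),
      IsWeight w ∧ x = copyProb F G w}.Nonempty :=
    ⟨_, 1, ⊥, fun _ => 1, ⟨fun _ => zero_le_one, by simp⟩, rfl⟩
  obtain ⟨x, ⟨n, G, w, hw, rfl⟩, hx⟩ := exists_lt_of_lt_csSup hne hlt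
  refine ⟨max n k + 1, by omega, ?_⟩
  rw [hlim, hlim]
  refine mul_lt_mul_of_pos_left (hx.trans_le (copyProb_le_cliqueFreeSup ?_ hw)) (by positivity)
  exact G.cliqueFree_of_card_lt (by simp)

end Inducibility

section Counting

open Classical in
lemma card_simpleGraph (V : Type*) [Fintype V] :
    Nat.card (SimpleGraph V) = 2 ^ (Fintype.card V).choose 2 := by
  have e : SimpleGraph V ≃ Set ((Sym2.diagSetᶜ : Set (Sym2 V))) :=
    { toFun := fun G => {e | e.1 ∈ G.edgeSet}
      invFun := fun s => SimpleGraph.fromEdgeSet (Set.image Subtype.val s)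
      left_inv := by
        intro G
        rw [← SimpleGraph.edgeSet_inj, SimpleGraph.edgeSet_fromEdgeSet]
        ext e
        constructor
        · rintro ⟨⟨x, hx, rfl⟩, -⟩
          exact hx
        · intro he
          have := SimpleGraph.edgeSet_subset_compl_diagSet G he
          exact ⟨⟨⟨e, this⟩, he, rfl⟩, this⟩
      right_inv := by
        intro s
        ext e
        simp only [SimpleGraph.edgeSet_fromEdgeSet]
        constructor
        · rintro ⟨⟨x, hx, h⟩, -⟩
          rwa [← Subtype.ext h]
        · intro he
          exact ⟨⟨e, he, rfl⟩, e.2⟩ }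
  rw [Nat.card_congr e, Nat.card_eq_fintype_card, Fintype.card_set, Sym2.card_diagSet_compl]

variable {V ι : Type*} [Fintype ι]

/-- The indices on which `G` treats the pairs `e i` and `f i` differently. -/
noncomputable def disagree (G : SimpleGraph V) (e f : ι → Sym2 V) : Finset ι :=
  open Classical in Finset.univ.filter fun i => ¬ (e i ∈ G.edgeSet ↔ f i ∈ G.edgeSet)

lemma mem_disagree {G : SimpleGraph V} {e f : ι → Sym2 V} {i : ι} :
    i ∈ disagree G e f ↔ ¬ (e i ∈ G.edgeSet ↔ f i ∈ G.edgeSet) := by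
  simp [disagree]

lemma eq_of_disagree_eq {e f : ι → Sym2 V} (rank : Sym2 V → ℕ)
    (hr : ∀ i, rank (f i) < rank (e i)) {G G' : SimpleGraph V}
    (h1 : disagree G e f = disagree G' e f)
    (h2 : ∀ p, p ∉ Set.range e → (p ∈ G.edgeSet ↔ p ∈ G'.edgeSet)) : G = G' := by
  have h : ∀ n, ∀ p : Sym2 V, rank p = n → (p ∈ G.edgeSet ↔ p ∈ G'.edgeSet) := by
    intro n
    induction n using Nat.strong_induction_on with
    | _ n ih =>
      intro p hp
      by_cases hpe : p ∈ Set.range e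
      · obtain ⟨i, rfl⟩ := hpe
        have h3 := ih _ (hp ▸ hr i) (f i) rfl
        have h4 : i ∈ disagree G e f ↔ i ∈ disagree G' e f := by rw [h1]
        rw [mem_disagree, mem_disagree, h3] at h4
        tauto
      · exact h2 p hpe
  rw [← SimpleGraph.edgeSet_inj]
  ext p
  exact h _ p rfl

open Classical in
lemma sum_pow_card_disagree_le [Fintype V] {e f : ι → Sym2 V} (he : Function.Injective e)
    (hd : ∀ i, ¬ (e i).IsDiag) (rank : Sym2 V → ℕ) (hr : ∀ i, rank (f i) < rank (e i))
    {x : ℝ} (hx : 0 ≤ x) :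
    ∑ G : SimpleGraph V, x ^ (disagree G e f).card * 2 ^ Fintype.card ι ≤
      (1 + x) ^ Fintype.card ι * 2 ^ (Fintype.card V).choose 2 := by
  set U : Finset (Sym2 V) := Finset.univ.filter fun p => ¬ p.IsDiag with hU
  set W := U \ Finset.univ.image e with hW
  have hUc : U.card = (Fintype.card V).choose 2 := by
    rw [← Sym2.card_subtype_not_diag, Fintype.card_subtype]
  have hsub : Finset.univ.image e ⊆ U := by
    intro p hp
    simp only [Finset.mem_image, Finset.mem_univ, true_and] at hp
    obtain ⟨i, rfl⟩ := hp
    simp [hU, hd i]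
  have hWc : W.card + Fintype.card ι = (Fintype.card V).choose 2 := by
    have := Finset.card_sdiff_add_card_eq_card hsub
    rwa [Finset.card_image_of_injective _ he, Finset.card_univ, hUc] at this
  rw [← hWc, pow_add, ← mul_assoc, ← Finset.sum_mul]
  refine mul_le_mul_of_nonneg_right ?_ (by positivity)
  have hR : (1 + x) ^ Fintype.card ι * 2 ^ W.card =
      ∑ P ∈ (Finset.univ : Finset (Finset ι)) ×ˢ W.powerset, x ^ P.1.card := by
    rw [Finset.sum_product]
    simp only [Finset.sum_const, Finset.card_powerset, nsmul_eq_mul]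
    rw [← Finset.mul_sum, mul_comm, add_comm, ← Fintype.sum_pow_mul_eq_add_pow]
    simp
  rw [hR]
  set Φ : SimpleGraph V → Finset ι × Finset (Sym2 V) :=
    fun G => (disagree G e f, W.filter fun p => p ∈ G.edgeSet) with hΦ
  have hinj : Function.Injective Φ := by
    intro G G' h
    refine eq_of_disagree_eq rank hr (congrArg Prod.fst h) fun p hp => ?_
    by_cases hpd : p.IsDiag
    · exact ⟨fun h => absurd hpd (G.not_isDiag_of_mem_edgeSet h),
        fun h => absurd hpd (G'.not_isDiag_of_mem_edgeSet h)⟩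
    · have hpW : p ∈ W := by
        simp only [hW, hU, Finset.mem_sdiff, Finset.mem_filter, Finset.mem_univ, true_and,
          Finset.mem_image]
        exact ⟨hpd, hp⟩
      have h3 := congrArg (fun P => p ∈ P.2) h
      simpa [hΦ, hpW] using h3
  calc ∑ G : SimpleGraph V, x ^ (disagree G e f).card
      = ∑ P ∈ Finset.univ.image Φ, x ^ P.1.card := by
        rw [Finset.sum_image fun a _ b _ h => hinj h]
    _ ≤ _ := by
        refine Finset.sum_le_sum_of_subset_of_nonneg ?_ fun _ _ _ => by positivity
        intro P hP
        simp only [Finset.mem_image, Finset.mem_univ, true_and] at hP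
        obtain ⟨G, rfl⟩ := hP
        simp [hΦ]

open Classical in
/-- Few graphs treat the pairs `e i` and `f i` alike for almost all indices `i`. -/
lemma card_disagree_le [Fintype V] {e f : ι → Sym2 V} (he : Function.Injective e)
    (hd : ∀ i, ¬ (e i).IsDiag) (rank : Sym2 V → ℕ) (hr : ∀ i, rank (f i) < rank (e i)) :
    ((Finset.univ.filter fun G : SimpleGraph V =>
        16 * (disagree G e f).card ≤ Fintype.card ι).card : ℝ) ≤
      2 ^ (Fintype.card V).choose 2 * (7 / 10) ^ Fintype.card ι := by
  set N := Fintype.card ι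
  set B := Finset.univ.filter fun G : SimpleGraph V => 16 * (disagree G e f).card ≤ N with hB
  have h := sum_pow_card_disagree_le he hd rank hr (x := 1 / 4) (by norm_num)
  have hlow : (B.card : ℝ) * ((25 / 28) ^ N * 2 ^ N) ≤
      ∑ G : SimpleGraph V, (1 / 4 : ℝ) ^ (disagree G e f).card * 2 ^ N := by
    rw [← nsmul_eq_mul, ← Finset.sum_const]
    refine le_trans (Finset.sum_le_sum fun G hG => ?_)
      (Finset.sum_le_sum_of_subset_of_nonneg (Finset.subset_univ B) fun _ _ _ => by positivity)
    refine mul_le_mul_of_nonneg_right ?_ (by positivity)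
    calc (25 / 28 : ℝ) ^ N ≤ (25 / 28) ^ (16 * (disagree G e f).card) :=
          pow_le_pow_of_le_one (by norm_num) (by norm_num) (by simpa [hB] using hG)
      _ = ((25 / 28) ^ 16) ^ (disagree G e f).card := by rw [pow_mul]
      _ ≤ _ := pow_le_pow_left₀ (by norm_num) (by norm_num) _
  have h2 := hlow.trans h
  have e1 : (2:ℝ) ^ (Fintype.card V).choose 2 * (7 / 10) ^ N * ((25 / 28) ^ N * 2 ^ N) =
      (1 + 1 / 4) ^ N * 2 ^ (Fintype.card V).choose 2 := by
    rw [mul_assoc, ← mul_pow, ← mul_pow, mul_comm]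
    norm_num
  rw [← e1] at h2
  exact le_of_mul_le_mul_right h2 (by positivity)

end Counting

section BadGraphs

lemma ncard_le_of_disagree {V α : Type*} [Fintype V] (S : Finset α) {e f : α → Sym2 V}
    (he : Set.InjOn e S) (hd : ∀ i ∈ S, ¬ (e i).IsDiag) (rank : Sym2 V → ℕ)
    (hr : ∀ i ∈ S, rank (f i) < rank (e i)) (P : SimpleGraph V → Prop)
    (hP : ∀ G, P G → ∃ T : Finset α, 16 * T.card ≤ S.card ∧
      ∀ i ∈ S, ¬ (e i ∈ G.edgeSet ↔ f i ∈ G.edgeSet) → i ∈ T) :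
    ({G | P G}.ncard : ℝ) ≤ 2 ^ (Fintype.card V).choose 2 * (7 / 10) ^ S.card := by
  have h := card_disagree_le (ι := S) (e := fun i => e i) (f := fun i => f i)
    (fun a b hab => Subtype.ext (he a.2 b.2 hab)) (fun i => hd i i.2) rank (fun i => hr i i.2)
  rw [Fintype.card_coe] at h
  refine le_trans ?_ h
  rw [Nat.cast_le, ← Set.ncard_coe_finset]
  refine Set.ncard_le_ncard (fun G hG => ?_) (Set.toFinite _)
  simp only [Finset.coe_filter, Finset.mem_univ, true_and, Set.mem_ofPred_eq]
  obtain ⟨T, hT, hTi⟩ := hP G hG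
  refine le_trans (Nat.mul_le_mul_left _ ?_) hT
  refine Finset.card_le_card_of_injOn Subtype.val ?_ Subtype.val_injective.injOn
  intro i hi
  have hdis : i ∈ disagree G (fun i : S => e i) (fun i => f i) := hi
  rw [mem_disagree] at hdis
  exact hTi _ i.2 hdis

/-- The sum of the endpoints of a pair. -/
def endpointSum {r : ℕ} : Sym2 (Fin r) → ℕ :=
  Sym2.lift ⟨fun a b => (a : ℕ) + b, fun _ _ => Nat.add_comm _ _⟩

@[simp] lemma endpointSum_mk {r : ℕ} (a b : Fin r) : endpointSum s(a, b) = (a : ℕ) + b := rfl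

variable {r : ℕ}

lemma ncard_near_twins_le {u v : Fin r} (huv : u ≠ v) (S : Finset (Fin r)) (hu : u ∉ S)
    (hv : v ∉ S) :
    ({G : SimpleGraph (Fin r) | ∃ T : Finset (Fin r), 16 * T.card ≤ S.card ∧
      ∀ w ∈ S, ¬ (G.Adj u w ↔ G.Adj v w) → w ∈ T}.ncard : ℝ) ≤
      2 ^ r.choose 2 * (7 / 10) ^ S.card := by
  wlog h : v < u generalizing u v
  · have := this huv.symm hv hu (lt_of_le_of_ne (not_lt.mp h) huv)
    simpa only [iff_comm] using this
  have := ncard_le_of_disagree S (e := fun w => s(u, w)) (f := fun w => s(v, w))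
    (fun a _ b _ hab => by
      rcases Sym2.eq_iff.mp hab with h | h
      · exact h.2
      · exact h.2.trans h.1)
    (fun w hw => by
      rw [Sym2.mk_isDiag_iff]
      rintro rfl
      exact hu hw) endpointSum (fun w _ => by simpa using h)
    (fun G => ∃ T : Finset (Fin r), 16 * T.card ≤ S.card ∧
      ∀ w ∈ S, ¬ (G.Adj u w ↔ G.Adj v w) → w ∈ T)
    (fun G hG => hG)
  rwa [Fintype.card_fin] at this

lemma ncard_module_le {M : Finset (Fin r)} (hM : M.Nonempty) :
    ({G : SimpleGraph (Fin r) |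
      ∀ u ∈ M, ∀ v ∈ M, ∀ w, w ∉ M → (G.Adj u w ↔ G.Adj v w)}.ncard : ℝ) ≤
      2 ^ r.choose 2 * (7 / 10) ^ ((M.card - 1) * (r - M.card)) := by
  set a := M.min' hM with ha
  have haM : a ∈ M := M.min'_mem hM
  have hlt : ∀ u ∈ M.erase a, a < u := fun u hu =>
    lt_of_le_of_ne (M.min'_le u (Finset.mem_of_mem_erase hu)) (Finset.ne_of_mem_erase hu).symm
  have hcard : (M.erase a ×ˢ Mᶜ).card = (M.card - 1) * (r - M.card) := by
    rw [Finset.card_product, Finset.card_erase_of_mem haM, Finset.card_compl, Fintype.card_fin]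
  have := ncard_le_of_disagree (M.erase a ×ˢ Mᶜ) (e := fun p => s(p.1, p.2))
    (f := fun p => s(a, p.2))
    (fun p hp q hq hpq => by
      simp only [Finset.coe_product, Set.mem_prod, Finset.mem_coe, Finset.mem_erase,
        Finset.mem_compl] at hp hq
      rcases Sym2.eq_iff.mp hpq with h | h
      · exact Prod.ext h.1 h.2
      · exact absurd (h.1 ▸ hp.1.2) hq.2)
    (fun p hp => by
      simp only [Finset.mem_product, Finset.mem_erase, Finset.mem_compl] at hp
      rw [Sym2.mk_isDiag_iff]
      intro h
      exact hp.2 (h ▸ hp.1.2)) endpointSum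
    (fun p hp => by
      have := hlt p.1 (Finset.mem_product.mp hp).1
      simpa using this)
    (fun G => ∀ u ∈ M, ∀ v ∈ M, ∀ w, w ∉ M → (G.Adj u w ↔ G.Adj v w))
    (fun G hG => by
      refine ⟨∅, by simp, fun p hp h => absurd ?_ h⟩
      simp only [Finset.mem_product, Finset.mem_erase, Finset.mem_compl] at hp
      exact hG _ hp.1.2 _ haM _ hp.2)
  rw [hcard, Fintype.card_fin] at this
  exact this

lemma card_symm_le (J : Finset (Fin r)) (p : Fin r → Fin r → Prop) [DecidableRel p]
    (hp : ∀ u v, p u v → p v u) (hne : ∀ u v, p u v → u ≠ v) :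
    ((J ×ˢ J).filter fun q => p q.1 q.2).card =
      2 * ((J ×ˢ J).filter fun q => q.1 < q.2 ∧ p q.1 q.2).card := by
  have h1 : ((J ×ˢ J).filter fun q => p q.1 q.2) =
      ((J ×ˢ J).filter fun q => q.1 < q.2 ∧ p q.1 q.2) ∪
        ((J ×ˢ J).filter fun q => q.2 < q.1 ∧ p q.1 q.2) := by
    ext q
    simp only [Finset.mem_filter, Finset.mem_product, Finset.mem_union]
    constructor
    · rintro ⟨h, hq⟩
      rcases lt_or_gt_of_ne (hne _ _ hq) with h' | h'
      · exact Or.inl ⟨h, h', hq⟩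
      · exact Or.inr ⟨h, h', hq⟩
    · rintro (⟨h, -, hq⟩ | ⟨h, -, hq⟩) <;> exact ⟨h, hq⟩
  have h2 : ((J ×ˢ J).filter fun q => q.2 < q.1 ∧ p q.1 q.2).card =
      ((J ×ˢ J).filter fun q => q.1 < q.2 ∧ p q.1 q.2).card := by
    refine Finset.card_bij (fun q _ => q.swap) ?_ ?_ ?_
    · intro q hq
      simp only [Finset.mem_filter, Finset.mem_product, Prod.fst_swap, Prod.snd_swap] at hq ⊢
      exact ⟨hq.1.symm, hq.2.1, hp _ _ hq.2.2⟩
    · intro a _ b _ h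
      exact Prod.swap_injective h
    · intro q hq
      simp only [Finset.mem_filter, Finset.mem_product] at hq
      exact ⟨q.swap, by
        simp only [Finset.mem_filter, Finset.mem_product, Prod.fst_swap, Prod.snd_swap]
        exact ⟨hq.1.symm, hq.2.1, hp _ _ hq.2.2⟩, q.swap_swap⟩
  rw [h1, Finset.card_union_of_disjoint, h2, two_mul]
  rw [Finset.disjoint_filter]
  intro q _ h h'
  exact absurd h.1 (not_lt.mpr h'.1.le)

lemma ncard_monotone_shift_le {J : Finset (Fin r)} {τ : Fin r → Fin r} {m : ℕ}
    (hJ : 18 * m ≤ J.card) (hfib : ∀ u, (J.filter fun v => τ v = u).card < m)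
    (hmono : (∀ v ∈ J, v < τ v) ∨ ∀ v ∈ J, τ v < v) :
    ({G : SimpleGraph (Fin r) | ∀ v ∈ J, ∃ T : Finset (Fin r), T.card < m ∧
      ∀ u ∈ J, τ u ≠ τ v → ¬ (G.Adj v u ↔ G.Adj (τ v) (τ u)) → u ∈ T}.ncard : ℝ) ≤
      2 ^ r.choose 2 * (7 / 10) ^ (153 * m ^ 2) := by
  set S := (J ×ˢ J).filter fun q => q.1 < q.2 ∧ τ q.1 ≠ τ q.2 with hS
  have hScard : J.card * (17 * m) ≤ 2 * S.card := by
    rw [hS, ← card_symm_le J (fun u v => τ u ≠ τ v) (fun _ _ h => h.symm)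
      (fun u v h h' => h (by rw [h'])), Finset.card_filter, Finset.sum_product,
      ← smul_eq_mul, ← Finset.sum_const]
    refine Finset.sum_le_sum fun v hv => ?_
    rw [← Finset.card_filter]
    have h1 := Finset.card_filter_add_card_filter_not (s := J) (fun u => τ u = τ v)
    have h2 := hfib (τ v)
    have h3 : (J.filter fun u => ¬ τ u = τ v) = J.filter fun u => τ v ≠ τ u :=
      Finset.filter_congr fun u _ => by rw [ne_comm]
    rw [h3] at h1
    dsimp only
    omega
  have hbad : ∀ G : SimpleGraph (Fin r), (∀ v ∈ J, ∃ T : Finset (Fin r), T.card < m ∧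
      ∀ u ∈ J, τ u ≠ τ v → ¬ (G.Adj v u ↔ G.Adj (τ v) (τ u)) → u ∈ T) →
      ∃ T : Finset (Fin r × Fin r), 16 * T.card ≤ S.card ∧ ∀ q ∈ S,
        ¬ (s(q.1, q.2) ∈ G.edgeSet ↔ s(τ q.1, τ q.2) ∈ G.edgeSet) → q ∈ T := by
    classical
    intro G hG
    refine ⟨S.filter fun q => ¬ (s(q.1, q.2) ∈ G.edgeSet ↔ s(τ q.1, τ q.2) ∈ G.edgeSet), ?_,
      fun q hq h => Finset.mem_filter.mpr ⟨hq, h⟩⟩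
    have h1 : 2 * (S.filter fun q => ¬ (s(q.1, q.2) ∈ G.edgeSet ↔
        s(τ q.1, τ q.2) ∈ G.edgeSet)).card ≤ J.card * m := by
      have h2 := card_symm_le J (fun v u => τ u ≠ τ v ∧ ¬ (G.Adj v u ↔ G.Adj (τ v) (τ u)))
        (fun u v h => ⟨h.1.symm, by rw [G.adj_comm, G.adj_comm (τ v)]; exact h.2⟩)
        (fun u v h h' => h.1 (by rw [h']))
      have h3 : (S.filter fun q => ¬ (s(q.1, q.2) ∈ G.edgeSet ↔ s(τ q.1, τ q.2) ∈ G.edgeSet)) =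
          (J ×ˢ J).filter fun q => q.1 < q.2 ∧ (τ q.2 ≠ τ q.1 ∧
            ¬ (G.Adj q.1 q.2 ↔ G.Adj (τ q.1) (τ q.2))) := by
        rw [hS, Finset.filter_filter]
        refine Finset.filter_congr fun q _ => ?_
        simp only [SimpleGraph.mem_edgeSet]
        rw [and_assoc, ne_comm]
      rw [h3, ← h2, Finset.card_filter, Finset.sum_product, ← smul_eq_mul, ← Finset.sum_const]
      refine Finset.sum_le_sum fun v hv => ?_
      rw [← Finset.card_filter]
      obtain ⟨T, hT, hTi⟩ := hG v hv
      refine (Finset.card_le_card fun u hu => ?_).trans hT.le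
      rw [Finset.mem_filter] at hu
      exact hTi u hu.1 hu.2.1 hu.2.2
    nlinarith
  have key : ∃ rank : Sym2 (Fin r) → ℕ, ∀ q ∈ S, rank s(τ q.1, τ q.2) < rank s(q.1, q.2) := by
    rcases hmono with h | h
    · refine ⟨fun p => 2 * r - endpointSum p, fun q hq => ?_⟩
      simp only [hS, Finset.mem_filter, Finset.mem_product] at hq
      have h1 := h _ hq.1.1
      have h2 := h _ hq.1.2
      have h3 := (τ q.1).2
      have h4 := (τ q.2).2
      simp only [endpointSum_mk]
      rw [Fin.lt_def] at h1 h2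
      omega
    · refine ⟨endpointSum, fun q hq => ?_⟩
      simp only [hS, Finset.mem_filter, Finset.mem_product] at hq
      have h1 := h _ hq.1.1
      have h2 := h _ hq.1.2
      simp only [endpointSum_mk]
      rw [Fin.lt_def] at h1 h2
      omega
  obtain ⟨rank, hrank⟩ := key
  have := ncard_le_of_disagree S (e := fun q => s(q.1, q.2))
    (f := fun q => s(τ q.1, τ q.2))
    (fun p hp q hq hpq => by
      simp only [hS, Finset.coe_filter, Finset.mem_product, Set.mem_ofPred_eq] at hp hq
      rcases Sym2.eq_iff.mp hpq with h | h
      · exact Prod.ext h.1 h.2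
      · have h1 := hp.2.1
        rw [h.1, h.2] at h1
        exact absurd h1 (not_lt.mpr hq.2.1.le))
    (fun q hq => by
      simp only [hS, Finset.mem_filter] at hq
      rw [Sym2.mk_isDiag_iff]
      exact hq.2.1.ne) rank hrank _ hbad
  rw [Fintype.card_fin] at this
  refine this.trans (mul_le_mul_of_nonneg_left ?_ (by positivity))
  refine pow_le_pow_of_le_one (by norm_num) (by norm_num) ?_
  nlinarith

end BadGraphs

section Union

variable {r : ℕ}

lemma typical_of_forall {F : SimpleGraph (Fin r)} {D : Finset (Fin r)} {m : ℕ} (hm : 0 < m)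
    (hr : 608 * m + 2 ≤ r)
    (h1 : ∀ u v, u ≠ v → u ∉ D → v ∉ D → ¬ ∀ x ∈ D, (F.Adj u x ↔ F.Adj v x))
    (h2 : ∀ u v, u ≠ v → ¬ ∃ T : Finset (Fin r), 16 * T.card ≤ r - 2 ∧
      ∀ w ∈ ({u, v} : Finset (Fin r))ᶜ, ¬ (F.Adj u w ↔ F.Adj v w) → w ∈ T)
    (h3 : ∀ (J : Finset (Fin r)) (τ : Fin r → Fin r), 18 * m ≤ J.card →
      (∀ u, (J.filter fun v => τ v = u).card < m) →
      ((∀ v ∈ J, v < τ v) ∨ ∀ v ∈ J, τ v < v) → ¬ ∀ v ∈ J, ∃ T : Finset (Fin r), T.card < m ∧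
      ∀ u ∈ J, τ u ≠ τ v → ¬ (F.Adj v u ↔ F.Adj (τ v) (τ u)) → u ∈ T)
    (h4 : ∀ M : Finset (Fin r), m ≤ M.card → M ≠ Finset.univ →
      ¬ ∀ u ∈ M, ∀ v ∈ M, ∀ w, w ∉ M → (F.Adj u w ↔ F.Adj v w)) : Typical F D m := by
  classical
  have rigid : ∀ (R : Finset (Fin r)) (τ : Fin r → Fin r), Rᶜ.card < m →
      (∀ u, (R.filter fun v => τ v = u).card < m) →
      (∃ v ∈ R, τ v ≠ v) → ∃ v ∈ R, ∃ S : Finset (Fin r), m ≤ S.card ∧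
        ∀ u ∈ S, u ∈ R ∧ τ u ≠ τ v ∧ ¬ (F.Adj v u ↔ F.Adj (τ v) (τ u)) := by
    intro R τ hR hfib ⟨v, hv, hvτ⟩
    have hbig : ∀ J ⊆ R, 18 * m ≤ J.card → ((∀ v ∈ J, v < τ v) ∨ ∀ v ∈ J, τ v < v) →
        ∃ v ∈ R, ∃ S : Finset (Fin r), m ≤ S.card ∧
          ∀ u ∈ S, u ∈ R ∧ τ u ≠ τ v ∧ ¬ (F.Adj v u ↔ F.Adj (τ v) (τ u)) := by
      intro J hJR hJ hmono
      by_contra hcon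
      refine h3 J τ hJ (fun u => (Finset.card_le_card
        (Finset.filter_subset_filter _ hJR)).trans_lt (hfib u)) hmono fun v hv => ?_
      refine ⟨J.filter fun u => τ u ≠ τ v ∧ ¬ (F.Adj v u ↔ F.Adj (τ v) (τ u)), ?_,
        fun u hu h h' => Finset.mem_filter.mpr ⟨hu, h, h'⟩⟩
      by_contra hc
      refine hcon ⟨v, hJR hv, _, not_lt.mp hc, fun u hu => ?_⟩
      rw [Finset.mem_filter] at hu
      exact ⟨hJR hu.1, hu.2⟩
    by_cases hJ1 : 18 * m ≤ (R.filter fun v => v < τ v).card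
    · exact hbig _ (Finset.filter_subset _ _) hJ1 (Or.inl fun v hv => (Finset.mem_filter.mp hv).2)
    by_cases hJ2 : 18 * m ≤ (R.filter fun v => τ v < v).card
    · exact hbig _ (Finset.filter_subset _ _) hJ2 (Or.inr fun v hv => (Finset.mem_filter.mp hv).2)
    by_contra hcon
    set S := R.filter fun u => τ u ≠ τ v ∧ ¬ (F.Adj v u ↔ F.Adj (τ v) (τ u)) with hS
    have hSm : S.card < m := by
      by_contra hc
      exact hcon ⟨v, hv, S, not_lt.mp hc, fun u hu => Finset.mem_filter.mp hu⟩
    refine h2 v (τ v) hvτ.symm ⟨(Rᶜ ∪ ((R.filter fun v => v < τ v) ∪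
      R.filter fun v => τ v < v)) ∪ S, ?_, fun w hw hwd => ?_⟩
    · have e1 := Finset.card_union_le (Rᶜ ∪ ((R.filter fun v => v < τ v) ∪
        R.filter fun v => τ v < v)) S
      have e2 := Finset.card_union_le Rᶜ ((R.filter fun v => v < τ v) ∪
        R.filter fun v => τ v < v)
      have e3 := Finset.card_union_le (R.filter fun v => v < τ v) (R.filter fun v => τ v < v)
      omega
    · simp only [Finset.mem_compl, Finset.mem_insert, Finset.mem_singleton, not_or] at hw
      simp only [Finset.mem_union, Finset.mem_compl, Finset.mem_filter, hS]
      by_cases hwR : w ∈ R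
      · rcases lt_trichotomy w (τ w) with h | h | h
        · exact Or.inl (Or.inr (Or.inl ⟨hwR, h⟩))
        · refine Or.inr ⟨hwR, ?_⟩
          rw [← h]
          exact ⟨hw.2, hwd⟩
        · exact Or.inl (Or.inr (Or.inr ⟨hwR, h⟩))
      · exact Or.inl (Or.inl hwR)
  refine ⟨fun u v hu hv huv => ?_, fun u v huv => ?_, rigid, fun τ hτ hτ' => ?_⟩
  · by_contra hcon
    refine h1 u v huv hu hv fun x hx => ?_
    by_contra h
    exact hcon ⟨x, hx, h⟩
  · by_contra hcon
    refine h2 u v huv ⟨∅, by simp, fun w _ h => absurd ⟨w, h⟩ hcon⟩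
  · by_contra hcon
    by_cases hfib : ∀ u, ((Finset.univ : Finset (Fin r)).filter fun v => τ v = u).card < m
    · obtain ⟨v, -, S, hS, hSp⟩ := rigid Finset.univ τ (by simpa using hm) hfib (by
        by_contra h
        refine hτ (funext fun v => ?_)
        by_contra hv
        exact h ⟨v, Finset.mem_univ _, hv⟩)
      obtain ⟨u, hu⟩ := Finset.card_pos.mp (hm.trans_le hS)
      exact hcon ⟨v, u, (hSp u hu).2.1.symm, (hSp u hu).2.2⟩
    · push Not at hfib
      obtain ⟨a, ha⟩ := hfib
      have key : ∀ u w, τ u = a → τ w ≠ a → (F.Adj u w ↔ F.Adj a (τ w)) := by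
        intro u w hu hw
        by_contra h
        refine hcon ⟨u, w, fun h' => hw (h'.symm.trans hu), ?_⟩
        rwa [hu]
      refine h4 _ ha (fun h => ?_) fun u hu v hv w hw => ?_
      · obtain ⟨u, v, huv⟩ := hτ'
        have hall : ∀ x, τ x = a := fun x => by
          have : x ∈ (Finset.univ : Finset (Fin r)).filter fun v => τ v = a := by
            rw [h]; exact Finset.mem_univ _
          simpa using this
        exact huv ((hall u).trans (hall v).symm)
      · simp only [Finset.mem_filter, Finset.mem_univ, true_and] at hu hv hw
        rw [key u w hu hw, key v w hv hw]

lemma ncard_iUnion_le_sum {X I : Type*} [Finite X] [Fintype I] (A : I → Set X) (b : I → ℝ)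
    (h : ∀ i, ((A i).ncard : ℝ) ≤ b i) : ((⋃ i, A i).ncard : ℝ) ≤ ∑ i, b i := by
  have : (⋃ i, A i).ncard ≤ ∑ i, (A i).ncard := by
    have := Finset.set_ncard_biUnion_le Finset.univ A
    simpa using this
  refine le_trans (Nat.cast_le.mpr this) ?_
  push_cast
  exact Finset.sum_le_sum fun i _ => h i

lemma ncard_not_typical_le {D : Finset (Fin r)} {m : ℕ} (hm : 0 < m) (hr : 608 * m + 2 ≤ r) :
    ({G : SimpleGraph (Fin r) | ¬ Typical G D m}.ncard : ℝ) ≤ 2 ^ r.choose 2 *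
      (r ^ 2 * (7 / 10) ^ D.card + r ^ 2 * (7 / 10) ^ (r - 2) +
        2 ^ r * r ^ r * (7 / 10) ^ (153 * m ^ 2) + ((1 + (7 / 10) ^ (m - 1)) ^ r - 1)) := by
  set C : ℝ := 2 ^ r.choose 2 with hC
  have hC0 : 0 ≤ C := by positivity
  set B1 : Fin r × Fin r → Set (SimpleGraph (Fin r)) := fun p =>
    {G | (p.1 ≠ p.2 ∧ p.1 ∉ D ∧ p.2 ∉ D) ∧ ∀ x ∈ D, (G.Adj p.1 x ↔ G.Adj p.2 x)} with hB1
  set B2 : Fin r × Fin r → Set (SimpleGraph (Fin r)) := fun p =>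
    {G | p.1 ≠ p.2 ∧ ∃ T : Finset (Fin r), 16 * T.card ≤ r - 2 ∧
      ∀ w ∈ ({p.1, p.2} : Finset (Fin r))ᶜ, ¬ (G.Adj p.1 w ↔ G.Adj p.2 w) → w ∈ T} with hB2
  set B3 : Finset (Fin r) × (Fin r → Fin r) → Set (SimpleGraph (Fin r)) := fun p =>
    {G | (18 * m ≤ p.1.card ∧ (∀ u, (p.1.filter fun v => p.2 v = u).card < m) ∧
      ((∀ v ∈ p.1, v < p.2 v) ∨ ∀ v ∈ p.1, p.2 v < v)) ∧ ∀ v ∈ p.1, ∃ T : Finset (Fin r),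
      T.card < m ∧ ∀ u ∈ p.1, p.2 u ≠ p.2 v → ¬ (G.Adj v u ↔ G.Adj (p.2 v) (p.2 u)) → u ∈ T}
    with hB3
  set B4 : Finset (Fin r) → Set (SimpleGraph (Fin r)) := fun M =>
    {G | (m ≤ M.card ∧ M ≠ Finset.univ) ∧
      ∀ u ∈ M, ∀ v ∈ M, ∀ w, w ∉ M → (G.Adj u w ↔ G.Adj v w)} with hB4
  have hsub : {G : SimpleGraph (Fin r) | ¬ Typical G D m} ⊆
      (((⋃ p, B1 p) ∪ ⋃ p, B2 p) ∪ ⋃ p, B3 p) ∪ ⋃ M, B4 M := by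
    intro G hG
    by_contra hcon
    simp only [Set.mem_union, Set.mem_iUnion, not_or, not_exists] at hcon
    obtain ⟨⟨⟨c1, c2⟩, c3⟩, c4⟩ := hcon
    exact hG (typical_of_forall hm hr
      (fun u v huv hu hv h => c1 (u, v) ⟨⟨huv, hu, hv⟩, h⟩)
      (fun u v huv h => c2 (u, v) ⟨huv, h⟩)
      (fun J τ hJ hf hmono h => c3 (J, τ) ⟨⟨hJ, hf, hmono⟩, h⟩)
      (fun M hM hM' h => c4 M ⟨⟨hM, hM'⟩, h⟩))
  have hempty : ∀ b : ℝ, 0 ≤ b → ((∅ : Set (SimpleGraph (Fin r))).ncard : ℝ) ≤ b := by simp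
  have b1 := ncard_iUnion_le_sum B1 (fun _ => C * (7 / 10) ^ D.card) (fun p => by
    by_cases hp : p.1 ≠ p.2 ∧ p.1 ∉ D ∧ p.2 ∉ D
    · refine le_trans (Nat.cast_le.mpr (Set.ncard_le_ncard ?_ (Set.toFinite _)))
        (ncard_near_twins_le hp.1 D hp.2.1 hp.2.2)
      intro G hG
      exact ⟨∅, by simp, fun w hw h => absurd (hG.2 w hw) h⟩
    · have : B1 p = ∅ := Set.eq_empty_of_forall_notMem fun G hG => hp hG.1
      rw [this]
      exact hempty _ (by positivity))
  have b2 := ncard_iUnion_le_sum B2 (fun _ => C * (7 / 10) ^ (r - 2)) (fun p => by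
    by_cases hp : p.1 ≠ p.2
    · have hc : (({p.1, p.2} : Finset (Fin r))ᶜ).card = r - 2 := by
        rw [Finset.card_compl, Finset.card_pair hp, Fintype.card_fin]
      have := ncard_near_twins_le hp ({p.1, p.2} : Finset (Fin r))ᶜ (by simp) (by simp)
      rw [hc] at this
      refine le_trans (Nat.cast_le.mpr (Set.ncard_le_ncard ?_ (Set.toFinite _))) this
      intro G hG
      exact hG.2
    · have : B2 p = ∅ := Set.eq_empty_of_forall_notMem fun G hG => hp hG.1
      rw [this]
      exact hempty _ (by positivity))
  have b3 := ncard_iUnion_le_sum B3 (fun _ => C * (7 / 10) ^ (153 * m ^ 2)) (fun p => by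
    by_cases hp : 18 * m ≤ p.1.card ∧ (∀ u, (p.1.filter fun v => p.2 v = u).card < m) ∧
      ((∀ v ∈ p.1, v < p.2 v) ∨ ∀ v ∈ p.1, p.2 v < v)
    · refine le_trans (Nat.cast_le.mpr (Set.ncard_le_ncard ?_ (Set.toFinite _)))
        (ncard_monotone_shift_le hp.1 hp.2.1 hp.2.2)
      intro G hG
      exact hG.2
    · have : B3 p = ∅ := Set.eq_empty_of_forall_notMem fun G hG => hp hG.1
      rw [this]
      exact hempty _ (by positivity))
  have b4 := ncard_iUnion_le_sum B4 (fun M => C * if M = Finset.univ then 0 else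
      ((7 / 10) ^ (m - 1)) ^ (r - M.card)) (fun M => by
    by_cases hM : m ≤ M.card ∧ M ≠ Finset.univ
    · rw [if_neg hM.2]
      refine le_trans (Nat.cast_le.mpr (Set.ncard_le_ncard ?_ (Set.toFinite _)))
        ((ncard_module_le (Finset.card_pos.mp (hm.trans_le hM.1))).trans ?_)
      · intro G hG
        exact hG.2
      · refine mul_le_mul_of_nonneg_left ?_ hC0
        rw [← pow_mul]
        refine pow_le_pow_of_le_one (by norm_num) (by norm_num) ?_
        exact Nat.mul_le_mul_right _ (Nat.sub_le_sub_right hM.1 1)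
    · have : B4 M = ∅ := Set.eq_empty_of_forall_notMem fun G hG => hM hG.1
      rw [this]
      refine hempty _ (mul_nonneg hC0 ?_)
      split_ifs <;> positivity)
  have hsum4 : ∑ M : Finset (Fin r), (if M = Finset.univ then (0:ℝ) else
      ((7 / 10) ^ (m - 1)) ^ (r - M.card)) = (1 + (7 / 10) ^ (m - 1)) ^ r - 1 := by
    have h := Fintype.sum_pow_mul_eq_add_pow (Fin r) (1:ℝ) ((7 / 10) ^ (m - 1))
    simp only [one_pow, one_mul, Fintype.card_fin] at h
    rw [← h, ← Finset.add_sum_erase _ _ (Finset.mem_univ (Finset.univ : Finset (Fin r))),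
      ← Finset.add_sum_erase (Finset.univ : Finset (Finset (Fin r)))
        (fun M => (((7:ℝ) / 10) ^ (m - 1)) ^ (r - M.card)) (Finset.mem_univ Finset.univ)]
    simp only [if_true, Finset.card_univ, Fintype.card_fin, Nat.sub_self, pow_zero,
      add_sub_cancel_left, zero_add]
    exact Finset.sum_congr rfl fun M hM => if_neg (Finset.ne_of_mem_erase hM)
  rw [← Finset.mul_sum, hsum4] at b4
  simp only [Finset.sum_const, Finset.card_univ, Fintype.card_prod, Fintype.card_fin,
    Fintype.card_finset, Fintype.card_fun, nsmul_eq_mul] at b1 b2 b3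
  push_cast at b1 b2 b3
  have u1 := Set.ncard_le_ncard hsub (Set.toFinite _)
  have u2 := Set.ncard_union_le (((⋃ p, B1 p) ∪ ⋃ p, B2 p) ∪ ⋃ p, B3 p) (⋃ M, B4 M)
  have u3 := Set.ncard_union_le ((⋃ p, B1 p) ∪ ⋃ p, B2 p) (⋃ p, B3 p)
  have u4 := Set.ncard_union_le (⋃ p, B1 p) (⋃ p, B2 p)
  have u5 : ({G : SimpleGraph (Fin r) | ¬ Typical G D m}.ncard : ℝ) ≤ (⋃ p, B1 p).ncard +
      (⋃ p, B2 p).ncard + (⋃ p, B3 p).ncard + (⋃ M, B4 M).ncard := by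
    exact_mod_cast u1.trans (u2.trans (by omega))
  refine u5.trans ?_
  linarith

end Union

section Asymptotics

lemma pow_self_le_of_add_eq {n q r : ℕ} (hn : 0 < n) (h : n + q = r) :
    (r : ℝ) ^ r ≤ (n : ℝ) ^ n * (Real.exp 1 * r) ^ q := by
  have hn' : (0:ℝ) < n := by exact_mod_cast hn
  have hr : (r : ℝ) = n * (1 + q / n) := by
    rw [← h]
    push_cast
    field_simp
  have h1 : (r : ℝ) ^ n ≤ (n : ℝ) ^ n * Real.exp 1 ^ q := by
    rw [hr, mul_pow]
    refine mul_le_mul_of_nonneg_left ?_ (by positivity)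
    calc (1 + (q:ℝ) / n) ^ n ≤ Real.exp (q / n) ^ n := by
          refine pow_le_pow_left₀ (by positivity) ?_ _
          rw [add_comm]
          exact Real.add_one_le_exp _
      _ = Real.exp 1 ^ q := by
          rw [← Real.exp_nat_mul, ← Real.exp_nat_mul]
          congr 1
          field_simp
  calc (r : ℝ) ^ r = (r : ℝ) ^ n * (r : ℝ) ^ q := by rw [← pow_add, h]
    _ ≤ (n : ℝ) ^ n * Real.exp 1 ^ q * (r : ℝ) ^ q :=
        mul_le_mul_of_nonneg_right h1 (by positivity)
    _ = _ := by rw [mul_pow, mul_assoc]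

lemma scale_of_le {r : ℕ} {D : Finset (Fin r)} {m : ℕ} {κ : ℝ} (hκ : 0 ≤ κ) (hκ1 : κ ≤ 1)
    (hD : D.card + 3 < r) (hm : 9 * κ * r ≤ m)
    (hbig : 8 * (r:ℝ) ^ 5 * (Real.exp 2 * r) ^ (D.card + 3) ≤ Real.exp (κ * r)) :
    Scale D m κ ((1 / (r:ℝ)) ^ r / (8 * (r:ℝ) ^ 4)) := by
  have hr0 : 0 < r := by omega
  have hr : (0:ℝ) < r := by exact_mod_cast hr0
  have hr1 : (1:ℝ) ≤ r := by exact_mod_cast hr0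
  have core : ∀ (n q : ℕ) (x : ℝ), 0 < n → n + q = r → q ≤ D.card + 3 →
      x ≤ r * Real.exp q * Real.exp (-(κ * r)) →
      x / (n:ℝ) ^ n ≤ (1 / (r:ℝ)) ^ r / (8 * (r:ℝ) ^ 4) := by
    intro n q x hn hnq hq hx
    have hn' : (0:ℝ) < n := by exact_mod_cast hn
    have hpow : (Real.exp 2 * (r:ℝ)) ^ q ≤ (Real.exp 2 * r) ^ (D.card + 3) :=
      pow_le_pow_right₀ (one_le_mul_of_one_le_of_one_le (Real.one_le_exp (by norm_num)) hr1) hq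
    have e2 : Real.exp q * (Real.exp 1 * r) ^ q = (Real.exp 2 * (r:ℝ)) ^ q := by
      rw [mul_pow, mul_pow, ← Real.exp_nat_mul, ← Real.exp_nat_mul, ← mul_assoc, ← Real.exp_add]
      congr 2
      ring
    rw [one_div, inv_pow, ← one_div, div_div, div_le_div_iff₀ (by positivity) (by positivity),
      one_mul]
    calc x * ((r:ℝ) ^ r * (8 * (r:ℝ) ^ 4))
        ≤ r * Real.exp q * Real.exp (-(κ * r)) *
          (((n : ℝ) ^ n * (Real.exp 1 * r) ^ q) * (8 * (r:ℝ) ^ 4)) := by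
          refine mul_le_mul hx (mul_le_mul_of_nonneg_right (pow_self_le_of_add_eq hn hnq)
            (by positivity)) (by positivity) (by positivity)
      _ = (n : ℝ) ^ n * (Real.exp (-(κ * r)) * (8 * (r:ℝ) ^ 5 * (Real.exp 2 * r) ^ q)) := by
          rw [← e2]
          ring
      _ ≤ (n : ℝ) ^ n * (Real.exp (-(κ * r)) * Real.exp (κ * r)) := by
          refine mul_le_mul_of_nonneg_left (mul_le_mul_of_nonneg_left
            (le_trans (mul_le_mul_of_nonneg_left hpow (by positivity)) hbig)
            (Real.exp_pos _).le) (by positivity)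
      _ = (n : ℝ) ^ n := by rw [← Real.exp_add, neg_add_cancel, Real.exp_zero, mul_one]
  have hQ : ∀ Q : Finset (Fin r), Q.card ≤ D.card + 3 →
      0 < (Qᶜ).card ∧ (Qᶜ).card + Q.card = r := by
    intro Q h
    have := Finset.card_compl_add_card Q
    rw [Fintype.card_fin] at this
    omega
  refine ⟨fun Q h => ?_, fun Q h => ?_, by positivity, hκ⟩
  · obtain ⟨hn, hnq⟩ := hQ Q h
    rw [div_pow]
    refine core _ _ _ hn hnq h ?_
    have hnq' : ((Qᶜ).card : ℝ) + Q.card = r := by exact_mod_cast hnq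
    have hq0 : (0:ℝ) ≤ Q.card := Nat.cast_nonneg _
    calc (1 - κ) ^ (Qᶜ).card ≤ Real.exp (-κ) ^ (Qᶜ).card :=
          pow_le_pow_left₀ (by linarith) (by linarith [Real.add_one_le_exp (-κ)]) _
      _ = Real.exp (κ * Q.card - κ * r) := by
          rw [← Real.exp_nat_mul, ← hnq']
          congr 1
          ring
      _ ≤ Real.exp (Q.card - κ * r) := by
          refine Real.exp_le_exp.mpr ?_
          nlinarith
      _ = 1 * Real.exp Q.card * Real.exp (-(κ * r)) := by
          rw [one_mul, ← Real.exp_add]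
          congr 1
      _ ≤ _ := by gcongr
  · obtain ⟨hn, hnq⟩ := hQ Q h
    rw [div_pow, ← mul_div_assoc, ← mul_div_assoc, Fintype.card_fin]
    refine core _ _ _ hn hnq h ?_
    have hnr : ((Qᶜ).card : ℝ) ≤ r := by
      have : (Qᶜ).card ≤ r := by omega
      exact_mod_cast this
    rw [mul_assoc (r:ℝ)]
    refine mul_le_mul_of_nonneg_left ?_ hr.le
    calc Real.exp (Q.card - m) * (1 + 2 * (4 * κ)) ^ (Qᶜ).card
        ≤ Real.exp (Q.card - m) * Real.exp (8 * κ) ^ (Qᶜ).card := by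
          refine mul_le_mul_of_nonneg_left (pow_le_pow_left₀ (by linarith)
            (by linarith [Real.add_one_le_exp (8 * κ)]) _) (Real.exp_pos _).le
      _ = Real.exp (Q.card - m + (Qᶜ).card * (8 * κ)) := by
          rw [← Real.exp_nat_mul, ← Real.exp_add]
      _ ≤ Real.exp (Q.card + -(κ * r)) := by
          refine Real.exp_le_exp.mpr ?_
          nlinarith
      _ = _ := by rw [Real.exp_add]

lemma eventually_sqrt_pow_le_exp {κ : ℝ} (hκ : 0 < κ) : ∀ᶠ r : ℕ in atTop,
    8 * (r:ℝ) ^ 5 * (Real.exp 2 * r) ^ (Nat.sqrt r + 3) ≤ Real.exp (κ * r) := by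
  have h1 : ∀ᶠ x : ℝ in atTop, Real.log x ≤ x ^ (1 / 4 : ℝ) := by
    have := (isLittleO_log_rpow_atTop (r := 1 / 4) (by norm_num)).bound one_pos
    filter_upwards [this, eventually_gt_atTop 0] with x hx hx0
    rw [one_mul, Real.norm_of_nonneg (Real.rpow_nonneg hx0.le _)] at hx
    exact (le_abs_self _).trans hx
  have h2 : ∀ᶠ x : ℝ in atTop, max 10 (3 / κ) ≤ x ^ (1 / 4 : ℝ) :=
    (tendsto_rpow_atTop (by norm_num)).eventually_ge_atTop _
  have hcast := tendsto_natCast_atTop_atTop (R := ℝ)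
  filter_upwards [hcast.eventually h1, hcast.eventually h2, eventually_gt_atTop 0]
    with r hlog ht hr0
  have hr : (0:ℝ) < r := by exact_mod_cast hr0
  set t := (r:ℝ) ^ (1 / 4 : ℝ) with htdef
  have ht4 : t ^ 4 = r := by
    rw [htdef, ← Real.rpow_natCast, ← Real.rpow_mul hr.le]
    norm_num
  have ht10 : 10 ≤ t := (le_max_left _ _).trans ht
  have htκ : 3 ≤ κ * t := by
    have := (le_max_right _ _).trans ht
    rw [div_le_iff₀ hκ] at this
    linarith
  have hs : (Nat.sqrt r : ℝ) ≤ t ^ 2 := by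
    have h : ((Nat.sqrt r : ℝ)) ^ 2 ≤ r := by exact_mod_cast Nat.sqrt_le' r
    rw [← ht4] at h
    nlinarith [sq_nonneg t, Nat.cast_nonneg (α := ℝ) (Nat.sqrt r)]
  have hexpr : (r:ℝ) ≤ Real.exp t := by
    rwa [Real.log_le_iff_le_exp hr] at hlog
  have h8 : (8:ℝ) ≤ Real.exp t := by
    linarith [Real.add_one_le_exp t]
  calc 8 * (r:ℝ) ^ 5 * (Real.exp 2 * r) ^ (Nat.sqrt r + 3)
      ≤ Real.exp t * Real.exp t ^ 5 * (Real.exp 2 * Real.exp t) ^ (Nat.sqrt r + 3) := by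
        gcongr
    _ = Real.exp (6 * t + (Nat.sqrt r + 3) * (2 + t)) := by
        rw [← pow_succ', ← Real.exp_add, ← Real.exp_nat_mul, ← Real.exp_nat_mul, ← Real.exp_add]
        push_cast
        congr 1
    _ ≤ Real.exp (κ * r) := by
        refine Real.exp_le_exp.mpr ?_
        have a1 : (Nat.sqrt r + 3 : ℝ) * (2 + t) ≤ (t ^ 2 + 3) * (2 + t) := by gcongr
        have a2 : 3 * t ^ 3 ≤ κ * r := by
          rw [← ht4]
          have : 0 ≤ t ^ 3 := by positivity
          nlinarith
        nlinarith [mul_nonneg (sub_nonneg.mpr ht10) (sq_nonneg t)]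

lemma tendsto_sq_mul_pow_sqrt :
    Tendsto (fun r : ℕ => (r:ℝ) ^ 2 * (7 / 10) ^ Nat.sqrt r) atTop (𝓝 0) := by
  have hsqrt : Tendsto Nat.sqrt atTop atTop :=
    tendsto_atTop_atTop.mpr fun b => ⟨b * b, fun a ha => Nat.le_sqrt.mpr ha⟩
  have h := (tendsto_pow_const_mul_const_pow_of_abs_lt_one 4
    (r := (7 / 10 : ℝ)) (by norm_num [abs_lt])).const_mul 16
  rw [mul_zero] at h
  refine tendsto_of_tendsto_of_tendsto_of_le_of_le' tendsto_const_nhds (h.comp hsqrt)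
    (Eventually.of_forall fun r => by positivity) ?_
  filter_upwards [hsqrt.eventually_ge_atTop 1] with r hr
  have h1 : (r:ℝ) ≤ (2 * Nat.sqrt r) ^ 2 := by
    have : r < (Nat.sqrt r + 1) ^ 2 := Nat.lt_succ_sqrt' r
    have h2 : r ≤ (2 * Nat.sqrt r) ^ 2 := this.le.trans (Nat.pow_le_pow_left (by omega) 2)
    exact_mod_cast h2
  simp only [Function.comp]
  rw [← mul_assoc]
  refine mul_le_mul_of_nonneg_right ?_ (by positivity)
  calc (r:ℝ) ^ 2 ≤ ((2 * Nat.sqrt r) ^ 2) ^ 2 := by gcongr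
    _ = _ := by ring

lemma tendsto_sq_mul_pow_sub_two :
    Tendsto (fun r : ℕ => (r:ℝ) ^ 2 * (7 / 10) ^ (r - 2)) atTop (𝓝 0) := by
  have h := (tendsto_pow_const_mul_const_pow_of_abs_lt_one 2
    (r := (7 / 10 : ℝ)) (by norm_num [abs_lt])).const_mul (100 / 49)
  rw [mul_zero] at h
  refine h.congr' ?_
  filter_upwards [eventually_ge_atTop 2] with r hr
  obtain ⟨k, rfl⟩ := Nat.exists_eq_add_of_le hr
  rw [Nat.add_sub_cancel_left, pow_add]
  ring

lemma tendsto_pow_self_mul_pow_sq (a k : ℕ) :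
    Tendsto (fun m : ℕ => ((a:ℝ) * m) ^ (k * m) * (7 / 10) ^ (153 * m ^ 2)) atTop (𝓝 0) := by
  have h := (tendsto_pow_const_mul_const_pow_of_abs_lt_one k
    (r := ((7 / 10) ^ 153 : ℝ)) (by
      rw [abs_of_nonneg (by positivity)]
      exact pow_lt_one₀ (by norm_num) (by norm_num) (by norm_num))).const_mul ((a:ℝ) ^ k)
  rw [mul_zero] at h
  have hev := h.eventually_le_const (u := 1 / 2) (by norm_num)
  refine tendsto_of_tendsto_of_tendsto_of_le_of_le' tendsto_const_nhds
    (tendsto_pow_atTop_nhds_zero_of_lt_one (r := (1 / 2 : ℝ)) (by norm_num) (by norm_num))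
    (Eventually.of_forall fun r => by positivity) ?_
  filter_upwards [hev] with m hm
  refine le_trans (le_of_eq ?_) (pow_le_pow_left₀ (by positivity) hm m)
  rw [mul_pow, mul_pow, mul_pow, ← pow_mul, ← pow_mul, ← pow_mul, ← pow_mul, mul_assoc, sq,
    ← mul_assoc 153]

lemma tendsto_one_add_pow_sub_one :
    Tendsto (fun r : ℕ => (1 + (7 / 10 : ℝ) ^ (r / 1000 - 1)) ^ r - 1) atTop (𝓝 0) := by
  have hdiv : Tendsto (fun r : ℕ => r / 1000) atTop atTop := Nat.tendsto_div_const_atTop (by simp)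
  have h := ((tendsto_pow_const_mul_const_pow_of_abs_lt_one 1
    (r := (7 / 10 : ℝ)) (by norm_num [abs_lt])).const_mul (20000 / 7)).comp hdiv
  rw [mul_zero] at h
  have h2 := ((Real.continuous_exp.tendsto 0).comp h).sub_const 1
  rw [Real.exp_zero, sub_self] at h2
  refine tendsto_of_tendsto_of_tendsto_of_le_of_le' tendsto_const_nhds h2
    (Eventually.of_forall fun r => ?_) ?_
  · refine sub_nonneg.mpr (one_le_pow₀ ?_)
    have : (0:ℝ) ≤ (7 / 10 : ℝ) ^ (r / 1000 - 1) := by positivity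
    linarith
  · filter_upwards [eventually_ge_atTop 1000] with r hr
    refine sub_le_sub_right ?_ 1
    simp only [Function.comp, pow_one]
    obtain ⟨k, hk⟩ : ∃ k, r / 1000 = k + 1 := ⟨r / 1000 - 1, by omega⟩
    have hrk : r ≤ 2000 * (k + 1) := by omega
    have hrk' : (r:ℝ) ≤ 2000 * (k + 1) := by exact_mod_cast hrk
    rw [hk, Nat.add_sub_cancel]
    calc (1 + (7 / 10 : ℝ) ^ k) ^ r ≤ Real.exp ((7 / 10 : ℝ) ^ k) ^ r := by
          refine pow_le_pow_left₀ (by positivity) ?_ _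
          rw [add_comm]
          exact Real.add_one_le_exp _
      _ = Real.exp (r * (7 / 10 : ℝ) ^ k) := by rw [← Real.exp_nat_mul]
      _ ≤ _ := by
          refine Real.exp_le_exp.mpr ?_
          have : (0:ℝ) ≤ (7 / 10 : ℝ) ^ k := by positivity
          push_cast
          rw [pow_succ]
          nlinarith

lemma tendsto_two_pow_mul_pow_self :
    Tendsto (fun r : ℕ => (2:ℝ) ^ r * r ^ r * (7 / 10) ^ (153 * (r / 1000) ^ 2)) atTop (𝓝 0) := by
  have hdiv : Tendsto (fun r : ℕ => r / 1000) atTop atTop := Nat.tendsto_div_const_atTop (by simp)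
  refine tendsto_of_tendsto_of_tendsto_of_le_of_le' tendsto_const_nhds
    ((tendsto_pow_self_mul_pow_sq 4000 2000).comp hdiv)
    (Eventually.of_forall fun r => by positivity) ?_
  filter_upwards [eventually_ge_atTop 1000] with r hr
  simp only [Function.comp]
  refine mul_le_mul_of_nonneg_right ?_ (by positivity)
  have h1 : r ≤ 2000 * (r / 1000) := by omega
  rw [← mul_pow]
  have h2 : (2 * r) ^ r ≤ (4000 * (r / 1000)) ^ (2000 * (r / 1000)) :=
    (Nat.pow_le_pow_left (by omega) r).trans (Nat.pow_le_pow_right (by omega) h1)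
  exact_mod_cast h2

/-- Asymptotically almost surely, a uniformly random graph on `r` labeled vertices is
inducibility diverse. -/
theorem stmt0 :
    Tendsto (fun r : ℕ =>
      (Nat.card {G : SimpleGraph (Fin r) // InducibilityDiverse G} : ℝ) /
        2 ^ (r * (r - 1) / 2)) atTop (𝓝 1) := by
  have herr := ((tendsto_sq_mul_pow_sqrt.add tendsto_sq_mul_pow_sub_two).add
    tendsto_two_pow_mul_pow_self).add tendsto_one_add_pow_sub_one
  have hlow := herr.const_sub 1
  simp only [add_zero, sub_zero] at hlow
  have htotal : ∀ r : ℕ, Nat.card (SimpleGraph (Fin r)) = 2 ^ (r * (r - 1) / 2) := by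
    intro r
    rw [card_simpleGraph, Fintype.card_fin, Nat.choose_two_right]
  refine tendsto_of_tendsto_of_tendsto_of_le_of_le' hlow tendsto_const_nhds ?_ ?_
  · filter_upwards [eventually_sqrt_pow_le_exp (κ := 1 / 20000) (by norm_num),
      eventually_ge_atTop 2000] with r hbig hr
    have hsr : Nat.sqrt r + 3 < r := by
      have h := Nat.sqrt_le' r
      have h44 : 44 ≤ Nat.sqrt r := Nat.le_sqrt.mpr (by omega)
      nlinarith
    obtain ⟨D, -, hD⟩ := Finset.exists_subset_card_eq
      (s := (Finset.univ : Finset (Fin r))) (n := Nat.sqrt r) (by simp; omega)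
    have hbad := ncard_not_typical_le (D := D) (m := r / 1000) (by omega) (by omega)
    rw [hD] at hbad
    have hne : Nontrivial (Fin r) := Fin.nontrivial_iff_two_le.mpr (by omega)
    have hr0 : (0:ℝ) < r := by
      have : 0 < r := by omega
      exact_mod_cast this
    have hsc : Scale D (r / 1000) (1 / 20000) ((1 / (r:ℝ)) ^ r / (8 * (r:ℝ) ^ 4)) := by
      refine scale_of_le (by norm_num) (by norm_num) (by rw [hD]; exact hsr) ?_
        (by rw [hD]; exact hbig)
      have h1 : 9 * r ≤ 20000 * (r / 1000) := by omega
      have h2 : (9:ℝ) * r ≤ 20000 * ((r / 1000 : ℕ) : ℝ) := by exact_mod_cast h1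
      linarith
    have hsub : {G : SimpleGraph (Fin r) | InducibilityDiverse G}ᶜ ⊆
        {G : SimpleGraph (Fin r) | ¬ Typical G D (r / 1000)} := by
      intro G hG hT
      refine hG (inducibilityDiverse_of_typical hT hsc (le_of_eq ?_))
      rw [Fintype.card_fin]
      field_simp
    have hle := Set.ncard_le_ncard hsub (Set.toFinite _)
    have hadd := Set.ncard_add_ncard_compl {G : SimpleGraph (Fin r) | InducibilityDiverse G}
    rw [htotal] at hadd
    have hadd' : (({G : SimpleGraph (Fin r) | InducibilityDiverse G}.ncard : ℕ) : ℝ) +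
        ({G : SimpleGraph (Fin r) | InducibilityDiverse G}ᶜ.ncard : ℕ) =
          2 ^ (r * (r - 1) / 2) := by exact_mod_cast hadd
    have hle' : ({G : SimpleGraph (Fin r) | InducibilityDiverse G}ᶜ.ncard : ℝ) ≤ _ :=
      (Nat.cast_le.mpr hle).trans hbad
    rw [Nat.choose_two_right] at hle'
    have hcard : Nat.card {G : SimpleGraph (Fin r) // InducibilityDiverse G} =
        {G : SimpleGraph (Fin r) | InducibilityDiverse G}.ncard := rfl
    rw [hcard, le_div_iff₀ (by positivity)]
    linarith
  · refine Eventually.of_forall fun r => ?_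
    refine div_le_one_of_le₀ ?_ (by positivity)
    have h : Nat.card {G : SimpleGraph (Fin r) // InducibilityDiverse G} ≤
        Nat.card (SimpleGraph (Fin r)) := Nat.card_le_card_of_injective _ Subtype.val_injective
    rw [htotal] at h
    exact_mod_cast h

end Asymptotics
end

section
/- Let F = K_{a_1,…,a_r} be a complete multipartite graph with part sizes a_1 ≥ … ≥ a_r ≥ 1, r ≥ 2, and let k ≥ 3. Then i_k(F) = max_{x ∈ Δ^{k−2}} P_{F,k−1}(x); that is, the inducibility of F over K_k-free graphs equals the maximum over the simplex of the complete multipartite density polynomial in k−1 variables. -/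
open Filter Topology

/-- The density polynomial `P_{F,m}` of the complete multipartite graph with part sizes
`a_1, …, a_r`, in `m` variables:
`(s!/(a_1!⋯a_r!·π(F))) · Σ_σ ∏_i x_{σ(i)}^{a_i}`, summed over injections `σ : [r] → [m]`,
where `π(F) = ∏_n c(n)!` and `c(n)` is the number of parts of size `n`. -/
noncomputable def PF {r : ℕ} (a : Fin r → ℕ) (m : ℕ) (x : Fin m → ℝ) : ℝ :=
  (((∑ i, a i).factorial : ℝ) /
      (((∏ i, (a i).factorial) *
        ∏ n ∈ Finset.range ((∑ i, a i) + 1),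
          ((Finset.univ.filter fun i => a i = n).card.factorial) : ℕ) : ℝ)) *
    ∑ σ : Fin r ↪ Fin m, ∏ i, x (σ i) ^ a i

/-- A map preserving both adjacency and non-adjacency; it need not be injective. -/
def IsInducedHom {α β : Type*} (F : SimpleGraph α) (G : SimpleGraph β) (φ : α → β) : Prop :=
  ∀ p q, F.Adj p q ↔ G.Adj (φ p) (φ q)

open scoped Classical in
/-- The weighted number of maps `V(F) → V(G)` preserving adjacency and non-adjacency. -/
noncomputable def homSum {α β : Type*} [Fintype α] [Fintype β]
    (F : SimpleGraph α) (G : SimpleGraph β) (y : β → ℝ) : ℝ :=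
  ∑ φ : α → β, if IsInducedHom F G φ then ∏ p, y (φ p) else 0

section Counting

variable {α β : Type*} [Fintype α] [Fintype β]

theorem card_embedding_eq_inducedCount_mul (F : SimpleGraph α) (G : SimpleGraph β) :
    Nat.card (F ↪g G) = inducedCount F G * Nat.card (F ≃g F) := by
  classical
  let S := {s : Finset β | s.card = Fintype.card α ∧
    Nonempty (F ≃g SimpleGraph.induce (↑s : Set β) G)}
  let e : (F ↪g G) ≃ Σ s : S, (F ≃g SimpleGraph.induce (↑s.1 : Set β) G) := by
    refine Equiv.ofBijective (fun f => ?_) ?_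
    · have h : Set.range f = (↑(Finset.univ.image f) : Set β) := by ext; simp
      let g : F ≃g SimpleGraph.induce (↑(Finset.univ.image f) : Set β) G :=
        ⟨(Equiv.ofInjective f f.injective).trans (Equiv.setCongr h), by
          intro a b; exact f.map_adj_iff⟩
      exact ⟨⟨Finset.univ.image f,
        by rw [Finset.card_image_of_injective _ f.injective, Finset.card_univ], ⟨g⟩⟩, g⟩
    · constructor
      · intro f g hfg
        have key : ∀ x y : Σ s : S, (F ≃g SimpleGraph.induce (↑s.1 : Set β) G), x = y →
            ∀ a, ((x.2 a : _) : β) = (y.2 a : _) := by rintro x _ rfl a; rfl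
        ext a
        exact key _ _ hfg a
      · rintro ⟨⟨s, hs⟩, g⟩
        refine ⟨(SimpleGraph.Embedding.induce (↑s : Set β)).comp g.toEmbedding, ?_⟩
        have hs' : Finset.univ.image
            ((SimpleGraph.Embedding.induce (G := G) (↑s : Set β)).comp g.toEmbedding) = s := by
          ext b
          simp only [Finset.mem_image, Finset.mem_univ, true_and]
          constructor
          · rintro ⟨a, rfl⟩; exact (g a).2
          · intro hb; exact ⟨g.symm ⟨b, hb⟩, by simp⟩
        have key : ∀ x y : Σ s : S, (F ≃g SimpleGraph.induce (↑s.1 : Set β) G),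
            x.1.1 = y.1.1 → (∀ a, ((x.2 a : _) : β) = (y.2 a : _)) → x = y := by
          rintro ⟨⟨s, hs⟩, x⟩ ⟨⟨t, ht⟩, y⟩ (rfl : s = t) h
          congr 1
          ext a
          exact h a
        exact key _ _ hs' (fun a => rfl)
  have hfib : ∀ s : S, Nat.card (F ≃g SimpleGraph.induce (↑s.1 : Set β) G) =
      Nat.card (F ≃g F) := by
    rintro ⟨s, hs, ⟨g⟩⟩
    exact Nat.card_congr ⟨fun h => h.trans g.symm, fun h => h.trans g,
      fun h => by ext; simp, fun h => by ext; simp⟩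
  have : ∀ s : S, Finite (F ≃g SimpleGraph.induce (↑s.1 : Set β) G) :=
    fun s => Finite.of_injective (fun f => (f : α → _)) DFunLike.coe_injective
  rw [Nat.card_congr e, Nat.card_sigma, Finset.sum_congr rfl (fun s _ => hfib s)]
  simp only [Finset.sum_const, Finset.card_univ, smul_eq_mul]
  congr 1
  rw [inducedCount, ← Nat.card_coe_set_eq, Nat.card_eq_fintype_card]

end Counting

theorem card_aut_completeMultipartiteGraph {r : ℕ} (a : Fin r → ℕ) (ha : ∀ i, 1 ≤ a i) :
    Nat.card ((SimpleGraph.completeMultipartiteGraph fun i => Fin (a i)) ≃g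
        SimpleGraph.completeMultipartiteGraph fun i => Fin (a i)) =
      (∏ i, (a i).factorial) *
        ∏ n ∈ Finset.range ((∑ i, a i) + 1),
          (Finset.univ.filter fun i => a i = n).card.factorial := by
  let F := SimpleGraph.completeMultipartiteGraph fun i => Fin (a i)
  let T := {τ : Equiv.Perm (Fin r) // a ∘ τ = a}
  let m : (Σ τ : T, ∀ i, Fin (a i) ≃ Fin (a (τ.1 i))) → (F ≃g F) := fun x =>
    ⟨Equiv.sigmaCongr x.1.1 x.2, by
      rintro ⟨i, s⟩ ⟨j, t⟩
      simp [F, Equiv.sigmaCongr]⟩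
  have hm : ∀ x i j, m x ⟨i, j⟩ = ⟨x.1.1 i, x.2 i j⟩ := fun x i j => rfl
  have hbij : Function.Bijective m := by
    constructor
    · rintro ⟨⟨τ, hτ⟩, g⟩ ⟨⟨τ', hτ'⟩, g'⟩ h
      have h1 : ∀ i j, (⟨τ i, g i j⟩ : Σ i, Fin (a i)) = ⟨τ' i, g' i j⟩ := fun i j => by
        have := DFunLike.congr_fun h (⟨i, j⟩ : Σ i, Fin (a i))
        rwa [hm, hm] at this
      have h2 : τ = τ' := by
        ext i
        exact congrArg (fun x => (x.1 : ℕ)) (h1 i ⟨0, ha i⟩)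
      subst h2
      congr 1
      funext i
      ext j
      have := h1 i j
      simp only [Sigma.mk.injEq, heq_eq_eq, true_and] at this
      rw [this]
    · intro e
      have hadj : ∀ p q, (e p).1 = (e q).1 ↔ p.1 = q.1 := fun p q => by
        have := e.map_adj_iff (v := p) (w := q)
        simp only [F, SimpleGraph.comap_adj, SimpleGraph.top_adj] at this
        exact not_iff_not.1 this
      let t : Fin r → Fin r := fun i => (e ⟨i, ⟨0, ha i⟩⟩).1
      have ht : ∀ p, (e p).1 = t p.1 := fun p => (hadj _ _).2 rfl
      have htinj : Function.Injective t := fun i j h => by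
        simpa using (hadj _ _).1 h
      let τ : Equiv.Perm (Fin r) :=
        Equiv.ofBijective t (Finite.injective_iff_bijective.1 htinj)
      have hex : ∀ i (j : Fin (a i)), ∃ k : Fin (a (τ i)), e ⟨i, j⟩ = ⟨τ i, k⟩ := fun i j => by
        have := ht ⟨i, j⟩
        generalize e ⟨i, j⟩ = q at this
        obtain ⟨q1, q2⟩ := q
        obtain rfl : q1 = t i := this
        exact ⟨q2, rfl⟩
      choose h hh using hex
      have hb : ∀ i, Function.Bijective (h i) := fun i => by
        constructor
        · intro j j' hj
          have : e ⟨i, j⟩ = e ⟨i, j'⟩ := by rw [hh, hh, hj]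
          simpa using e.injective this
        · intro k
          obtain ⟨⟨i', j⟩, hp⟩ := e.surjective ⟨τ i, k⟩
          obtain rfl : i' = i := htinj ((ht ⟨i', j⟩).symm.trans (by rw [hp]; rfl))
          refine ⟨j, ?_⟩
          rw [hh] at hp
          simpa using hp
      have hτ : a ∘ τ = a := by
        funext i
        simpa using (Fintype.card_congr (Equiv.ofBijective _ (hb i))).symm
      refine ⟨⟨⟨τ, hτ⟩, fun i => Equiv.ofBijective _ (hb i)⟩, ?_⟩
      ext1 ⟨i, j⟩
      rw [hm, hh]
      rfl
  rw [← Nat.card_congr (Equiv.ofBijective m hbij), Nat.card_sigma]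
  have hfib : ∀ τ : T, Nat.card (∀ i, Fin (a i) ≃ Fin (a (τ.1 i))) =
      ∏ i, (a i).factorial := by
    rintro ⟨τ, hτ⟩
    have hτ' : ∀ i, a (τ i) = a i := congrFun hτ
    rw [Nat.card_pi]
    refine Finset.prod_congr rfl fun i _ => ?_
    rw [Nat.card_eq_fintype_card, Fintype.card_equiv (finCongr (hτ' i).symm), Fintype.card_fin]
  rw [Finset.sum_congr rfl (fun s _ => hfib s)]
  simp only [Finset.sum_const, Finset.card_univ, smul_eq_mul]
  rw [mul_comm]
  congr 1
  rw [DomMulAct.stabilizer_card']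
  simp only [Fintype.card_subtype]
  refine Finset.prod_subset ?_ ?_
  · intro n hn
    obtain ⟨i, -, rfl⟩ := Finset.mem_image.1 hn
    exact Finset.mem_range.2
      (Nat.lt_succ_of_le (Finset.single_le_sum (fun _ _ => Nat.zero_le _) (Finset.mem_univ i)))
  · intro n _ hn
    rw [Finset.filter_eq_empty_iff.2, Finset.card_empty, Nat.factorial_zero]
    exact fun i _ hi => hn (Finset.mem_image.2 ⟨i, Finset.mem_univ i, hi⟩)

theorem homSum_top_completeMultipartiteGraph {r : ℕ} {β : Type*} [Fintype β] [DecidableEq β]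
    (a : Fin r → ℕ) (ha : ∀ i, 1 ≤ a i) (y : β → ℝ) :
    homSum (SimpleGraph.completeMultipartiteGraph fun i => Fin (a i)) (⊤ : SimpleGraph β) y =
      ∑ σ : Fin r ↪ β, ∏ i, y (σ i) ^ a i := by
  classical
  rw [homSum, ← Finset.sum_filter]
  symm
  refine Finset.sum_bij' (fun σ _ p => σ p.1)
    (fun φ hφ => ⟨fun i => φ ⟨i, ⟨0, ha i⟩⟩, fun i j h => ?_⟩) ?_ ?_ ?_ ?_ ?_
  · have := (Finset.mem_filter.1 hφ).2 ⟨i, ⟨0, ha i⟩⟩ ⟨j, ⟨0, ha j⟩⟩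
    simp only [SimpleGraph.comap_adj, SimpleGraph.top_adj] at this
    exact (not_iff_not.1 this).2 h
  · intro σ _
    simp [IsInducedHom]
  · simp
  · intro σ _
    rfl
  · intro φ hφ
    funext p
    have := (Finset.mem_filter.1 hφ).2 ⟨p.1, ⟨0, ha _⟩⟩ p
    simp only [SimpleGraph.comap_adj, SimpleGraph.top_adj] at this
    exact (not_iff_not.1 this).1 rfl
  · intro σ _
    rw [Fintype.prod_sigma]
    simp

section Averaging

variable {α β κ : Type*} [Fintype α] [Fintype β] [Fintype κ] [DecidableEq α] [DecidableEq β]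

/-- Under independent `κ`-valued labels on `β` with law `x`, an injective sample of labels
again consists of independent labels with law `x`. -/
theorem sum_prod_mul_comp_of_injective {x : κ → ℝ} (hx : ∑ j, x j = 1) {φ : α → β}
    (hφ : Function.Injective φ) (g : (α → κ) → ℝ) :
    ∑ c : β → κ, (∏ v, x (c v)) * g (c ∘ φ) = ∑ ψ : α → κ, g ψ * ∏ p, x (ψ p) := by
  classical
  rw [← Finset.sum_fiberwise Finset.univ (fun c : β → κ => c ∘ φ)]
  refine Finset.sum_congr rfl fun ψ _ => ?_
  rw [Finset.sum_congr rfl (g := fun c : β → κ => g ψ * ∏ v, x (c v)), ← Finset.mul_sum]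
  · congr 1
    have hset : (Finset.univ.filter fun c : β → κ => c ∘ φ = ψ) =
        Fintype.piFinset fun v => Finset.univ.filter fun j => ∀ p, φ p = v → j = ψ p := by
      ext c
      simp only [Finset.mem_filter, Finset.mem_univ, true_and, Fintype.mem_piFinset,
        funext_iff, Function.comp_apply]
      exact ⟨fun h v p hp => hp ▸ h p, fun h p => h _ p rfl⟩
    rw [hset, ← Finset.prod_univ_sum]
    symm
    refine Fintype.prod_of_injective φ hφ _ _ (fun v hv => ?_) (fun p => ?_)
    · rw [Finset.filter_true_of_mem, hx]
      exact fun j _ p hp => absurd ⟨p, hp⟩ hv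
    · have : (Finset.univ.filter fun j => ∀ q, φ q = φ p → j = ψ q) = {ψ p} := by
        ext j
        simp only [Finset.mem_filter, Finset.mem_univ, true_and, Finset.mem_singleton]
        exact ⟨fun h => h p rfl, fun h q hq => by rw [h, hφ hq]⟩
      rw [this, Finset.sum_singleton]
  · intro c hc
    rw [(Finset.mem_filter.1 hc).2, mul_comm]

end Averaging

theorem natCard_embedding_eq_sum {α β : Type*} [Fintype α] [Fintype β] [DecidableEq α]
    [DecidableEq β] (F : SimpleGraph α) (G : SimpleGraph β) [DecidablePred (IsInducedHom F G)] :
    Nat.card (F ↪g G) = ∑ φ : α ↪ β, if IsInducedHom F G φ then 1 else 0 := by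
  rw [← Finset.card_filter, ← Fintype.card_subtype, ← Nat.card_eq_fintype_card]
  refine Nat.card_congr ⟨fun f => ⟨f.toEmbedding, fun p q => f.map_adj_iff.symm⟩,
    fun f => ⟨f.1, (f.2 _ _).symm⟩, fun f => rfl, fun f => rfl⟩

theorem sum_prod_mul_card_embedding_comap_top {α κ : Type*} [Fintype α] [Fintype κ]
    (F : SimpleGraph α) {x : κ → ℝ} (hx : ∑ j, x j = 1) (n : ℕ) :
    ∑ c : Fin n → κ, (∏ v, x (c v)) * (Nat.card (F ↪g (⊤ : SimpleGraph κ).comap c) : ℝ) =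
      n.descFactorial (Fintype.card α) * homSum F ⊤ x := by
  classical
  have h : ∀ (c : Fin n → κ) (φ : α ↪ Fin n),
      IsInducedHom F ((⊤ : SimpleGraph κ).comap c) φ ↔ IsInducedHom F ⊤ (c ∘ φ) :=
    fun c φ => Iff.rfl
  simp_rw [natCard_embedding_eq_sum, h]
  push_cast
  simp_rw [Finset.mul_sum]
  rw [Finset.sum_comm]
  have h2 : ∀ φ : α ↪ Fin n, ∑ c : Fin n → κ, (∏ v, x (c v)) *
      (if IsInducedHom F ⊤ (c ∘ φ) then (1 : ℝ) else 0) = homSum F ⊤ x := fun φ => by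
    rw [sum_prod_mul_comp_of_injective hx φ.injective
      (fun ψ => if IsInducedHom F ⊤ ψ then (1 : ℝ) else 0), homSum]
    simp
  rw [Finset.sum_congr rfl fun φ _ => h2 φ, Finset.sum_const, Finset.card_univ,
    Fintype.card_embedding_eq, Fintype.card_fin, nsmul_eq_mul]

theorem natCard_embedding_le_homSum {α β : Type*} [Fintype α] [Fintype β]
    (F : SimpleGraph α) (G : SimpleGraph β) :
    (Nat.card (F ↪g G) : ℝ) ≤
      Fintype.card β ^ Fintype.card α * homSum F G fun _ => (Fintype.card β : ℝ)⁻¹ := by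
  classical
  rcases isEmpty_or_nonempty β with hβ | hβ
  · rcases isEmpty_or_nonempty α with hα | hα
    · have : Subsingleton (F ↪g G) := ⟨fun f g => by ext a; exact isEmptyElim a⟩
      have h : Nat.card (F ↪g G) ≤ 1 := Finite.card_le_one_iff_subsingleton.2 this
      have h' : IsInducedHom F G (isEmptyElim : α → β) := fun p => isEmptyElim p
      have : (Nat.card (F ↪g G) : ℝ) ≤ 1 := by exact_mod_cast h
      simpa [homSum, IsInducedHom] using this
    · have : IsEmpty (F ↪g G) := ⟨fun f => isEmptyElim (f hα.some)⟩
      simp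
  have hn : (Fintype.card β : ℝ) ≠ 0 := by exact_mod_cast Fintype.card_ne_zero
  rw [homSum, natCard_embedding_eq_sum, Finset.mul_sum]
  push_cast
  have : ∀ φ : α → β, (Fintype.card β : ℝ) ^ Fintype.card α *
      (if IsInducedHom F G φ then ∏ _p : α, (Fintype.card β : ℝ)⁻¹ else 0) =
      if IsInducedHom F G φ then 1 else 0 := fun φ => by
    split_ifs
    · rw [Finset.prod_const, Finset.card_univ, ← mul_pow, mul_inv_cancel₀ hn, one_pow]
    · simp
  simp_rw [this]
  rw [← Finset.sum_image (s := Finset.univ) (g := fun φ : α ↪ β => (φ : α → β))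
    (f := fun φ => if IsInducedHom F G φ then (1 : ℝ) else 0) DFunLike.coe_injective.injOn]
  refine Finset.sum_le_sum_of_subset_of_nonneg (Finset.subset_univ _) fun φ _ _ => ?_
  split_ifs <;> simp

theorem homSum_nonneg {α β : Type*} [Fintype α] [Fintype β] (F : SimpleGraph α)
    (G : SimpleGraph β) {y : β → ℝ} (hy : ∀ b, 0 ≤ y b) : 0 ≤ homSum F G y := by
  refine Finset.sum_nonneg fun φ _ => ?_
  split_ifs
  · exact Finset.prod_nonneg fun p _ => hy _
  · exact le_rfl

section Symmetrization

variable {β : Type*} [DecidableEq β]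

/-- Move the weight of `v` to `u`. -/
def mergeWeight (u v : β) (y : β → ℝ) : β → ℝ :=
  fun b => if b = v then 0 else if b = u then y u + y v else y b

theorem mergeWeight_nonneg {u v : β} {y : β → ℝ} (hy : ∀ b, 0 ≤ y b) (b : β) :
    0 ≤ mergeWeight u v y b := by
  unfold mergeWeight
  split_ifs
  exacts [le_rfl, add_nonneg (hy _) (hy _), hy _]

theorem mergeWeight_swap {u v : β} (huv : u ≠ v) (y : β → ℝ) (b : β) :
    mergeWeight v u y (Equiv.swap u v b) = mergeWeight u v y b := by
  unfold mergeWeight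
  rcases eq_or_ne b u with rfl | hu
  · simp [huv, huv.symm, add_comm]
  rcases eq_or_ne b v with rfl | hv
  · simp
  · simp [Equiv.swap_apply_of_ne_of_ne hu hv, hu, hv]

theorem sum_mergeWeight [Fintype β] {u v : β} (huv : u ≠ v) (y : β → ℝ) :
    ∑ b, mergeWeight u v y b = ∑ b, y b := by
  have h : ∀ b, mergeWeight u v y b =
      y b + ((if b = u then y v else 0) - if b = v then y v else 0) := fun b => by
    unfold mergeWeight
    split_ifs with h1 h2 h2
    · exact absurd (h2.symm.trans h1) huv
    · rw [h1]; ring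
    · rw [h2]; ring
    · ring
  simp [h, Finset.sum_add_distrib]

/-- The map collapsing `v` onto `u`. -/
def collapse (u v : β) : β → β := fun b => if b = v then u else b

theorem sum_filter_collapse [Fintype β] {u v : β} (huv : u ≠ v) (y : β → ℝ) (c : β) :
    ∑ b with collapse u v b = c, y b = mergeWeight u v y c := by
  rcases eq_or_ne c v with rfl | hv
  · rw [Finset.filter_eq_empty_iff.2]
    · simp [mergeWeight]
    · intro b _
      unfold collapse
      split_ifs with h
      exacts [huv, h]
  rcases eq_or_ne c u with rfl | hu
  · have : (Finset.univ.filter fun b => collapse c v b = c) = {c, v} := by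
      ext b
      rw [Finset.mem_filter, Finset.mem_insert, Finset.mem_singleton]
      unfold collapse
      split_ifs with h <;> simp [h]
    rw [this, Finset.sum_pair huv]
    simp [mergeWeight, huv]
  · have : (Finset.univ.filter fun b => collapse u v b = c) = {c} := by
      ext b
      rw [Finset.mem_filter, Finset.mem_singleton]
      unfold collapse
      split_ifs with h <;> simp [h, hu.symm, hv.symm]
    rw [this, Finset.sum_singleton]
    simp [mergeWeight, hu, hv]

variable {α : Type*}

theorem isInducedHom_of_collapse_eq {F : SimpleGraph α} (hF : F.IsCompleteMultipartite)
    {G : SimpleGraph β} {u v : β} (hadj : ¬ G.Adj u v) {φ φ' : α → β} (hφ : IsInducedHom F G φ)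
    {p₀ q₀ : α} (hp : φ p₀ = u) (hq : φ q₀ = v)
    (h : ∀ p, collapse u v (φ' p) = collapse u v (φ p)) : IsInducedHom F G φ' := by
  have hpq : ¬ F.Adj p₀ q₀ := by rw [hφ, hp, hq]; exact hadj
  have htwin : ∀ w, G.Adj u (φ w) ↔ G.Adj v (φ w) := fun w => by
    rw [← hp, ← hq, ← hφ, ← hφ]
    refine ⟨fun h1 => ?_, fun h1 => ?_⟩ <;> by_contra h2
    · exact hF.trans p₀ q₀ w hpq h2 h1
    · exact hF.trans q₀ p₀ w (fun h => hpq h.symm) h2 h1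
  have hcases : ∀ p, φ' p = φ p ∨ (φ' p = u ∧ φ p = v) ∨ (φ' p = v ∧ φ p = u) := fun p => by
    have := h p
    unfold collapse at this
    split_ifs at this <;> grind
  have h1 : ∀ p w, G.Adj (φ' p) (φ w) ↔ G.Adj (φ p) (φ w) := fun p w => by
    rcases hcases p with h | ⟨h, h'⟩ | ⟨h, h'⟩ <;> rw [h]
    · rw [h', htwin]
    · rw [h', htwin]
  intro p q
  rw [hφ, ← h1]
  rcases hcases q with h | ⟨h, h'⟩ | ⟨h, h'⟩
  · rw [h]
  · rw [h, h', ← hp, ← hq, h1, h1, G.adj_comm, G.adj_comm _ (φ p₀), hp, hq, htwin]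
  · rw [h, h', ← hp, ← hq, h1, h1, G.adj_comm, G.adj_comm _ (φ q₀), hp, hq, htwin]

variable [Fintype α] [Fintype β]

open scoped Classical in
theorem sum_fiber_collapse_le {F : SimpleGraph α} (hF : F.IsCompleteMultipartite)
    {G : SimpleGraph β} {u v : β} (huv : u ≠ v) (hadj : ¬ G.Adj u v) {y : β → ℝ}
    (hy : ∀ b, 0 ≤ y b) {s t : ℝ} (hs : 0 ≤ s) (ht : 0 ≤ t) (hst : s + t = 1)
    (hsu : y u = s * (y u + y v)) (htv : y v = t * (y u + y v)) (χ : α → β) :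
    ∑ φ : α → β with collapse u v ∘ φ = χ, (if IsInducedHom F G φ then ∏ p, y (φ p) else 0) ≤
      s * (if IsInducedHom F G χ then ∏ p, mergeWeight u v y (χ p) else 0) +
      t * (if IsInducedHom F G (Equiv.swap u v ∘ χ) then
        ∏ p, mergeWeight u v y (χ p) else 0) := by
  have hQ : 0 ≤ ∏ p, mergeWeight u v y (χ p) :=
    Finset.prod_nonneg fun p _ => mergeWeight_nonneg hy _
  have hyφ : ∀ φ : α → β, 0 ≤ ∏ p, y (φ p) := fun φ => Finset.prod_nonneg fun p _ => hy _
  by_cases hχ : ∃ p, χ p = v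
  · obtain ⟨p, hp⟩ := hχ
    rw [Finset.filter_eq_empty_iff.2, Finset.sum_empty]
    · split_ifs <;> positivity
    · rintro φ - rfl
      simp only [Function.comp_apply, collapse] at hp
      split_ifs at hp with h
      exacts [huv hp, h hp]
  push Not at hχ
  have hcol : ∀ p, collapse u v (χ p) = χ p := fun p => by simp [collapse, hχ p]
  have hcol' : ∀ p, collapse u v (Equiv.swap u v (χ p)) = χ p := fun p => by
    rcases eq_or_ne (χ p) u with h | h
    · simp [h, collapse]
    · rw [Equiv.swap_apply_of_ne_of_ne h (hχ p), hcol]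
  have htri : ∀ φ : α → β, collapse u v ∘ φ = χ → IsInducedHom F G φ →
      φ = χ ∨ φ = Equiv.swap u v ∘ χ ∨
        (IsInducedHom F G χ ∧ IsInducedHom F G (Equiv.swap u v ∘ χ)) := by
    intro φ hφ hind
    have hφ' : ∀ p, collapse u v (φ p) = χ p := congrFun hφ
    by_cases h1 : ∃ p, φ p = u
    · by_cases h2 : ∃ p, φ p = v
      · obtain ⟨p, hp⟩ := h1
        obtain ⟨q, hq⟩ := h2
        exact Or.inr (Or.inr ⟨isInducedHom_of_collapse_eq hF hadj hind hp hq fun p => by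
            rw [hcol, hφ'], isInducedHom_of_collapse_eq hF hadj hind hp hq fun p => by
            rw [Function.comp_apply, hcol', hφ']⟩)
      · push Not at h2
        refine Or.inl (funext fun p => ?_)
        rw [← hφ' p]
        simp [collapse, h2 p]
    · push Not at h1
      refine Or.inr (Or.inl (funext fun p => ?_))
      rw [Function.comp_apply, ← hφ' p]
      by_cases h : φ p = v
      · simp [collapse, h]
      · simp [collapse, h, Equiv.swap_apply_of_ne_of_ne (h1 p) h]
  by_cases hboth : IsInducedHom F G χ ∧ IsInducedHom F G (Equiv.swap u v ∘ χ)
  · rw [if_pos hboth.1, if_pos hboth.2, ← add_mul, hst, one_mul]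
    calc _ ≤ ∑ φ : α → β with collapse u v ∘ φ = χ, ∏ p, y (φ p) :=
          Finset.sum_le_sum fun φ _ => by split_ifs; exacts [le_rfl, hyφ φ]
      _ = ∏ p, ∑ b with collapse u v b = χ p, y b := by
          rw [Finset.prod_univ_sum]
          refine Finset.sum_congr ?_ fun _ _ => rfl
          ext φ
          simp [funext_iff]
      _ ≤ _ := by simp_rw [sum_filter_collapse huv]; exact le_rfl
  set A : ℝ := if IsInducedHom F G χ then ∏ p, y (χ p) else 0 with hA
  set B : ℝ := if IsInducedHom F G (Equiv.swap u v ∘ χ) then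
    ∏ p, y (Equiv.swap u v (χ p)) else 0 with hB
  have hA0 : 0 ≤ A := by rw [hA]; split_ifs; exacts [hyφ _, le_rfl]
  have hB0 : 0 ≤ B := by rw [hB]; split_ifs; exacts [hyφ (Equiv.swap u v ∘ χ), le_rfl]
  have hAB : ∑ φ : α → β with collapse u v ∘ φ = χ,
      (if IsInducedHom F G φ then ∏ p, y (φ p) else 0) ≤ A + B := by
    calc _ ≤ ∑ φ : α → β with collapse u v ∘ φ = χ,
          ((if φ = χ then A else 0) + if φ = Equiv.swap u v ∘ χ then B else 0) := by
          refine Finset.sum_le_sum fun φ hφ => ?_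
          have h0 : 0 ≤ (if φ = χ then A else 0) := by split_ifs; exacts [hA0, le_rfl]
          have h0' : 0 ≤ (if φ = Equiv.swap u v ∘ χ then B else 0) := by
            split_ifs; exacts [hB0, le_rfl]
          by_cases hind : IsInducedHom F G φ
          · rcases htri φ (Finset.mem_filter.1 hφ).2 hind with h | h | h
            · have hind' := hind
              rw [h] at hind'
              have hAv : A = ∏ p, y (φ p) := by rw [hA, if_pos hind', h]
              rw [if_pos hind, if_pos h, hAv]
              exact le_add_of_nonneg_right h0'
            · have hind' := hind
              rw [h] at hind'
              have hBv : B = ∏ p, y (φ p) := by rw [hB, if_pos hind', h]; rfl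
              rw [if_pos hind, if_pos h, hBv]
              exact le_add_of_nonneg_left h0
            · exact absurd h hboth
          · rw [if_neg hind]
            exact add_nonneg h0 h0'
      _ ≤ A + B := by
          rw [Finset.sum_add_distrib, Finset.sum_ite_eq', Finset.sum_ite_eq']
          refine add_le_add ?_ ?_ <;> split_ifs <;> first | exact le_rfl | assumption
  refine hAB.trans ?_
  by_cases hT : ∃ p, χ p = u
  · obtain ⟨p₀, hp₀⟩ := hT
    have hw : mergeWeight u v y u = y u + y v := by simp [mergeWeight, huv]
    have key : ∀ (z : α → ℝ) (c : ℝ), (∀ p, 0 ≤ z p) →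
        (∀ p, z p ≤ mergeWeight u v y (χ p)) → 0 ≤ c → z p₀ = c * (y u + y v) →
        ∏ p, z p ≤ c * ∏ p, mergeWeight u v y (χ p) := fun z c hz hzm hc h => by
      rw [← Finset.mul_prod_erase _ _ (Finset.mem_univ p₀),
        ← Finset.mul_prod_erase _ (fun p => mergeWeight u v y (χ p)) (Finset.mem_univ p₀),
        h, hp₀, hw, ← mul_assoc]
      exact mul_le_mul_of_nonneg_left (Finset.prod_le_prod (fun p _ => hz p) fun p _ => hzm p)
        (mul_nonneg hc (add_nonneg (hy _) (hy _)))
    refine add_le_add ?_ ?_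
    · rw [hA]
      split_ifs
      · refine key (fun p => y (χ p)) s (fun p => hy _) (fun p => ?_) hs (by rw [hp₀, ← hsu])
        simp only [mergeWeight, hχ p, if_false]
        split_ifs with h
        · rw [h]; exact le_add_of_nonneg_right (hy _)
        · exact le_rfl
      · simp
    · rw [hB]
      split_ifs
      · refine key (fun p => y (Equiv.swap u v (χ p))) t (fun p => hy _) (fun p => ?_) ht
          (by rw [hp₀, Equiv.swap_apply_left, ← htv])
        simp only [mergeWeight, hχ p, if_false]
        split_ifs with h
        · rw [h, Equiv.swap_apply_left]; exact le_add_of_nonneg_left (hy _)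
        · rw [Equiv.swap_apply_of_ne_of_ne h (hχ p)]
      · simp
  · push Not at hT
    have hsw : Equiv.swap u v ∘ χ = χ :=
      funext fun p => Equiv.swap_apply_of_ne_of_ne (hT p) (hχ p)
    rw [hsw, and_self] at hboth
    rw [hA, hB, hsw]
    simp [hboth]

theorem homSum_le_max_mergeWeight {F : SimpleGraph α} (hF : F.IsCompleteMultipartite)
    {G : SimpleGraph β} {u v : β} (huv : u ≠ v) (hadj : ¬ G.Adj u v) {y : β → ℝ}
    (hy : ∀ b, 0 ≤ y b) (hw : 0 < y u + y v) :
    homSum F G y ≤ max (homSum F G (mergeWeight u v y)) (homSum F G (mergeWeight v u y)) := by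
  classical
  set s := y u / (y u + y v) with hs
  set t := y v / (y u + y v) with ht
  have hs0 : 0 ≤ s := div_nonneg (hy _) hw.le
  have ht0 : 0 ≤ t := div_nonneg (hy _) hw.le
  have hst : s + t = 1 := by rw [hs, ht, ← add_div, div_self hw.ne']
  have hsu : y u = s * (y u + y v) := by rw [hs, div_mul_cancel₀ _ hw.ne']
  have htv : y v = t * (y u + y v) := by rw [ht, div_mul_cancel₀ _ hw.ne']
  have hswap : homSum F G (mergeWeight v u y) = ∑ χ : α → β,
      if IsInducedHom F G (Equiv.swap u v ∘ χ) then
        ∏ p, mergeWeight u v y (χ p) else 0 := by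
    rw [homSum, ← Equiv.sum_comp (Equiv.arrowCongr (Equiv.refl α) (Equiv.swap u v))]
    refine Finset.sum_congr rfl fun χ _ => ?_
    have h : Equiv.arrowCongr (Equiv.refl α) (Equiv.swap u v) χ = Equiv.swap u v ∘ χ := rfl
    simp_rw [h, Function.comp_apply, mergeWeight_swap huv]
  have h : homSum F G y ≤
      s * homSum F G (mergeWeight u v y) + t * homSum F G (mergeWeight v u y) := by
    rw [hswap, homSum, ← Finset.sum_fiberwise Finset.univ (fun φ : α → β => collapse u v ∘ φ),
      homSum, Finset.mul_sum, Finset.mul_sum, ← Finset.sum_add_distrib]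
    exact Finset.sum_le_sum fun χ _ =>
      sum_fiber_collapse_le hF huv hadj hy hs0 ht0 hst hsu htv χ
  refine h.trans ?_
  calc _ ≤ s * max (homSum F G (mergeWeight u v y)) (homSum F G (mergeWeight v u y)) +
        t * max (homSum F G (mergeWeight u v y)) (homSum F G (mergeWeight v u y)) :=
        add_le_add (mul_le_mul_of_nonneg_left (le_max_left _ _) hs0)
          (mul_le_mul_of_nonneg_left (le_max_right _ _) ht0)
    _ = _ := by rw [← add_mul, hst, one_mul]

/-- Among weightings of total weight one, `homSum` is bounded by its value at a weighting
supported on a clique. -/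
theorem exists_isClique_homSum_le {F : SimpleGraph α} (hF : F.IsCompleteMultipartite)
    (G : SimpleGraph β) (y : β → ℝ) (hy : y ∈ stdSimplex ℝ β) :
    ∃ z ∈ stdSimplex ℝ β, G.IsClique {b | z b ≠ 0} ∧ homSum F G y ≤ homSum F G z := by
  induction hn : (Finset.univ.filter fun b => y b ≠ 0).card using Nat.strong_induction_on
    generalizing y with
  | _ n ih =>
    by_cases hcl : G.IsClique {b | y b ≠ 0}
    · exact ⟨y, hy, hcl, le_rfl⟩
    obtain ⟨u, hu, v, hv, huv, hadj⟩ : ∃ u, y u ≠ 0 ∧ ∃ v, y v ≠ 0 ∧ u ≠ v ∧ ¬ G.Adj u v := by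
      simpa [SimpleGraph.IsClique, Set.Pairwise] using hcl
    have step : ∀ u v : β, y u ≠ 0 → y v ≠ 0 → u ≠ v →
        homSum F G y ≤ homSum F G (mergeWeight u v y) →
        ∃ z ∈ stdSimplex ℝ β, G.IsClique {b | z b ≠ 0} ∧ homSum F G y ≤ homSum F G z := by
      intro u v hu hv huv hle
      suffices hlt : (Finset.univ.filter fun b => mergeWeight u v y b ≠ 0).card < n by
        obtain ⟨z, hz, hzc, hzle⟩ := ih _ hlt (mergeWeight u v y)
          ⟨mergeWeight_nonneg hy.1, (sum_mergeWeight huv y).trans hy.2⟩ rfl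
        exact ⟨z, hz, hzc, hle.trans hzle⟩
      rw [← hn]
      refine Finset.card_lt_card (Finset.ssubset_iff_of_subset ?_ |>.2 ⟨v, ?_, ?_⟩)
      · intro b hb
        rw [Finset.mem_filter] at hb ⊢
        refine ⟨hb.1, fun h => hb.2 ?_⟩
        have : b ≠ u := fun h' => hu (h' ▸ h)
        simp [mergeWeight, this, h]
      · exact Finset.mem_filter.2 ⟨Finset.mem_univ v, hv⟩
      · simp [mergeWeight]
    rcases le_max_iff.1 (homSum_le_max_mergeWeight hF huv hadj hy.1
      (add_pos_of_pos_of_nonneg (lt_of_le_of_ne (hy.1 u) hu.symm) (hy.1 v))) with h | h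
    · exact step u v hu hv huv h
    · exact step v u hv hu huv.symm h

end Symmetrization

theorem homSum_le_of_cliqueFree {r k : ℕ} (hk : 1 ≤ k) (a : Fin r → ℕ) (ha : ∀ i, 1 ≤ a i)
    {M : ℝ} (hM : ∀ x ∈ stdSimplex ℝ (Fin (k - 1)),
      ∑ σ : Fin r ↪ Fin (k - 1), ∏ i, x (σ i) ^ a i ≤ M)
    {β : Type*} [Fintype β] {G : SimpleGraph β} (hG : G.CliqueFree k) {y : β → ℝ}
    (hy : y ∈ stdSimplex ℝ β) :
    homSum (SimpleGraph.completeMultipartiteGraph fun i => Fin (a i)) G y ≤ M := by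
  classical
  set F := SimpleGraph.completeMultipartiteGraph fun i => Fin (a i) with hF
  obtain ⟨z, hz, hcl, hle⟩ := exists_isClique_homSum_le
    (SimpleGraph.completeMultipartiteGraph.isCompleteMultipartite fun i => Fin (a i)) G y hy
  refine hle.trans ?_
  have htop : homSum F G z ≤ homSum F ⊤ z := by
    refine Finset.sum_le_sum fun φ _ => ?_
    have h0 : 0 ≤ ∏ p, z (φ p) := Finset.prod_nonneg fun p _ => hz.1 _
    by_cases hsupp : ∀ p, z (φ p) ≠ 0
    · have : IsInducedHom F G φ → IsInducedHom F ⊤ φ := fun h p q => by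
        rw [h, SimpleGraph.top_adj]
        exact ⟨fun h => h.ne, fun h => hcl (hsupp p) (hsupp q) h⟩
      split_ifs with h1 h2 h2
      · exact le_rfl
      · exact absurd (this h1) h2
      · exact h0
      · exact le_rfl
    · push Not at hsupp
      obtain ⟨p, hp⟩ := hsupp
      rw [Finset.prod_eq_zero (Finset.mem_univ p) hp, ite_self, ite_self]
  refine htop.trans ?_
  rw [hF, homSum_top_completeMultipartiteGraph a ha]
  set S : Finset β := Finset.univ.filter fun b => z b ≠ 0 with hS
  have hcard : S.card < k := by
    by_contra! h
    obtain ⟨t, ht, htk⟩ := Finset.exists_subset_card_eq h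
    refine hG t ⟨hcl.subset fun b hb => ?_, htk⟩
    exact (Finset.mem_filter.1 (ht hb)).2
  obtain ⟨e⟩ : Nonempty (S ↪ Fin (k - 1)) := by
    refine Function.Embedding.nonempty_of_card_le ?_
    rw [Fintype.card_coe, Fintype.card_fin]
    omega
  set x : Fin (k - 1) → ℝ := fun j => ∑ b : S, if e b = j then z b else 0 with hx
  have hxe : ∀ b : S, x (e b) = z b := fun b => by
    simp [hx, e.injective.eq_iff]
  have hx0 : ∀ j, 0 ≤ x j := fun j =>
    Finset.sum_nonneg fun b _ => by split_ifs; exacts [hz.1 _, le_rfl]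
  have hxs : x ∈ stdSimplex ℝ (Fin (k - 1)) := by
    refine ⟨hx0, ?_⟩
    rw [Finset.sum_comm]
    simp only [Finset.sum_ite_eq, Finset.mem_univ, if_true]
    rw [Finset.sum_coe_sort S z, hS, Finset.sum_filter_ne_zero, hz.2]
  refine le_trans ?_ (hM x hxs)
  let T : Finset (Fin r ↪ β) := Finset.univ.filter fun σ => ∀ i, σ i ∈ S
  rw [← Finset.sum_subset (Finset.subset_univ T)]
  · rw [← Finset.sum_coe_sort T]
    let g : T → (Fin r ↪ Fin (k - 1)) := fun σ =>
      ⟨fun i => e ⟨σ.1 i, (Finset.mem_filter.1 σ.2).2 i⟩, fun i j h => by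
        simpa using e.injective h⟩
    have hg : Function.Injective g := fun σ τ h => by
      ext i
      have := e.injective (DFunLike.congr_fun h i)
      simpa using this
    have hgx : ∀ σ : T, ∏ i, z (σ.1 i) ^ a i = ∏ i, x (g σ i) ^ a i := fun σ =>
      Finset.prod_congr rfl fun i _ => by
        change _ = x (e ⟨σ.1 i, _⟩) ^ a i
        rw [hxe]
    rw [Finset.sum_congr rfl fun σ _ => hgx σ,
      ← Finset.sum_image (s := Finset.univ) (g := g)
        (f := fun τ => ∏ i, x (τ i) ^ a i) hg.injOn]
    exact Finset.sum_le_sum_of_subset_of_nonneg (Finset.subset_univ _) fun τ _ _ =>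
      Finset.prod_nonneg fun i _ => pow_nonneg (hx0 _) _
  · intro σ _ hσ
    obtain ⟨i, hi⟩ : ∃ i, z (σ i) = 0 := by simpa [T, hS] using hσ
    exact Finset.prod_eq_zero (Finset.mem_univ i) (by
      rw [hi, zero_pow (Nat.one_le_iff_ne_zero.1 (ha i))])

section Density

variable {r : ℕ} (a : Fin r → ℕ)

theorem PF_eq_div_card_aut (ha : ∀ i, 1 ≤ a i) (m : ℕ) (x : Fin m → ℝ) :
    PF a m x = (∑ i, a i).factorial /
      (Nat.card ((SimpleGraph.completeMultipartiteGraph fun i => Fin (a i)) ≃g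
        SimpleGraph.completeMultipartiteGraph fun i => Fin (a i)) : ℝ) *
      ∑ σ : Fin r ↪ Fin m, ∏ i, x (σ i) ^ a i := by
  rw [card_aut_completeMultipartiteGraph a ha, PF]

theorem continuous_PF (m : ℕ) : Continuous (PF a m) := by
  unfold PF
  fun_prop

theorem natCard_aut_pos {α : Type*} [Finite α] (F : SimpleGraph α) : 0 < Nat.card (F ≃g F) := by
  have : Finite (F ≃g F) := Finite.of_injective (fun f => (f : α → α)) DFunLike.coe_injective
  have : Nonempty (F ≃g F) := ⟨SimpleGraph.Iso.refl⟩
  exact Nat.card_pos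

theorem inducedDensity_eq {α β : Type*} [Fintype α] [Fintype β] (F : SimpleGraph α)
    (G : SimpleGraph β) :
    inducedDensity F G = (Fintype.card α).factorial / (Nat.card (F ≃g F) : ℝ) *
      (Nat.card (F ↪g G) / ((Fintype.card β).descFactorial (Fintype.card α) : ℝ)) := by
  have h1 : (Nat.card (F ≃g F) : ℝ) ≠ 0 := by exact_mod_cast (natCard_aut_pos F).ne'
  have h2 : ((Fintype.card α).factorial : ℝ) ≠ 0 := by
    exact_mod_cast Nat.factorial_ne_zero _
  rw [inducedDensity, card_embedding_eq_inducedCount_mul,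
    Nat.descFactorial_eq_factorial_mul_choose]
  push_cast
  by_cases h3 : ((Fintype.card β).choose (Fintype.card α) : ℝ) = 0
  · simp [h3]
  · field_simp

theorem inducedDensity_le_of_cliqueFree (ha : ∀ i, 1 ≤ a i) {k : ℕ} (hk : 1 ≤ k) {M : ℝ}
    (hM : ∀ x ∈ stdSimplex ℝ (Fin (k - 1)), PF a (k - 1) x ≤ M) {n : ℕ} (hn : n ≠ 0)
    {G : SimpleGraph (Fin n)} (hG : G.CliqueFree k) :
    inducedDensity (SimpleGraph.completeMultipartiteGraph fun i => Fin (a i)) G ≤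
      M * (n ^ (∑ i, a i) / n.descFactorial (∑ i, a i)) := by
  set F := SimpleGraph.completeMultipartiteGraph fun i => Fin (a i) with hF
  set C : ℝ := (∑ i, a i).factorial / (Nat.card (F ≃g F) : ℝ) with hC
  have hCpos : 0 < C := div_pos (by exact_mod_cast Nat.factorial_pos _)
    (by exact_mod_cast natCard_aut_pos F)
  have hcard : Fintype.card (Σ i, Fin (a i)) = ∑ i, a i := by simp
  have hsum : ∀ x ∈ stdSimplex ℝ (Fin (k - 1)),
      ∑ σ : Fin r ↪ Fin (k - 1), ∏ i, x (σ i) ^ a i ≤ M / C := fun x hx => by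
    rw [le_div_iff₀' hCpos]
    have := hM x hx
    rwa [PF_eq_div_card_aut a ha] at this
  have hn' : (n : ℝ) ≠ 0 := by exact_mod_cast hn
  have hunif : (fun _ => ((n : ℝ))⁻¹) ∈ stdSimplex ℝ (Fin n) :=
    ⟨fun _ => by positivity, by simp [hn']⟩
  have h1 := homSum_le_of_cliqueFree hk a ha hsum hG hunif
  have h2 := natCard_embedding_le_homSum F G
  rw [hcard, Fintype.card_fin] at h2
  rw [inducedDensity_eq, hcard, Fintype.card_fin]
  calc C * (Nat.card (F ↪g G) / (n.descFactorial (∑ i, a i) : ℝ))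
      ≤ C * ((n ^ (∑ i, a i) * (M / C)) / (n.descFactorial (∑ i, a i) : ℝ)) := by
        gcongr
        exact h2.trans (mul_le_mul_of_nonneg_left h1 (by positivity))
    _ = _ := by field_simp

theorem exists_cliqueFree_PF_le_inducedDensity (ha : ∀ i, 1 ≤ a i) {k : ℕ} (hk : 1 ≤ k) {x : Fin (k - 1) → ℝ}
    (hx : x ∈ stdSimplex ℝ (Fin (k - 1))) {n : ℕ} (hn : ∑ i, a i ≤ n) :
    ∃ G : SimpleGraph (Fin n), G.CliqueFree k ∧ PF a (k - 1) x ≤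
      inducedDensity (SimpleGraph.completeMultipartiteGraph fun i => Fin (a i)) G := by
  set F := SimpleGraph.completeMultipartiteGraph fun i => Fin (a i) with hF
  by_contra! hcon
  have hcard : Fintype.card (Σ i, Fin (a i)) = ∑ i, a i := by simp
  have hfree : ∀ c : Fin n → Fin (k - 1),
      ((⊤ : SimpleGraph (Fin (k - 1))).comap c).CliqueFree k := fun c =>
    SimpleGraph.Colorable.cliqueFree (n := k - 1) ⟨⟨c, fun h => h⟩⟩ (by omega)
  set C : ℝ := (∑ i, a i).factorial / (Nat.card (F ≃g F) : ℝ) with hC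
  have hd : (n.descFactorial (∑ i, a i) : ℝ) ≠ 0 := by
    exact_mod_cast (Nat.descFactorial_pos.2 hn).ne'
  have hw : ∑ c : Fin n → Fin (k - 1), ∏ v, x (c v) = 1 := by
    rw [← Fintype.prod_sum fun (_ : Fin n) j => x j]
    simp [hx.2]
  have hmean : ∑ c : Fin n → Fin (k - 1), (∏ v, x (c v)) *
      inducedDensity F ((⊤ : SimpleGraph (Fin (k - 1))).comap c) = PF a (k - 1) x := by
    have h := sum_prod_mul_card_embedding_comap_top F hx.2 n
    rw [hcard, show homSum F ⊤ x = _ from homSum_top_completeMultipartiteGraph a ha x] at h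
    rw [PF_eq_div_card_aut a ha, ← hF, ← hC]
    simp_rw [inducedDensity_eq, hcard, Fintype.card_fin]
    calc _ = C / n.descFactorial (∑ i, a i) * ∑ c : Fin n → Fin (k - 1), (∏ v, x (c v)) *
          (Nat.card (F ↪g (⊤ : SimpleGraph (Fin (k - 1))).comap c) : ℝ) := by
          rw [Finset.mul_sum]
          refine Finset.sum_congr rfl fun c _ => ?_
          rw [hC]
          ring
      _ = _ := by
          rw [h, div_mul_eq_mul_div, mul_left_comm, mul_div_cancel_left₀ _ hd]
  obtain ⟨c, hc⟩ : ∃ c : Fin n → Fin (k - 1), 0 < ∏ v, x (c v) := by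
    by_contra! h
    exact absurd (Finset.sum_nonpos fun c _ => h c) (by rw [hw]; norm_num)
  have hlt : ∑ c : Fin n → Fin (k - 1), (∏ v, x (c v)) *
      inducedDensity F ((⊤ : SimpleGraph (Fin (k - 1))).comap c) <
      ∑ c : Fin n → Fin (k - 1), (∏ v, x (c v)) * PF a (k - 1) x :=
    Finset.sum_lt_sum
      (fun c _ => mul_le_mul_of_nonneg_left (hcon _ (hfree c)).le
        (Finset.prod_nonneg fun v _ => hx.1 _))
      ⟨c, Finset.mem_univ c, mul_lt_mul_of_pos_left (hcon _ (hfree c)) hc⟩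
  rw [hmean, ← Finset.sum_mul, hw, one_mul] at hlt
  exact lt_irrefl _ hlt

theorem tendsto_ikn_s8 (ha : ∀ i, 1 ≤ a i) {k : ℕ} (hk : 2 ≤ k) {x : Fin (k - 1) → ℝ}
    (hx : x ∈ stdSimplex ℝ (Fin (k - 1)))
    (hmax : ∀ z ∈ stdSimplex ℝ (Fin (k - 1)), PF a (k - 1) z ≤ PF a (k - 1) x) :
    Tendsto (fun n => ikn (SimpleGraph.completeMultipartiteGraph fun i => Fin (a i)) k n) atTop
      (𝓝 (PF a (k - 1) x)) := by
  set F := SimpleGraph.completeMultipartiteGraph fun i => Fin (a i) with hF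
  have hub : ∀ n : ℕ, n ≠ 0 → ∀ v ∈ {v : ℝ | ∃ G : SimpleGraph (Fin n), G.CliqueFree k ∧
      v = inducedDensity F G},
      v ≤ PF a (k - 1) x * (n ^ (∑ i, a i) / n.descFactorial (∑ i, a i)) := by
    rintro n hn _ ⟨G, hG, rfl⟩
    exact inducedDensity_le_of_cliqueFree a ha (by omega) hmax hn hG
  have hratio : Tendsto (fun n : ℕ => PF a (k - 1) x *
      ((n : ℝ) ^ (∑ i, a i) / n.descFactorial (∑ i, a i))) atTop (𝓝 (PF a (k - 1) x)) := by
    have h := (isEquivalent_descFactorial (∑ i, a i)).symm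
    have h' := (Asymptotics.isEquivalent_iff_tendsto_one ?_).1 h
    · simpa using h'.const_mul (PF a (k - 1) x)
    · filter_upwards [eventually_ge_atTop (∑ i, a i)] with n hn
      exact_mod_cast (Nat.descFactorial_pos.2 hn).ne'
  refine tendsto_of_tendsto_of_tendsto_of_le_of_le' tendsto_const_nhds hratio ?_ ?_
  · filter_upwards [eventually_ge_atTop (∑ i, a i), eventually_ne_atTop 0] with n hn hn0
    obtain ⟨G, hG, hle⟩ := exists_cliqueFree_PF_le_inducedDensity a ha (by omega : 1 ≤ k) hx hn
    exact hle.trans (le_csSup ⟨_, hub n hn0⟩ ⟨G, hG, rfl⟩)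
  · filter_upwards [eventually_ne_atTop 0] with n hn0
    exact csSup_le ⟨_, ⊥, SimpleGraph.cliqueFree_bot hk, rfl⟩ (hub n hn0)

end Density

/-- For a complete multipartite graph `F = K_{a_1,…,a_r}` (`a_1 ≥ … ≥ a_r ≥ 1`, `r ≥ 2`)
and `k ≥ 3`, `i_k(F)` equals the maximum of the density polynomial `P_{F,k-1}` over the
standard simplex `Δ^{k-2}`. -/
theorem stmt8 {r k : ℕ} (hr : 2 ≤ r) (hk : 3 ≤ k)
    (a : Fin r → ℕ) (ha : ∀ i, 1 ≤ a i)
    (hsorted : ∀ i j : Fin r, i ≤ j → a j ≤ a i) :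
    IsGreatest {v : ℝ | ∃ x ∈ stdSimplex ℝ (Fin (k - 1)), v = PF a (k - 1) x}
      (ik (SimpleGraph.completeMultipartiteGraph fun i => Fin (a i)) k) := by
  have hne : (stdSimplex ℝ (Fin (k - 1))).Nonempty :=
    ⟨_, single_mem_stdSimplex ℝ (⟨0, by omega⟩ : Fin (k - 1))⟩
  obtain ⟨x, hx, hmax⟩ := (isCompact_stdSimplex ℝ (Fin (k - 1))).exists_isMaxOn hne
    (continuous_PF a (k - 1)).continuousOn
  rw [ik, (tendsto_ikn_s8 a ha (by omega : 2 ≤ k) hx fun z hz => hmax hz).limUnder_eq]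
  refine ⟨⟨x, hx, rfl⟩, ?_⟩
  rintro _ ⟨z, hz, rfl⟩
  exact hmax hz
end
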